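/- arXiv:2406.12401 — 4 statements merged into one kernel-verified Lean document; each statement's English description precedes it below -/
import Mathlib

section
/- Uniqueness for the multi-type Flory equation with an eventually conservative kernel: under the uniqueness hypotheses, if (μ_t)_{t≥0} and (μ̂_t)_{t≥0} are both solutions of the multi-type Flory equation with conserved quantity φ and the same initial condition μ_0, then μ_t = μ̂_t for every t ≥ 0. -/
open MeasureTheory Set

noncomputable section

/-- `K̄(x,y) := K(x,y,E)`, the total coagulation rate, as a real number. -/
def Kbar {E : Type*} [MeasurableSpace E] (K : E → E → Measure E) (x y : E) : ℝ :=
  (K x y Set.univ).toReal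

/-- `φ` is conservative with respect to the coagulation kernel `K`:
for all `x y q`, `φ(z,q) = φ(x,q) + φ(y,q)` for `K(x,y,·)`-almost all `z`. -/
def Conservative {E : Type*} [MeasurableSpace E] (K : E → E → Measure E)
    (φ : E → E → ℝ) : Prop :=
  ∀ x y q : E, ∀ᵐ z ∂(K x y), φ z q = φ x q + φ y q

/-- The sublevel set `D_r := {x ∈ E : ∫ φ(x,y) μ₀(dy) ≤ r}`. -/
def Dset {E : Type*} [MeasurableSpace E] (φ : E → E → ℝ) (μ₀ : Measure E) (r : ℝ) :
    Set E :=
  {x : E | ∫⁻ y, ENNReal.ofReal (φ x y) ∂μ₀ ≤ ENNReal.ofReal r}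

/-- `(μ_t)_{t ≥ 0}` is a solution of the multi-type Flory equation with conserved
quantity `φ` and initial condition `μ 0`:
(0) each `μ t` is a finite measure;
(i) `t ↦ μ t A` is measurable for each Borel `A`;
(ii) integrability of the loss terms against nonnegative compactly supported
continuous test functions;
(iii) the weak form of the equation for compactly supported continuous test
functions;
(iv) `∫ φ(x,u) μ_t(du) ≤ ∫ φ(x,u) μ_0(du)` for all `x` and `t ≥ 0`. -/
def IsFlorySolution {E : Type*} [MeasurableSpace E] [TopologicalSpace E]
    (K : E → E → Measure E) (φ : E → E → ℝ) (μ : ℝ → Measure E) : Prop :=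
  (∀ t : ℝ, IsFiniteMeasure (μ t)) ∧
  (∀ A : Set E, MeasurableSet A → Measurable fun t : ℝ => μ t A) ∧
  (∀ f : E → ℝ, Continuous f → HasCompactSupport f → (∀ x, 0 ≤ f x) →
    ∀ t : ℝ, 0 ≤ t →
      (∫⁻ s in Set.Ioc (0 : ℝ) t,
          ∫⁻ y, ∫⁻ x, ENNReal.ofReal (f y) * K x y Set.univ ∂(μ s) ∂(μ s)) < ⊤ ∧
      (∫⁻ s in Set.Ioc (0 : ℝ) t,
          ∫⁻ y, ∫⁻ x, ENNReal.ofReal (f y) * ENNReal.ofReal (φ x y) ∂(μ 0) ∂(μ s)) < ⊤) ∧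
  (∀ f : E → ℝ, Continuous f → HasCompactSupport f → ∀ t : ℝ, 0 ≤ t →
    ∫ y, f y ∂(μ t) = ∫ y, f y ∂(μ 0) +
      ∫ s in (0 : ℝ)..t,
        ((1 / 2) * ∫ x, ∫ y, ∫ z, f z ∂(K x y) ∂(μ s) ∂(μ s)
          - ∫ y, ∫ x, f y * Kbar K x y ∂(μ s) ∂(μ s)
          - ∫ y, ∫ x, f y * φ x y ∂(μ 0) ∂(μ s)
          + ∫ y, ∫ x, f y * φ x y ∂(μ s) ∂(μ s))) ∧
  (∀ x : E, ∀ t : ℝ, 0 ≤ t →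
    ∫⁻ u, ENNReal.ofReal (φ x u) ∂(μ t) ≤ ∫⁻ u, ENNReal.ofReal (φ x u) ∂(μ 0))

open scoped ENNReal

section Uniqueness

variable {E : Type*} [MeasurableSpace E]

section Auxiliary

/-- Iterated Bochner integrals of a nonnegative function, as iterated Lebesgue integrals. -/
lemma integral_integral_eq_toReal_lintegral {ν ρ : Measure E} [SFinite ν]
    {g : E → E → ℝ} (hg : Measurable fun p : E × E => g p.1 p.2) (hg0 : ∀ x y, 0 ≤ g x y)
    (hfin : ∫⁻ y, ∫⁻ x, ENNReal.ofReal (g x y) ∂ν ∂ρ ≠ ∞) :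
    ∫ y, ∫ x, g x y ∂ν ∂ρ = (∫⁻ y, ∫⁻ x, ENNReal.ofReal (g x y) ∂ν ∂ρ).toReal := by
  have hm : Measurable fun y => ∫⁻ x, ENNReal.ofReal (g x y) ∂ν :=
    Measurable.lintegral_prod_left' (f := fun p : E × E => ENNReal.ofReal (g p.1 p.2))
      hg.ennreal_ofReal
  rw [← integral_toReal hm.aemeasurable (ae_lt_top hm hfin)]
  refine integral_congr_ae (Filter.Eventually.of_forall fun y => ?_)
  have hgy : Measurable fun x => g x y := hg.comp (measurable_id.prodMk measurable_const)
  exact integral_eq_lintegral_of_nonneg_ae (Filter.Eventually.of_forall fun x => hg0 x y)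
    hgy.aestronglyMeasurable

lemma intervalIntegrable_toReal {F : ℝ → ℝ≥0∞} (hF : Measurable F) {t : ℝ} (ht : 0 ≤ t)
    (hfin : ∫⁻ s in Ioc 0 t, F s ≠ ∞) :
    IntervalIntegrable (fun s => (F s).toReal) volume 0 t := by
  rw [intervalIntegrable_iff_integrableOn_Ioc_of_le ht]
  exact integrable_toReal_of_lintegral_ne_top hF.aemeasurable hfin

lemma intervalIntegral_toReal {F : ℝ → ℝ≥0∞} (hF : Measurable F) {t : ℝ} (ht : 0 ≤ t)
    (hfin : ∫⁻ s in Ioc 0 t, F s ≠ ∞) :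
    ∫ s in (0 : ℝ)..t, (F s).toReal = (∫⁻ s in Ioc 0 t, F s).toReal := by
  rw [intervalIntegral.integral_of_le ht]
  exact integral_toReal hF.aemeasurable (ae_lt_top hF hfin)

lemma measurable_prod_self {μ : ℝ → Measure E} (hfin : ∀ t, IsFiniteMeasure (μ t))
    (hmeas : Measurable μ) : Measurable fun s => (μ s).prod (μ s) := by
  refine Measurable.measure_of_isPiSystem generateFrom_prod.symm isPiSystem_prod ?_ ?_
  · rintro _ ⟨A, hA, B, hB, rfl⟩
    simp only [Measure.prod_prod]
    exact ((Measure.measurable_coe hA).comp hmeas).mul ((Measure.measurable_coe hB).comp hmeas)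
  · rw [← Set.univ_prod_univ]
    simp only [Measure.prod_prod]
    exact ((Measure.measurable_coe .univ).comp hmeas).mul
      ((Measure.measurable_coe .univ).comp hmeas)

/-- If `μ ≤ ν + ε` on measurable subsets of `D`, the same holds for integrals of functions
bounded by `C` and vanishing outside `D`, with error `C * ε`. -/
lemma lintegral_le_add_of_measure_le {μ ν : Measure E} {D : Set E}
    {ε : ℝ≥0∞} {C : ℝ} (hC : 0 ≤ C)
    (h : ∀ A ⊆ D, MeasurableSet A → μ A ≤ ν A + ε) {g : E → ℝ≥0∞} (hg : Measurable g)
    (hgC : ∀ x, g x ≤ ENNReal.ofReal C) (hgD : ∀ x ∉ D, g x = 0) :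
    ∫⁻ x, g x ∂μ ≤ ∫⁻ x, g x ∂ν + ENNReal.ofReal C * ε := by
  have hgtop : ∀ x, g x ≠ ∞ := fun x => ((hgC x).trans_lt ENNReal.ofReal_lt_top).ne
  have key : ∀ ρ : Measure E,
      ∫⁻ x, g x ∂ρ = ∫⁻ r in Ioc 0 C, ρ {x | r < (g x).toReal} := by
    intro ρ
    have h1 := lintegral_eq_lintegral_meas_lt ρ (f := fun x => (g x).toReal)
      (Filter.Eventually.of_forall fun x => ENNReal.toReal_nonneg)
      hg.ennreal_toReal.aemeasurable
    simp only [ENNReal.ofReal_toReal (hgtop _)] at h1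
    rw [h1, ← Ioc_union_Ioi_eq_Ioi hC, lintegral_union measurableSet_Ioi]
    · rw [setLIntegral_congr_fun (g := fun _ => 0) measurableSet_Ioi]
      · simp
      · intro r hr
        have : {x | r < (g x).toReal} = ∅ := by
          ext x
          simp only [mem_ofPred_eq, mem_empty_iff_false, iff_false, not_lt]
          exact (ENNReal.toReal_le_of_le_ofReal hC (hgC x)).trans (le_of_lt hr)
        simp [this]
    · exact Set.disjoint_left.2 fun r hr hr' => absurd hr.2 (not_le.2 hr')
  rw [key, key]
  calc ∫⁻ r in Ioc 0 C, μ {x | r < (g x).toReal}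
      ≤ ∫⁻ r in Ioc 0 C, (ν {x | r < (g x).toReal} + ε) := by
        refine setLIntegral_mono' measurableSet_Ioc fun r hr => h _ ?_ ?_
        · intro x hx
          by_contra hxD
          rw [mem_ofPred_eq, hgD x hxD] at hx
          exact absurd hx (not_lt.2 hr.1.le)
        · exact measurableSet_lt measurable_const hg.ennreal_toReal
    _ = _ := by
        rw [lintegral_add_right _ measurable_const]
        simp [mul_comm]

/-- Comparison of quadratic functionals of two measures close to each other on `D`. -/
lemma lintegral_lintegral_le_add_of_measure_le {μ ν : Measure E} [SFinite μ] [SFinite ν]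
    {D : Set E} {ε : ℝ≥0∞} {C : ℝ} (hC : 0 ≤ C)
    (h : ∀ A ⊆ D, MeasurableSet A → μ A ≤ ν A + ε) {g : E × E → ℝ≥0∞} (hg : Measurable g)
    (hgμ : ∀ x ∈ D, ∫⁻ y, g (x, y) ∂μ ≤ ENNReal.ofReal C)
    (hgν : ∀ y ∈ D, ∫⁻ x, g (x, y) ∂ν ≤ ENNReal.ofReal C)
    (hgD : ∀ x y, x ∉ D ∨ y ∉ D → g (x, y) = 0) :
    ∫⁻ p, g p ∂(μ.prod μ) ≤ ∫⁻ p, g p ∂(ν.prod ν) + ENNReal.ofReal (2 * C) * ε := by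
  have hzl : ∀ x ∉ D, ∫⁻ y, g (x, y) ∂μ = 0 := fun x hx => by simp [hgD x _ (Or.inl hx)]
  have hzr : ∀ y ∉ D, ∫⁻ x, g (x, y) ∂ν = 0 := fun y hy => by simp [hgD _ y (Or.inr hy)]
  have hl := lintegral_le_add_of_measure_le hC h (hg.lintegral_prod_right' (ν := μ))
    (fun x => by
      by_cases hx : x ∈ D
      · exact hgμ x hx
      · simp [hzl x hx]) hzl
  have hr := lintegral_le_add_of_measure_le hC h (hg.lintegral_prod_left' (μ := ν))
    (fun y => by
      by_cases hy : y ∈ D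
      · exact hgν y hy
      · simp [hzr y hy]) hzr
  calc ∫⁻ p, g p ∂(μ.prod μ) = ∫⁻ x, ∫⁻ y, g (x, y) ∂μ ∂μ := lintegral_prod _ hg.aemeasurable
    _ ≤ ∫⁻ x, ∫⁻ y, g (x, y) ∂μ ∂ν + ENNReal.ofReal C * ε := hl
    _ = ∫⁻ y, ∫⁻ x, g (x, y) ∂ν ∂μ + ENNReal.ofReal C * ε := by
        rw [lintegral_lintegral_swap (f := fun x y => g (x, y)) hg.aemeasurable]
    _ ≤ (∫⁻ y, ∫⁻ x, g (x, y) ∂ν ∂ν + ENNReal.ofReal C * ε) + ENNReal.ofReal C * ε := by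
        gcongr
    _ = ∫⁻ p, g p ∂(ν.prod ν) + ENNReal.ofReal (2 * C) * ε := by
        rw [lintegral_prod_symm' _ hg, add_assoc, ← add_mul, two_mul, ENNReal.ofReal_add hC hC]

lemma setLIntegral_pow_div_factorial {C M t : ℝ} (hC : 0 ≤ C) (hM : 0 ≤ M) (ht : 0 ≤ t) (n : ℕ) :
    ∫⁻ s in Ioc 0 t, ENNReal.ofReal C * ENNReal.ofReal (M * ((C * s) ^ n / n.factorial)) =
      ENNReal.ofReal (M * ((C * t) ^ (n + 1) / (n + 1).factorial)) := by
  have h1 : ∀ s ∈ Ioc 0 t, ENNReal.ofReal C * ENNReal.ofReal (M * ((C * s) ^ n / n.factorial)) =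
      ENNReal.ofReal ((C * M * C ^ n / n.factorial) * s ^ n) := fun s hs => by
    rw [← ENNReal.ofReal_mul hC]
    congr 1
    rw [mul_pow]
    ring
  rw [setLIntegral_congr_fun measurableSet_Ioc h1, ← ofReal_integral_eq_lintegral_ofReal,
    ← intervalIntegral.integral_of_le ht, intervalIntegral.integral_const_mul, integral_pow]
  · congr 1
    rw [Nat.factorial_succ, mul_pow]
    push_cast
    field_simp
    simp
    ring
  · exact (Continuous.integrableOn_Icc (by fun_prop)).mono_set Ioc_subset_Icc_self
  · exact (ae_restrict_iff' measurableSet_Ioc).2 (Filter.Eventually.of_forall fun s hs => by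
      have := hs.1.le
      positivity)

lemma measure_le_lintegral_ofReal {ρ : Measure E} {f : E → ℝ} {C : Set E}
    (hC : MeasurableSet C) (hfC : EqOn f 1 C) : ρ C ≤ ∫⁻ x, ENNReal.ofReal (f x) ∂ρ := by
  rw [← setLIntegral_one]
  calc ∫⁻ _ in C, 1 ∂ρ = ∫⁻ x in C, ENNReal.ofReal (f x) ∂ρ :=
        setLIntegral_congr_fun hC fun x hx => by simp [hfC hx]
    _ ≤ _ := setLIntegral_le_lintegral _ _

lemma lintegral_ofReal_le_measure {ρ : Measure E} {f : E → ℝ} {C : Set E}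
    (hC : MeasurableSet C) (hf : ∀ x, f x ∈ Icc (0 : ℝ) 1) (hfC : EqOn f 0 Cᶜ) :
    ∫⁻ x, ENNReal.ofReal (f x) ∂ρ ≤ ρ C := by
  rw [← lintegral_indicator_one hC]
  refine lintegral_mono fun x => ?_
  by_cases hx : x ∈ C
  · simpa [hx] using (hf x).2
  · simp [hfC hx]

end Auxiliary

/-- Comparison of two balance equations `mass + losses = initial mass + gains`. -/
lemma le_add_of_balance_eq {m m' z P Q S U P' Q' S' U' a b c d : ℝ≥0∞}
    (h : m + (P + Q) = z + (2⁻¹ * S + U)) (h' : m' + (P' + Q') = z + (2⁻¹ * S' + U'))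
    (hfin : P + Q ≠ ∞) (hS : S ≤ S' + 2 * a) (hU : U ≤ U' + b) (hP : P' ≤ P + c)
    (hQ : Q' ≤ Q + d) : m ≤ m' + (a + b + c + d) := by
  have htwo : (2⁻¹ : ℝ≥0∞) * (2 * a) = a := by
    rw [← mul_assoc, ENNReal.inv_mul_cancel (by simp) (by simp), one_mul]
  refine (ENNReal.add_le_add_iff_right hfin).1 ?_
  calc m + (P + Q) = z + (2⁻¹ * S + U) := h
    _ ≤ z + (2⁻¹ * (S' + 2 * a) + (U' + b)) := by gcongr
    _ = m' + (P' + Q') + (a + b) := by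
        rw [h', mul_add, htwo]
        ring
    _ ≤ m' + ((P + c) + (Q + d)) + (a + b) := by gcongr
    _ = m' + (a + b + c + d) + (P + Q) := by ring

section TimeIntegrals

/-- The measure `∫₀ᵗ μ_s ds`. -/
def timeMeasure (μ : ℝ → Measure E) (t : ℝ) : Measure E :=
  (volume.restrict (Ioc 0 t)).bind μ

/-- The measure `∫₀ᵗ μ_s ⊗ μ_s ds`. -/
def timePairMeasure (μ : ℝ → Measure E) (t : ℝ) : Measure (E × E) :=
  (volume.restrict (Ioc 0 t)).bind fun s => (μ s).prod (μ s)

/-- The measure `∫₀ᵗ ∫∫ K(x,y,·) μ_s(dx) μ_s(dy) ds` of coagulated particles. -/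
def gainMeasure (K : E → E → Measure E) (μ : ℝ → Measure E) (t : ℝ) : Measure E :=
  (timePairMeasure μ t).bind fun p => K p.1 p.2

/-- The measure `∫₀ᵗ ∫ h(x,·) μ_s(dx) μ_s ds` of particles removed at pair rate `h`. -/
def pairLossMeasure (h : E × E → ℝ≥0∞) (μ : ℝ → Measure E) (t : ℝ) : Measure E :=
  ((timePairMeasure μ t).withDensity h).map Prod.snd

variable {μ : ℝ → Measure E} {t : ℝ}

lemma lintegral_timeMeasure (hmeas : Measurable μ) {f : E → ℝ≥0∞} (hf : Measurable f) :
    ∫⁻ y, f y ∂(timeMeasure μ t) = ∫⁻ s in Ioc 0 t, ∫⁻ y, f y ∂(μ s) :=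
  Measure.lintegral_bind hmeas.aemeasurable hf.aemeasurable

lemma lintegral_timePairMeasure (hfin : ∀ s, IsFiniteMeasure (μ s)) (hmeas : Measurable μ)
    {f : E × E → ℝ≥0∞} (hf : Measurable f) :
    ∫⁻ p, f p ∂(timePairMeasure μ t) = ∫⁻ s in Ioc 0 t, ∫⁻ p, f p ∂((μ s).prod (μ s)) :=
  Measure.lintegral_bind (measurable_prod_self hfin hmeas).aemeasurable hf.aemeasurable

lemma lintegral_gainMeasure {K : E → E → Measure E}
    (hK : Measurable fun p : E × E => K p.1 p.2)
    (hfin : ∀ s, IsFiniteMeasure (μ s)) (hmeas : Measurable μ)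
    {f : E → ℝ≥0∞} (hf : Measurable f) :
    ∫⁻ z, f z ∂(gainMeasure K μ t) =
      ∫⁻ s in Ioc 0 t, ∫⁻ p, ∫⁻ z, f z ∂(K p.1 p.2) ∂((μ s).prod (μ s)) := by
  rw [gainMeasure, Measure.lintegral_bind hK.aemeasurable hf.aemeasurable]
  exact lintegral_timePairMeasure hfin hmeas ((Measure.measurable_lintegral hf).comp hK)

lemma lintegral_pairLossMeasure (hfin : ∀ s, IsFiniteMeasure (μ s)) (hmeas : Measurable μ)
    {h : E × E → ℝ≥0∞} (hh : Measurable h) {f : E → ℝ≥0∞} (hf : Measurable f) :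
    ∫⁻ y, f y ∂(pairLossMeasure h μ t) =
      ∫⁻ s in Ioc 0 t, ∫⁻ p, f p.2 * h p ∂((μ s).prod (μ s)) := by
  rw [pairLossMeasure, lintegral_map hf measurable_snd,
    lintegral_withDensity_eq_lintegral_mul _ hh (g := fun p : E × E => f p.2)
      (hf.comp measurable_snd)]
  simp only [Pi.mul_apply, mul_comm (h _)]
  exact lintegral_timePairMeasure hfin hmeas ((hf.comp measurable_snd).mul hh)

lemma lintegral_timeMeasure_withDensity (hmeas : Measurable μ)
    {h : E → ℝ≥0∞} (hh : Measurable h) {f : E → ℝ≥0∞} (hf : Measurable f) :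
    ∫⁻ y, f y ∂((timeMeasure μ t).withDensity h) =
      ∫⁻ s in Ioc 0 t, ∫⁻ y, f y * h y ∂(μ s) := by
  rw [lintegral_withDensity_eq_lintegral_mul _ hh hf]
  simp only [Pi.mul_apply, mul_comm (h _)]
  exact lintegral_timeMeasure hmeas (hf.mul hh)

end TimeIntegrals

/-- The total coagulation rate, with values in `[0, ∞]`. -/
def totalRate (K : E → E → Measure E) (p : E × E) : ℝ≥0∞ := K p.1 p.2 univ

/-- The function `φ`, with values in `[0, ∞]`. -/
def conservedRate (φ : E → E → ℝ) (p : E × E) : ℝ≥0∞ := ENNReal.ofReal (φ p.1 p.2)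

/-- The conserved quantity `∫ φ(x,·) μ₀(dx)`, with values in `[0, ∞]`. -/
def conservedSize (φ : E → E → ℝ) (μ₀ : Measure E) (y : E) : ℝ≥0∞ :=
  ∫⁻ x, ENNReal.ofReal (φ x y) ∂μ₀

lemma measurable_totalRate {K : E → E → Measure E}
    (hK : Measurable fun p : E × E => K p.1 p.2) : Measurable (totalRate K) :=
  (Measure.measurable_coe .univ).comp hK

lemma measurable_conservedSize {φ : E → E → ℝ} (hφ : Measurable fun p : E × E => φ p.1 p.2)
    (μ₀ : Measure E) [SFinite μ₀] : Measurable (conservedSize φ μ₀) :=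
  Measurable.lintegral_prod_left' (f := fun p : E × E => ENNReal.ofReal (φ p.1 p.2))
    hφ.ennreal_ofReal

namespace IsFlorySolution

variable [TopologicalSpace E] {K : E → E → Measure E} {φ : E → E → ℝ} {μ : ℝ → Measure E}

lemma measurable (hμ : IsFlorySolution K φ μ) : Measurable μ :=
  Measure.measurable_of_measurable_coe _ hμ.2.1

lemma lintegral_totalLoss_lt_top (hμ : IsFlorySolution K φ μ)
    (hK : Measurable fun p : E × E => K p.1 p.2) [OpensMeasurableSpace E]
    {f : E → ℝ} (hf : Continuous f) (hfs : HasCompactSupport f) (hf0 : ∀ x, 0 ≤ f x)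
    {t : ℝ} (ht : 0 ≤ t) :
    ∫⁻ y, ENNReal.ofReal (f y) ∂(pairLossMeasure (totalRate K) μ t) < ∞ := by
  have hfm := hf.measurable.ennreal_ofReal
  rw [lintegral_pairLossMeasure hμ.1 hμ.measurable (measurable_totalRate hK) hfm]
  convert (hμ.2.2.1 f hf hfs hf0 t ht).1 using 2
  have := hμ.1
  ext s
  exact lintegral_prod_symm' _ ((hfm.comp measurable_snd).mul (measurable_totalRate hK))

lemma lintegral_sizeLoss_lt_top (hμ : IsFlorySolution K φ μ)
    (hφ : Measurable fun p : E × E => φ p.1 p.2) [OpensMeasurableSpace E]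
    {f : E → ℝ} (hf : Continuous f) (hfs : HasCompactSupport f) (hf0 : ∀ x, 0 ≤ f x)
    {t : ℝ} (ht : 0 ≤ t) :
    ∫⁻ y, ENNReal.ofReal (f y) ∂((timeMeasure μ t).withDensity (conservedSize φ (μ 0))) < ∞ := by
  have hfm := hf.measurable.ennreal_ofReal
  have := hμ.1
  rw [lintegral_timeMeasure_withDensity hμ.measurable (measurable_conservedSize hφ _) hfm]
  convert (hμ.2.2.1 f hf hfs hf0 t ht).2 using 2
  ext s
  refine lintegral_congr fun y => ?_
  exact (lintegral_const_mul' _ _ ENNReal.ofReal_ne_top).symm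

lemma lintegral_conservedRate_le (hμ : IsFlorySolution K φ μ) (hφs : ∀ x y, φ x y = φ y x)
    {s : ℝ} (hs : 0 ≤ s) (y : E) :
    ∫⁻ x, conservedRate φ (x, y) ∂(μ s) ≤ conservedSize φ (μ 0) y := by
  simpa only [conservedRate, conservedSize, hφs _ y] using hμ.2.2.2.2 y s hs

/-- The mass reinjected through `φ` is dominated by the mass removed through the conserved
quantity. -/
lemma pairLossMeasure_conservedRate_le (hμ : IsFlorySolution K φ μ)
    (hφ : Measurable fun p : E × E => φ p.1 p.2) (hφs : ∀ x y, φ x y = φ y x)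
    {f : E → ℝ≥0∞} (hf : Measurable f) (t : ℝ) :
    ∫⁻ y, f y ∂(pairLossMeasure (conservedRate φ) μ t) ≤
      ∫⁻ y, f y ∂((timeMeasure μ t).withDensity (conservedSize φ (μ 0))) := by
  have := hμ.1
  have hφm : Measurable (conservedRate φ) := hφ.ennreal_ofReal
  rw [lintegral_pairLossMeasure hμ.1 hμ.measurable hφm hf,
    lintegral_timeMeasure_withDensity hμ.measurable (measurable_conservedSize hφ _) hf]
  refine setLIntegral_mono' measurableSet_Ioc fun s hs => ?_
  rw [lintegral_prod_symm' (fun p : E × E => f p.2 * conservedRate φ p)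
    ((hf.comp measurable_snd).mul hφm)]
  refine lintegral_mono fun y => ?_
  rw [lintegral_const_mul (f y) (f := fun x => conservedRate φ (x, y))
    (hφm.comp (measurable_id.prodMk measurable_const))]
  exact mul_le_mul_right (hμ.lintegral_conservedRate_le hφs hs.1.le y) _

/-- The weak equation for a nonnegative test function with finite gain term, with all terms
expressed by Lebesgue integrals. -/
lemma lintegral_eq (hμ : IsFlorySolution K φ μ) [OpensMeasurableSpace E]
    (hK : Measurable fun p : E × E => K p.1 p.2) (hKfin : ∀ x y, IsFiniteMeasure (K x y))
    (hφ : Measurable fun p : E × E => φ p.1 p.2) (hφ0 : ∀ x y, 0 ≤ φ x y)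
    (hφs : ∀ x y, φ x y = φ y x)
    {f : E → ℝ} (hf : Continuous f) (hfs : HasCompactSupport f) (hf0 : ∀ x, 0 ≤ f x)
    {t : ℝ} (ht : 0 ≤ t)
    (hgain : ∫⁻ z, ENNReal.ofReal (f z) ∂(gainMeasure K μ t) ≠ ∞) :
    ∫⁻ y, ENNReal.ofReal (f y) ∂(μ t) +
        ∫⁻ y, ENNReal.ofReal (f y) ∂(pairLossMeasure (totalRate K) μ t) +
        ∫⁻ y, ENNReal.ofReal (f y) ∂((timeMeasure μ t).withDensity (conservedSize φ (μ 0))) =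
      ∫⁻ y, ENNReal.ofReal (f y) ∂(μ 0) +
        2⁻¹ * ∫⁻ z, ENNReal.ofReal (f z) ∂(gainMeasure K μ t) +
        ∫⁻ y, ENNReal.ofReal (f y) ∂(pairLossMeasure (conservedRate φ) μ t) := by
  have hfin := hμ.1
  have hμm := hμ.measurable
  have hpm := measurable_prod_self hfin hμm
  have hfm : Measurable f := hf.measurable
  have hfe := hfm.ennreal_ofReal
  have hκ := measurable_totalRate hK
  have hφm : Measurable (conservedRate φ) := hφ.ennreal_ofReal
  have hψ := measurable_conservedSize hφ (μ 0)
  have hL1 := (hμ.lintegral_totalLoss_lt_top hK hf hfs hf0 ht).ne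
  have hL2 := (hμ.lintegral_sizeLoss_lt_top hφ hf hfs hf0 ht).ne
  have hL3 := ((hμ.pairLossMeasure_conservedRate_le hφ hφs hfe t).trans_lt hL2.lt_top).ne
  have hf_ne_top : ∀ s, ∫⁻ y, ENNReal.ofReal (f y) ∂(μ s) ≠ ∞ := fun s =>
    (hf.integrable_of_hasCompactSupport hfs).lintegral_lt_top.ne
  have hf_integral : ∀ s, ∫ y, f y ∂(μ s) = (∫⁻ y, ENNReal.ofReal (f y) ∂(μ s)).toReal := fun s =>
    integral_eq_lintegral_of_nonneg_ae (Filter.Eventually.of_forall hf0)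
      hfm.aestronglyMeasurable
  have heq := hμ.2.2.2.1 f hf hfs t ht
  rw [hf_integral, hf_integral] at heq
  rw [lintegral_gainMeasure hK hfin hμm hfe] at hgain ⊢
  rw [lintegral_pairLossMeasure hfin hμm hκ hfe] at hL1 ⊢
  rw [lintegral_pairLossMeasure hfin hμm hφm hfe] at hL3 ⊢
  rw [lintegral_timeMeasure_withDensity hμm hψ hfe] at hL2 ⊢
  have hGm : Measurable fun p : E × E => ∫⁻ z, ENNReal.ofReal (f z) ∂(K p.1 p.2) :=
    (Measure.measurable_lintegral hfe).comp hK
  have hfκ : Measurable fun p : E × E => ENNReal.ofReal (f p.2) * totalRate K p :=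
    (hfe.comp measurable_snd).mul hκ
  have hfφ : Measurable fun p : E × E => ENNReal.ofReal (f p.2) * conservedRate φ p :=
    (hfe.comp measurable_snd).mul hφm
  set G := fun s => ∫⁻ p, ∫⁻ z, ENNReal.ofReal (f z) ∂(K p.1 p.2) ∂((μ s).prod (μ s)) with hG
  set L1 := fun s => ∫⁻ p, ENNReal.ofReal (f p.2) * totalRate K p ∂((μ s).prod (μ s)) with hL1d
  set L3 := fun s => ∫⁻ p, ENNReal.ofReal (f p.2) * conservedRate φ p ∂((μ s).prod (μ s)) with hL3d
  set L2 := fun s => ∫⁻ y, ENNReal.ofReal (f y) * conservedSize φ (μ 0) y ∂(μ s) with hL2d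
  have mG : Measurable G := (Measure.measurable_lintegral hGm).comp hpm
  have mL1 : Measurable L1 := (Measure.measurable_lintegral hfκ).comp hpm
  have mL3 : Measurable L3 := (Measure.measurable_lintegral hfφ).comp hpm
  have mL2 : Measurable L2 := (Measure.measurable_lintegral (hfe.mul hψ)).comp hμm
  have hae : ∀ᵐ s ∂(volume.restrict (uIoc 0 t)),
      (1 / 2) * ∫ x, ∫ y, ∫ z, f z ∂(K x y) ∂(μ s) ∂(μ s)
          - ∫ y, ∫ x, f y * Kbar K x y ∂(μ s) ∂(μ s)
          - ∫ y, ∫ x, f y * φ x y ∂(μ 0) ∂(μ s)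
          + ∫ y, ∫ x, f y * φ x y ∂(μ s) ∂(μ s) =
        (1 / 2) * (G s).toReal - (L1 s).toReal - (L2 s).toReal + (L3 s).toReal := by
    rw [uIoc_of_le ht]
    filter_upwards [ae_lt_top mG hgain, ae_lt_top mL1 hL1, ae_lt_top mL2 hL2,
      ae_lt_top mL3 hL3] with s h1 h2 h3 h4
    have hinner : ∀ p : E × E, ∫ z, f z ∂(K p.1 p.2) =
        (∫⁻ z, ENNReal.ofReal (f z) ∂(K p.1 p.2)).toReal := fun p =>
      integral_eq_lintegral_of_nonneg_ae (Filter.Eventually.of_forall hf0)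
        hfm.aestronglyMeasurable
    have hinner' : ∀ p : E × E, ENNReal.ofReal (∫ z, f z ∂(K p.1 p.2)) =
        ∫⁻ z, ENNReal.ofReal (f z) ∂(K p.1 p.2) := fun p =>
      ofReal_integral_eq_lintegral_ofReal (hf.integrable_of_hasCompactSupport hfs)
        (Filter.Eventually.of_forall hf0)
    congr 1
    · congr 1
      · congr 1
        · congr 1
          have e : G s = ∫⁻ x, ∫⁻ y, ENNReal.ofReal (∫ z, f z ∂(K x y)) ∂(μ s) ∂(μ s) := by
            rw [hG]
            simp only
            rw [lintegral_prod _ hGm.aemeasurable]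
            exact lintegral_congr fun x => lintegral_congr fun y => (hinner' (x, y)).symm
          rw [e]
          refine integral_integral_eq_toReal_lintegral (g := fun y x => ∫ z, f z ∂(K x y))
            ?_ (fun y x => integral_nonneg hf0) (e ▸ h1.ne)
          have : Measurable fun p : E × E => ∫ z, f z ∂(K p.1 p.2) := by
            simp only [hinner]
            exact hGm.ennreal_toReal
          exact this.comp measurable_swap
        · have e : L1 s = ∫⁻ y, ∫⁻ x, ENNReal.ofReal (f y * Kbar K x y) ∂(μ s) ∂(μ s) := by
            rw [hL1d]
            simp only
            rw [lintegral_prod_symm' _ hfκ]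
            refine lintegral_congr fun y => lintegral_congr fun x => ?_
            rw [ENNReal.ofReal_mul (hf0 y), Kbar, ENNReal.ofReal_toReal (measure_ne_top _ _)]
            rfl
          rw [e]
          exact integral_integral_eq_toReal_lintegral (g := fun x y => f y * Kbar K x y)
            ((hfm.comp measurable_snd).mul hκ.ennreal_toReal)
            (fun x y => mul_nonneg (hf0 y) ENNReal.toReal_nonneg) (e ▸ h2.ne)
      · have e : L2 s = ∫⁻ y, ∫⁻ x, ENNReal.ofReal (f y * φ x y) ∂(μ 0) ∂(μ s) := by
          rw [hL2d]
          refine lintegral_congr fun y => ?_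
          simp only [ENNReal.ofReal_mul (hf0 y)]
          exact (lintegral_const_mul' _ _ ENNReal.ofReal_ne_top).symm
        rw [e]
        exact integral_integral_eq_toReal_lintegral (g := fun x y => f y * φ x y)
          ((hfm.comp measurable_snd).mul hφ)
          (fun x y => mul_nonneg (hf0 y) (hφ0 x y)) (e ▸ h3.ne)
    · have e : L3 s = ∫⁻ y, ∫⁻ x, ENNReal.ofReal (f y * φ x y) ∂(μ s) ∂(μ s) := by
        rw [hL3d]
        simp only
        rw [lintegral_prod_symm' _ hfφ]
        refine lintegral_congr fun y => lintegral_congr fun x => ?_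
        rw [ENNReal.ofReal_mul (hf0 y)]
        rfl
      rw [e]
      exact integral_integral_eq_toReal_lintegral (g := fun x y => f y * φ x y)
        ((hfm.comp measurable_snd).mul hφ)
        (fun x y => mul_nonneg (hf0 y) (hφ0 x y)) (e ▸ h4.ne)
  have iG := intervalIntegrable_toReal mG ht hgain
  have iL1 := intervalIntegrable_toReal mL1 ht hL1
  have iL2 := intervalIntegrable_toReal mL2 ht hL2
  have iL3 := intervalIntegrable_toReal mL3 ht hL3
  have eG := intervalIntegral_toReal mG ht hgain
  have eL1 := intervalIntegral_toReal mL1 ht hL1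
  have eL2 := intervalIntegral_toReal mL2 ht hL2
  have eL3 := intervalIntegral_toReal mL3 ht hL3
  rw [intervalIntegral.integral_congr_ae_restrict hae,
    intervalIntegral.integral_add (((iG.const_mul _).sub iL1).sub iL2) iL3,
    intervalIntegral.integral_sub ((iG.const_mul _).sub iL1) iL2,
    intervalIntegral.integral_sub (iG.const_mul _) iL1,
    intervalIntegral.integral_const_mul] at heq
  have h2 : (2⁻¹ : ℝ≥0∞) ≠ ∞ := by simp
  refine (ENNReal.toReal_eq_toReal_iff' ?_ ?_).1 ?_
  · exact ENNReal.add_ne_top.2 ⟨ENNReal.add_ne_top.2 ⟨hf_ne_top t, hL1⟩, hL2⟩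
  · exact ENNReal.add_ne_top.2
      ⟨ENNReal.add_ne_top.2 ⟨hf_ne_top 0, ENNReal.mul_ne_top h2 hgain⟩, hL3⟩
  · rw [ENNReal.toReal_add (ENNReal.add_ne_top.2 ⟨hf_ne_top t, hL1⟩) hL2,
      ENNReal.toReal_add (hf_ne_top t) hL1,
      ENNReal.toReal_add (ENNReal.add_ne_top.2 ⟨hf_ne_top 0, ENNReal.mul_ne_top h2 hgain⟩) hL3,
      ENNReal.toReal_add (hf_ne_top 0) (ENNReal.mul_ne_top h2 hgain), ENNReal.toReal_mul]
    rw [← eG, ← eL1, ← eL2, ← eL3, heq]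
    simp
    ring

end IsFlorySolution

section LocalFiniteness

open scoped Topology

lemma isLocallyFiniteMeasure_add [TopologicalSpace E] (ρ ρ' : Measure E)
    [IsLocallyFiniteMeasure ρ] [IsLocallyFiniteMeasure ρ'] : IsLocallyFiniteMeasure (ρ + ρ') := by
  refine ⟨fun x => ?_⟩
  obtain ⟨U, hU, hUfin⟩ := ρ.finiteAt_nhds x
  obtain ⟨V, hV, hVfin⟩ := ρ'.finiteAt_nhds x
  refine ⟨U ∩ V, Filter.inter_mem hU hV, ?_⟩
  rw [Measure.add_apply]
  exact ENNReal.add_lt_top.2 ⟨(measure_mono inter_subset_left).trans_lt hUfin,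
    (measure_mono inter_subset_right).trans_lt hVfin⟩

variable {X : Type*} [MetricSpace X] [MeasurableSpace X] [BorelSpace X] [LocallyCompactSpace X]

lemma isLocallyFiniteMeasure_of_lintegral_lt_top {ρ : Measure X}
    (h : ∀ f : X → ℝ, Continuous f → HasCompactSupport f → (∀ x, 0 ≤ f x) →
      ∫⁻ x, ENNReal.ofReal (f x) ∂ρ < ∞) : IsLocallyFiniteMeasure ρ := by
  have : IsFiniteMeasureOnCompacts ρ := ⟨fun C hC => by
    obtain ⟨f, hf1, -, hfs, hf⟩ :=
      exists_continuous_one_zero_of_isCompact hC isClosed_empty (disjoint_empty C)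
    exact (measure_le_lintegral_ofReal hC.measurableSet hf1).trans_lt
      (h f f.continuous hfs fun x => (hf x).1)⟩
  exact isLocallyFiniteMeasure_of_isFiniteMeasureOnCompacts

/-- A measure finite on each set of a countable closed cover is locally finite if it is dominated
by a locally finite measure on those test functions which it integrates. -/
lemma isLocallyFiniteMeasure_of_lintegral_le {Γ ρ : Measure X} [IsLocallyFiniteMeasure ρ]
    (hle : ∀ f : X → ℝ, Continuous f → HasCompactSupport f → (∀ x, 0 ≤ f x) →
      ∫⁻ x, ENNReal.ofReal (f x) ∂Γ ≠ ∞ →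
      ∫⁻ x, ENNReal.ofReal (f x) ∂Γ ≤ ∫⁻ x, ENNReal.ofReal (f x) ∂ρ)
    {C : ℕ → Set X} (hC : ∀ n, IsClosed (C n)) (hCfin : ∀ n, Γ (C n) < ∞)
    (hcover : ⋃ n, C n = univ) : IsLocallyFiniteMeasure Γ := by
  set G : Set X := {x | ∃ U, IsOpen U ∧ x ∈ U ∧ Γ U < ∞} with hG
  have hGopen : IsOpen G := by
    rw [isOpen_iff_forall_mem_open]
    rintro x ⟨U, hU, hxU, hfin⟩
    exact ⟨U, fun y hy => ⟨U, hU, hy, hfin⟩, hU, hxU⟩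
  have hGcompact : ∀ k ⊆ G, IsCompact k → Γ k < ∞ := fun k hk hkc =>
    hkc.measure_lt_top_of_nhdsWithin fun x hx => by
      obtain ⟨U, hU, hxU, hfin⟩ := hk hx
      exact ⟨U, mem_nhdsWithin_of_mem_nhds (hU.mem_nhds hxU), hfin⟩
  suffices hGuniv : Gᶜ = ∅ by
    refine ⟨fun x => ?_⟩
    have hx : x ∈ G := by
      by_contra hx
      exact (hGuniv ▸ (show x ∈ Gᶜ from hx) : x ∈ (∅ : Set X))
    obtain ⟨U, hU, hxU, hfin⟩ := hx
    exact ⟨U, hU.mem_nhds hxU, hfin⟩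
  by_contra hne
  have : Nonempty ↥Gᶜ := (nonempty_iff_ne_empty.2 hne).to_subtype
  have : LocallyCompactSpace ↥Gᶜ :=
    hGopen.isClosed_compl.isClosedEmbedding_subtypeVal.locallyCompactSpace
  obtain ⟨n, ⟨x₀, hx₀⟩, hxint⟩ := nonempty_interior_of_iUnion_of_closed
    (f := fun n => (Subtype.val ⁻¹' C n : Set ↥Gᶜ))
    (fun n => (hC n).preimage continuous_subtype_val)
    (by rw [← preimage_iUnion, hcover, preimage_univ])
  obtain ⟨V', hV'sub, hV'open, hxV'⟩ := mem_interior.1 hxint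
  obtain ⟨V, hVopen, rfl⟩ := isOpen_induced_iff.1 hV'open
  obtain ⟨W', hW', hxW', -⟩ := exists_compact_subset hVopen hxV'
  obtain ⟨W, hW, hxW, hWsub⟩ :=
    exists_compact_subset (hVopen.inter isOpen_interior) ⟨hxV', hxW'⟩
  refine hx₀ ⟨interior W, isOpen_interior, hxW, ?_⟩
  obtain ⟨F, hFclosed, hFsub, hFU, hFmono⟩ := hGopen.exists_iUnion_isClosed
  have hbound : ∀ i, Γ (W ∩ F i) ≤ ρ W' := by
    intro i
    have hWF : IsCompact (W ∩ F i) := hW.inter_right (hFclosed i)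
    obtain ⟨k, hk, hkint, hksub⟩ := exists_compact_between hWF
      (hGopen.inter isOpen_interior)
      (show W ∩ F i ⊆ G ∩ interior W' from fun x hx => ⟨hFsub i hx.2, (hWsub hx.1).2⟩)
    obtain ⟨g, hg1, hg0, hgs, hg⟩ := exists_continuous_one_zero_of_isCompact hWF
      isOpen_interior.isClosed_compl (disjoint_compl_right_iff_subset.2 hkint)
    have hgfin : ∫⁻ x, ENNReal.ofReal (g x) ∂Γ ≠ ∞ :=
      ((lintegral_ofReal_le_measure isOpen_interior.measurableSet hg hg0).trans_lt
        ((measure_mono interior_subset).trans_lt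
          (hGcompact k (hksub.trans inter_subset_left) hk))).ne
    calc Γ (W ∩ F i) ≤ ∫⁻ x, ENNReal.ofReal (g x) ∂Γ :=
          measure_le_lintegral_ofReal hWF.measurableSet hg1
      _ ≤ ∫⁻ x, ENNReal.ofReal (g x) ∂ρ := hle g g.continuous hgs (fun x => (hg x).1) hgfin
      _ ≤ ρ (interior k) := lintegral_ofReal_le_measure isOpen_interior.measurableSet hg hg0
      _ ≤ ρ W' := measure_mono fun x hx => interior_subset (hksub (interior_subset hx)).2
  have hWG : Γ (W ∩ G) ≤ ρ W' := by
    rw [← hFU, inter_iUnion,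
      Monotone.measure_iUnion fun i j hij => inter_subset_inter_right W (hFmono hij)]
    exact iSup_le hbound
  have hsub : interior W ⊆ (W ∩ G) ∪ C n := by
    intro x hx
    have hxW := interior_subset hx
    by_cases hxG : x ∈ G
    · exact Or.inl ⟨hxW, hxG⟩
    · exact Or.inr (hV'sub (show (⟨x, hxG⟩ : ↥Gᶜ) ∈ Subtype.val ⁻¹' V from (hWsub hxW).1))
  calc Γ (interior W) ≤ Γ (W ∩ G) + Γ (C n) := (measure_mono hsub).trans (measure_union_le _ _)
    _ < ∞ := ENNReal.add_lt_top.2 ⟨hWG.trans_lt hW'.measure_lt_top, hCfin n⟩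

/-- Locally finite measures agreeing on nonnegative compactly supported functions are equal. -/
lemma measure_eq_of_lintegral_ofReal_eq [SigmaCompactSpace X] {ρ ρ' : Measure X}
    [IsLocallyFiniteMeasure ρ] [IsLocallyFiniteMeasure ρ']
    (h : ∀ f : X → ℝ, Continuous f → HasCompactSupport f → (∀ x, 0 ≤ f x) →
      ∫⁻ x, ENNReal.ofReal (f x) ∂ρ = ∫⁻ x, ENNReal.ofReal (f x) ∂ρ') : ρ = ρ' := by
  refine Measure.ext_of_integral_eq_on_compactlySupported_nnreal fun f => ?_
  have hcont : Continuous fun x => (f x : ℝ) := by fun_prop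
  have hsupp : HasCompactSupport fun x => (f x : ℝ) :=
    f.hasCompactSupport.comp_left (g := fun r : NNReal => (r : ℝ)) (by simp)
  have hpos : ∀ x, 0 ≤ (f x : ℝ) := fun x => (f x).2
  rw [integral_eq_lintegral_of_nonneg_ae (Filter.Eventually.of_forall hpos)
      hcont.measurable.aestronglyMeasurable,
    integral_eq_lintegral_of_nonneg_ae (Filter.Eventually.of_forall hpos)
      hcont.measurable.aestronglyMeasurable, h _ hcont hsupp hpos]

end LocalFiniteness

/-- A coagulation kernel together with a conserved quantity `φ` which dominates it, and which
coincides with the total rate as soon as one of the particles is of size larger than `R`. -/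
structure IsEventuallyConservative [TopologicalSpace E] (K : E → E → Measure E) (φ : E → E → ℝ)
    (μ₀ : Measure E) (c' R : ℝ) : Prop where
  measurable_kernel : Measurable fun p : E × E => K p.1 p.2
  finite_kernel : ∀ x y, IsFiniteMeasure (K x y)
  measurable_phi : Measurable fun p : E × E => φ p.1 p.2
  phi_nonneg : ∀ x y, 0 ≤ φ x y
  phi_symm : ∀ x y, φ x y = φ y x
  conservative : Conservative K φ
  isCompact_Dset : ∃ k₀ : ℕ, ∀ k : ℕ, k₀ ≤ k → IsCompact (Dset φ μ₀ (k : ℝ))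
  iUnion_Dset : ⋃ k : ℕ, Dset φ μ₀ (k : ℝ) = Set.univ
  nonneg_const : 0 ≤ c'
  Kbar_le : ∀ x y, Kbar K x y ≤ c' * φ x y
  eq_Kbar : ∀ x y : E, (x, y) ∉ Dset φ μ₀ R ×ˢ Dset φ μ₀ R → φ x y = Kbar K x y

lemma Dset_mono (φ : E → E → ℝ) (μ₀ : Measure E) {r r' : ℝ} (h : r ≤ r') :
    Dset φ μ₀ r ⊆ Dset φ μ₀ r' := fun _ hx =>
  le_trans hx (ENNReal.ofReal_le_ofReal h)

namespace IsEventuallyConservative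

section Kernel

variable [TopologicalSpace E] {K : E → E → Measure E} {φ : E → E → ℝ} {μ₀ : Measure E} {c' R : ℝ}

lemma measurable_conservedRate (h : IsEventuallyConservative K φ μ₀ c' R) :
    Measurable (conservedRate φ) :=
  h.measurable_phi.ennreal_ofReal

lemma mem_Dset_iff (h : IsEventuallyConservative K φ μ₀ c' R) {r : ℝ} {x : E} :
    x ∈ Dset φ μ₀ r ↔ conservedSize φ μ₀ x ≤ ENNReal.ofReal r := by
  simp only [Dset, conservedSize, h.phi_symm _ x]
  rfl

lemma totalRate_eq_ofReal (h : IsEventuallyConservative K φ μ₀ c' R) (x y : E) :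
    totalRate K (x, y) = ENNReal.ofReal (Kbar K x y) := by
  have := h.finite_kernel x y
  exact (ENNReal.ofReal_toReal (measure_ne_top _ _)).symm

lemma totalRate_le (h : IsEventuallyConservative K φ μ₀ c' R) (p : E × E) :
    totalRate K p ≤ ENNReal.ofReal c' * conservedRate φ p := by
  rw [← Prod.mk.eta (p := p), h.totalRate_eq_ofReal, conservedRate,
    ← ENNReal.ofReal_mul h.nonneg_const]
  exact ENNReal.ofReal_le_ofReal (h.Kbar_le _ _)

lemma totalRate_eq_conservedRate (h : IsEventuallyConservative K φ μ₀ c' R) {r : ℝ} (hr : R ≤ r)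
    {x : E} (hx : x ∉ Dset φ μ₀ r) (y : E) :
    totalRate K (x, y) = conservedRate φ (x, y) := by
  rw [h.totalRate_eq_ofReal, conservedRate,
    h.eq_Kbar x y fun hxy => hx (Dset_mono φ μ₀ hr hxy.1)]

/-- The size of a coagulated particle is the sum of the sizes of its parents. -/
lemma conservedSize_ae_eq (h : IsEventuallyConservative K φ μ₀ c' R) [SFinite μ₀] (x y : E) :
    ∀ᵐ z ∂(K x y), conservedSize φ μ₀ z = conservedSize φ μ₀ x + conservedSize φ μ₀ y := by
  have := h.finite_kernel x y
  have hsec : ∀ w : E, Measurable fun q => φ q w := fun w =>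
    h.measurable_phi.comp (measurable_id.prodMk measurable_const)
  have hms : MeasurableSet {p : E × E | φ p.2 p.1 = φ x p.1 + φ y p.1} := by
    refine measurableSet_eq_fun (h.measurable_phi.comp measurable_swap) (Measurable.add ?_ ?_)
    · exact h.measurable_phi.comp (measurable_const.prodMk measurable_fst)
    · exact h.measurable_phi.comp (measurable_const.prodMk measurable_fst)
  have hae : ∀ᵐ q ∂μ₀, ∀ᵐ z ∂(K x y), φ z q = φ x q + φ y q :=
    Filter.Eventually.of_forall fun q => h.conservative x y q
  rw [Measure.ae_ae_comm hms] at hae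
  filter_upwards [hae] with z hz
  rw [conservedSize, conservedSize, conservedSize,
    ← lintegral_add_left (hsec x).ennreal_ofReal]
  refine lintegral_congr_ae ?_
  filter_upwards [hz] with q hq
  rw [h.phi_symm q z, hq, h.phi_symm q x, h.phi_symm q y,
    ENNReal.ofReal_add (h.phi_nonneg _ _) (h.phi_nonneg _ _)]

lemma kernel_apply_eq_zero (h : IsEventuallyConservative K φ μ₀ c' R) [SFinite μ₀] {r : ℝ}
    {A : Set E} (hA : A ⊆ Dset φ μ₀ r) {x y : E} (hxy : x ∉ Dset φ μ₀ r ∨ y ∉ Dset φ μ₀ r) :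
    K x y A = 0 := by
  refine measure_mono_null (fun z hz => ?_) (h.conservedSize_ae_eq x y)
  intro hzeq
  have hzD := h.mem_Dset_iff.1 (hA hz)
  simp only [h.mem_Dset_iff] at hxy
  rw [hzeq] at hzD
  rcases hxy with hx | hy
  · exact hx (le_self_add.trans hzD)
  · exact hy (le_add_self.trans hzD)

lemma kernel_apply_le_indicator (h : IsEventuallyConservative K φ μ₀ c' R) [SFinite μ₀] {r : ℝ}
    {A : Set E} (hA : A ⊆ Dset φ μ₀ r) (p : E × E) :
    K p.1 p.2 A ≤ (Dset φ μ₀ r).indicator 1 p.2 * totalRate K p := by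
  by_cases hp : p.2 ∈ Dset φ μ₀ r
  · simpa [hp, totalRate] using measure_mono (subset_univ A)
  · simp [h.kernel_apply_eq_zero hA (Or.inr hp)]

end Kernel

variable {E : Type*} [MetricSpace E] [MeasurableSpace E] [BorelSpace E] [LocallyCompactSpace E]
  {K : E → E → Measure E} {φ : E → E → ℝ} {c' R : ℝ} {μ : ℝ → Measure E}

lemma gainMeasure_Dset_lt_top (h : IsEventuallyConservative K φ (μ 0) c' R)
    (hμ : IsFlorySolution K φ μ) {r : ℝ} (hD : IsCompact (Dset φ (μ 0) r)) {t : ℝ} (ht : 0 ≤ t) :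
    gainMeasure K μ t (Dset φ (μ 0) r) < ∞ := by
  have := hμ.1
  have hDm := hD.measurableSet
  obtain ⟨f, hf1, -, hfs, hf⟩ :=
    exists_continuous_one_zero_of_isCompact hD isClosed_empty (disjoint_empty _)
  refine lt_of_le_of_lt ?_ (hμ.lintegral_totalLoss_lt_top h.measurable_kernel f.continuous hfs
    (fun x => (hf x).1) ht)
  refine le_trans ?_ (measure_le_lintegral_ofReal hDm hf1)
  rw [← lintegral_indicator_one hDm, ← lintegral_indicator_one hDm,
    lintegral_gainMeasure h.measurable_kernel hμ.1 hμ.measurable (measurable_one.indicator hDm),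
    lintegral_pairLossMeasure hμ.1 hμ.measurable (measurable_totalRate h.measurable_kernel)
      (measurable_one.indicator hDm)]
  refine lintegral_mono fun s => lintegral_mono fun p => ?_
  rw [lintegral_indicator_one hDm]
  exact h.kernel_apply_le_indicator subset_rfl p

lemma isLocallyFiniteMeasure_totalLoss (h : IsEventuallyConservative K φ (μ 0) c' R)
    (hμ : IsFlorySolution K φ μ) {t : ℝ} (ht : 0 ≤ t) :
    IsLocallyFiniteMeasure (pairLossMeasure (totalRate K) μ t) :=
  isLocallyFiniteMeasure_of_lintegral_lt_top fun _ hf hfs hf0 =>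
    hμ.lintegral_totalLoss_lt_top h.measurable_kernel hf hfs hf0 ht

lemma isLocallyFiniteMeasure_sizeLoss (h : IsEventuallyConservative K φ (μ 0) c' R)
    (hμ : IsFlorySolution K φ μ) {t : ℝ} (ht : 0 ≤ t) :
    IsLocallyFiniteMeasure ((timeMeasure μ t).withDensity (conservedSize φ (μ 0))) :=
  isLocallyFiniteMeasure_of_lintegral_lt_top fun _ hf hfs hf0 =>
    hμ.lintegral_sizeLoss_lt_top h.measurable_phi hf hfs hf0 ht

lemma isLocallyFiniteMeasure_conservedLoss (h : IsEventuallyConservative K φ (μ 0) c' R)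
    (hμ : IsFlorySolution K φ μ) {t : ℝ} (ht : 0 ≤ t) :
    IsLocallyFiniteMeasure (pairLossMeasure (conservedRate φ) μ t) :=
  isLocallyFiniteMeasure_of_lintegral_lt_top fun _ hf hfs hf0 =>
    (hμ.pairLossMeasure_conservedRate_le h.measurable_phi h.phi_symm
      hf.measurable.ennreal_ofReal t).trans_lt
      (hμ.lintegral_sizeLoss_lt_top h.measurable_phi hf hfs hf0 ht)

lemma isLocallyFiniteMeasure_gain (h : IsEventuallyConservative K φ (μ 0) c' R)
    (hμ : IsFlorySolution K φ μ) {t : ℝ} (ht : 0 ≤ t) :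
    IsLocallyFiniteMeasure (gainMeasure K μ t) := by
  have := hμ.1
  have := h.isLocallyFiniteMeasure_totalLoss hμ ht
  have := h.isLocallyFiniteMeasure_sizeLoss hμ ht
  have := isLocallyFiniteMeasure_add (μ t) (pairLossMeasure (totalRate K) μ t)
  have := isLocallyFiniteMeasure_add (μ t + pairLossMeasure (totalRate K) μ t)
    ((timeMeasure μ t).withDensity (conservedSize φ (μ 0)))
  set ρ := μ t + pairLossMeasure (totalRate K) μ t +
    (timeMeasure μ t).withDensity (conservedSize φ (μ 0)) with hρ
  have := isLocallyFiniteMeasure_add ρ ρ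
  obtain ⟨k₀, hk₀⟩ := h.isCompact_Dset
  refine isLocallyFiniteMeasure_of_lintegral_le (ρ := ρ + ρ)
    (C := fun n => Dset φ (μ 0) ((k₀ + n : ℕ) : ℝ)) ?_
    (fun n => (hk₀ _ (Nat.le_add_right _ _)).isClosed)
    (fun n => h.gainMeasure_Dset_lt_top hμ (hk₀ _ (Nat.le_add_right _ _)) ht) ?_
  · intro f hf hfs hf0 hfin
    have heq := hμ.lintegral_eq h.measurable_kernel h.finite_kernel h.measurable_phi h.phi_nonneg
      h.phi_symm hf hfs hf0 ht hfin
    rw [← lintegral_add_measure, ← lintegral_add_measure, ← hρ] at heq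
    have hle : 2⁻¹ * ∫⁻ z, ENNReal.ofReal (f z) ∂(gainMeasure K μ t) ≤
        ∫⁻ z, ENNReal.ofReal (f z) ∂ρ := by
      rw [heq, add_assoc]
      exact le_self_add.trans le_add_self
    rw [lintegral_add_measure, ← two_mul]
    calc ∫⁻ z, ENNReal.ofReal (f z) ∂(gainMeasure K μ t)
        = 2 * (2⁻¹ * ∫⁻ z, ENNReal.ofReal (f z) ∂(gainMeasure K μ t)) := by
          rw [← mul_assoc, ENNReal.mul_inv_cancel (by simp) (by simp), one_mul]
      _ ≤ _ := by gcongr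
  · refine eq_univ_of_forall fun x => ?_
    obtain ⟨n, hn⟩ := mem_iUnion.1 (h.iUnion_Dset.symm ▸ mem_univ x)
    exact mem_iUnion.2 ⟨n, Dset_mono φ (μ 0) (by push_cast; simp) hn⟩

variable [SigmaCompactSpace E]

/-- The Flory equation as an identity between locally finite measures. -/
lemma measure_eq (h : IsEventuallyConservative K φ (μ 0) c' R)
    (hμ : IsFlorySolution K φ μ) {t : ℝ} (ht : 0 ≤ t) :
    μ t + pairLossMeasure (totalRate K) μ t +
        (timeMeasure μ t).withDensity (conservedSize φ (μ 0)) =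
      μ 0 + (2⁻¹ : NNReal) • gainMeasure K μ t + pairLossMeasure (conservedRate φ) μ t := by
  have := hμ.1
  have := h.isLocallyFiniteMeasure_totalLoss hμ ht
  have := h.isLocallyFiniteMeasure_sizeLoss hμ ht
  have := h.isLocallyFiniteMeasure_conservedLoss hμ ht
  have := h.isLocallyFiniteMeasure_gain hμ ht
  have := isLocallyFiniteMeasure_add (μ t) (pairLossMeasure (totalRate K) μ t)
  have := isLocallyFiniteMeasure_add (μ t + pairLossMeasure (totalRate K) μ t)
    ((timeMeasure μ t).withDensity (conservedSize φ (μ 0)))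
  have := isLocallyFiniteMeasure_add (μ 0) ((2⁻¹ : NNReal) • gainMeasure K μ t)
  have := isLocallyFiniteMeasure_add (μ 0 + (2⁻¹ : NNReal) • gainMeasure K μ t)
    (pairLossMeasure (conservedRate φ) μ t)
  refine measure_eq_of_lintegral_ofReal_eq fun f hf hfs hf0 => ?_
  have hfin : ∫⁻ z, ENNReal.ofReal (f z) ∂(gainMeasure K μ t) ≠ ∞ :=
    (hf.integrable_of_hasCompactSupport hfs).lintegral_lt_top.ne
  simp only [lintegral_add_measure]
  rw [hμ.lintegral_eq h.measurable_kernel h.finite_kernel h.measurable_phi h.phi_nonneg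
    h.phi_symm hf hfs hf0 ht hfin, lintegral_smul_measure]
  congr 2
  rw [ENNReal.smul_def, ENNReal.coe_inv two_ne_zero]
  simp

/-- The Flory equation on measurable subsets of a compact sublevel set `D` is a closed system: only
pairs of particles in `D` contribute. -/
lemma measure_apply_eq (h : IsEventuallyConservative K φ (μ 0) c' R)
    (hμ : IsFlorySolution K φ μ) {r : ℝ} (hr : R ≤ r) (hD : IsCompact (Dset φ (μ 0) r))
    {A : Set E} (hA : A ⊆ Dset φ (μ 0) r) (hAm : MeasurableSet A) {t : ℝ} (ht : 0 ≤ t) :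
    μ t A + ((∫⁻ s in Ioc 0 t, ∫⁻ p, (Dset φ (μ 0) r ×ˢ A).indicator (totalRate K) p
          ∂((μ s).prod (μ s))) +
        ∫⁻ s in Ioc 0 t, ∫⁻ y, A.indicator (conservedSize φ (μ 0)) y ∂(μ s)) =
      μ 0 A + (2⁻¹ * (∫⁻ s in Ioc 0 t, ∫⁻ p, K p.1 p.2 A ∂((μ s).prod (μ s))) +
        ∫⁻ s in Ioc 0 t, ∫⁻ p, (Dset φ (μ 0) r ×ˢ A).indicator (conservedRate φ) p
          ∂((μ s).prod (μ s))) ∧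
    (∫⁻ s in Ioc 0 t, ∫⁻ p, (Dset φ (μ 0) r ×ˢ A).indicator (totalRate K) p
          ∂((μ s).prod (μ s))) +
        (∫⁻ s in Ioc 0 t, ∫⁻ y, A.indicator (conservedSize φ (μ 0)) y ∂(μ s)) ≠ ∞ := by
  have hfin := hμ.1
  have hμm := hμ.measurable
  have hpm := measurable_prod_self hfin hμm
  have hDm := hD.measurableSet
  have hκ := measurable_totalRate h.measurable_kernel
  have hφm := h.measurable_conservedRate
  have h1A : Measurable (A.indicator (1 : E → ℝ≥0∞)) := measurable_one.indicator hAm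
  have hfar : Measurable (((Dset φ (μ 0) r)ᶜ ×ˢ A).indicator (conservedRate φ)) :=
    hφm.indicator (hDm.compl.prod hAm)
  have hfar' : Measurable fun s => ∫⁻ p, ((Dset φ (μ 0) r)ᶜ ×ˢ A).indicator (conservedRate φ) p
      ∂((μ s).prod (μ s)) := (Measure.measurable_lintegral hfar).comp hpm
  have hsplit : ∀ g : E × E → ℝ≥0∞, Measurable g →
      (∀ x ∉ Dset φ (μ 0) r, ∀ y, g (x, y) = conservedRate φ (x, y)) →
      pairLossMeasure g μ t A =
        (∫⁻ s in Ioc 0 t, ∫⁻ p, (Dset φ (μ 0) r ×ˢ A).indicator g p ∂((μ s).prod (μ s))) +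
        ∫⁻ s in Ioc 0 t, ∫⁻ p, ((Dset φ (μ 0) r)ᶜ ×ˢ A).indicator (conservedRate φ) p
          ∂((μ s).prod (μ s)) := by
    intro g hg hgeq
    rw [← lintegral_indicator_one hAm, lintegral_pairLossMeasure hfin hμm hg h1A,
      ← lintegral_add_right _ hfar']
    refine lintegral_congr fun s => ?_
    rw [← lintegral_add_right _ hfar]
    refine lintegral_congr fun p => ?_
    obtain ⟨x, y⟩ := p
    by_cases hx : x ∈ Dset φ (μ 0) r <;> by_cases hy : y ∈ A <;> simp [hx, hy, hgeq]
  have hLκ := hsplit _ hκ fun x hx y => h.totalRate_eq_conservedRate hr hx y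
  have hLφ := hsplit _ hφm fun x _ y => rfl
  have hLψ : (timeMeasure μ t).withDensity (conservedSize φ (μ 0)) A =
      ∫⁻ s in Ioc 0 t, ∫⁻ y, A.indicator (conservedSize φ (μ 0)) y ∂(μ s) := by
    rw [← lintegral_indicator_one hAm, lintegral_timeMeasure_withDensity hμm
      (measurable_conservedSize h.measurable_phi _) h1A]
    refine lintegral_congr fun s => lintegral_congr fun y => ?_
    by_cases hy : y ∈ A <;> simp [hy]
  have hΓ : gainMeasure K μ t A = ∫⁻ s in Ioc 0 t, ∫⁻ p, K p.1 p.2 A ∂((μ s).prod (μ s)) := by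
    rw [← lintegral_indicator_one hAm,
      lintegral_gainMeasure h.measurable_kernel hfin hμm h1A]
    simp only [lintegral_indicator_one hAm]
  have := h.isLocallyFiniteMeasure_totalLoss hμ ht
  have := h.isLocallyFiniteMeasure_sizeLoss hμ ht
  have hLκfin : pairLossMeasure (totalRate K) μ t A ≠ ∞ :=
    ((measure_mono hA).trans_lt hD.measure_lt_top).ne
  have hLψfin : (timeMeasure μ t).withDensity (conservedSize φ (μ 0)) A ≠ ∞ :=
    ((measure_mono hA).trans_lt hD.measure_lt_top).ne
  have heq := congrArg (fun ρ : Measure E => ρ A) (h.measure_eq hμ ht)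
  simp only [Measure.add_apply, Measure.smul_apply] at heq
  rw [ENNReal.smul_def, ENNReal.coe_inv two_ne_zero, smul_eq_mul, ENNReal.coe_ofNat] at heq
  rw [hLκ] at hLκfin
  obtain ⟨hnear_fin, hfar_fin⟩ := ENNReal.add_ne_top.1 hLκfin
  rw [hLψ] at hLψfin
  rw [hLκ, hLφ, hLψ, hΓ] at heq
  refine ⟨(ENNReal.add_left_inj hfar_fin).1 ?_, ENNReal.add_ne_top.2 ⟨hnear_fin, hLψfin⟩⟩
  rw [← add_assoc] at heq
  convert heq using 1 <;> abel

lemma exists_measure_Dset_le (h : IsEventuallyConservative K φ (μ 0) c' R)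
    (hμ : IsFlorySolution K φ μ) {r : ℝ} (hD : IsCompact (Dset φ (μ 0) r))
    {T : ℝ} (hT : 0 ≤ T) :
    ∃ M : ℝ, 0 ≤ M ∧ ∀ t, 0 ≤ t → t ≤ T → μ t (Dset φ (μ 0) r) ≤ ENNReal.ofReal M := by
  have hfin := hμ.1
  have hDm := hD.measurableSet
  have h1D : Measurable ((Dset φ (μ 0) r).indicator (1 : E → ℝ≥0∞)) := measurable_one.indicator hDm
  have := h.isLocallyFiniteMeasure_conservedLoss hμ hT
  have := h.isLocallyFiniteMeasure_gain hμ hT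
  set M := μ 0 (Dset φ (μ 0) r) + gainMeasure K μ T (Dset φ (μ 0) r) +
    pairLossMeasure (conservedRate φ) μ T (Dset φ (μ 0) r) with hM
  have hMfin : M ≠ ∞ := ENNReal.add_ne_top.2 ⟨ENNReal.add_ne_top.2
    ⟨hD.measure_lt_top.ne, hD.measure_lt_top.ne⟩, hD.measure_lt_top.ne⟩
  refine ⟨M.toReal, ENNReal.toReal_nonneg, fun t ht htT => ?_⟩
  rw [ENNReal.ofReal_toReal hMfin]
  have hsub : Ioc 0 t ⊆ Ioc 0 T := Ioc_subset_Ioc_right htT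
  have heq := congrArg (fun ρ : Measure E => ρ (Dset φ (μ 0) r)) (h.measure_eq hμ ht)
  simp only [Measure.add_apply, Measure.smul_apply] at heq
  have hgain : gainMeasure K μ t (Dset φ (μ 0) r) ≤ gainMeasure K μ T (Dset φ (μ 0) r) := by
    rw [← lintegral_indicator_one hDm, ← lintegral_indicator_one hDm,
      lintegral_gainMeasure h.measurable_kernel hfin hμ.measurable h1D,
      lintegral_gainMeasure h.measurable_kernel hfin hμ.measurable h1D]
    exact lintegral_mono_set hsub
  have hloss : pairLossMeasure (conservedRate φ) μ t (Dset φ (μ 0) r) ≤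
      pairLossMeasure (conservedRate φ) μ T (Dset φ (μ 0) r) := by
    rw [← lintegral_indicator_one hDm, ← lintegral_indicator_one hDm,
      lintegral_pairLossMeasure hfin hμ.measurable h.measurable_conservedRate h1D,
      lintegral_pairLossMeasure hfin hμ.measurable h.measurable_conservedRate h1D]
    exact lintegral_mono_set hsub
  have hhalf : (2⁻¹ : NNReal) • gainMeasure K μ t (Dset φ (μ 0) r) ≤
      gainMeasure K μ t (Dset φ (μ 0) r) := by
    rw [ENNReal.smul_def, smul_eq_mul]
    refine mul_le_of_le_one_left' ?_
    rw [ENNReal.coe_inv two_ne_zero]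
    simp
  calc μ t (Dset φ (μ 0) r) ≤ _ := le_self_add.trans le_self_add
    _ = _ := heq
    _ ≤ M := add_le_add (add_le_add le_rfl (hhalf.trans hgain)) hloss

/-- One step of the Picard iteration: a bound on the distance of two solutions on subsets of a
sublevel set improves to its time integral. -/
lemma measure_le_add_lintegral {ν : ℝ → Measure E}
    (h : IsEventuallyConservative K φ (μ 0) c' R) (hμ : IsFlorySolution K φ μ)
    (hν : IsFlorySolution K φ ν) (h0 : ν 0 = μ 0) {r : ℝ} (hr : R ≤ r) (hr0 : 0 ≤ r)
    (hD : IsCompact (Dset φ (μ 0) r)) {T : ℝ} {a : ℝ → ℝ≥0∞} (ha : Measurable a)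
    (hμν : ∀ s, 0 ≤ s → s ≤ T → ∀ A ⊆ Dset φ (μ 0) r, MeasurableSet A → μ s A ≤ ν s A + a s)
    (hνμ : ∀ s, 0 ≤ s → s ≤ T → ∀ A ⊆ Dset φ (μ 0) r, MeasurableSet A → ν s A ≤ μ s A + a s)
    {t : ℝ} (ht : 0 ≤ t) (htT : t ≤ T) {A : Set E} (hA : A ⊆ Dset φ (μ 0) r)
    (hAm : MeasurableSet A) :
    μ t A ≤ ν t A + ∫⁻ s in Ioc 0 t, ENNReal.ofReal ((3 * c' + 3) * r) * a s := by
  have hc := h.nonneg_const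
  have hcr : 0 ≤ c' * r := mul_nonneg hc hr0
  have hDm := hD.measurableSet
  have hfinμ := hμ.1
  have hfinν := hν.1
  have hκ := measurable_totalRate h.measurable_kernel
  have hφm := h.measurable_conservedRate
  have hψ := measurable_conservedSize h.measurable_phi (μ 0)
  have hKA : Measurable fun p : E × E => K p.1 p.2 A :=
    (Measure.measurable_coe hAm).comp h.measurable_kernel
  obtain ⟨heqμ, hfin⟩ := h.measure_apply_eq hμ hr hD hA hAm ht
  obtain ⟨heqν, -⟩ := (h0 ▸ h :
    IsEventuallyConservative K φ (ν 0) c' R).measure_apply_eq hν hr (h0 ▸ hD) (h0 ▸ hA) hAm ht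
  rw [h0] at heqν
  have hcol : ∀ ρ : ℝ → Measure E, IsFlorySolution K φ ρ → ρ 0 = μ 0 → ∀ s, 0 ≤ s →
      ∀ y ∈ Dset φ (μ 0) r, ∫⁻ x, conservedRate φ (x, y) ∂(ρ s) ≤ ENNReal.ofReal r := by
    intro ρ hρ hρ0 s hs y hy
    refine (hρ.lintegral_conservedRate_le h.phi_symm hs y).trans ?_
    rw [hρ0]
    exact h.mem_Dset_iff.1 hy
  have hrow : ∀ ρ : ℝ → Measure E, IsFlorySolution K φ ρ → ρ 0 = μ 0 → ∀ s, 0 ≤ s →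
      ∀ x ∈ Dset φ (μ 0) r, ∫⁻ y, conservedRate φ (x, y) ∂(ρ s) ≤ ENNReal.ofReal r := by
    intro ρ hρ hρ0 s hs x hx
    simpa only [conservedRate, h.phi_symm x] using hcol ρ hρ hρ0 s hs x hx
  -- Quadratic functionals with a kernel dominated by `b * φ`.
  have hquad : ∀ (ρ ρ' : ℝ → Measure E), IsFlorySolution K φ ρ → IsFlorySolution K φ ρ' →
      ρ 0 = μ 0 → ρ' 0 = μ 0 →
      (∀ s, 0 ≤ s → s ≤ T → ∀ B ⊆ Dset φ (μ 0) r, MeasurableSet B → ρ s B ≤ ρ' s B + a s) →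
      ∀ (b : ℝ), 0 ≤ b → ∀ g : E × E → ℝ≥0∞, Measurable g →
      (∀ p, g p ≤ ENNReal.ofReal b * conservedRate φ p) →
      (∀ x y, x ∉ Dset φ (μ 0) r ∨ y ∉ Dset φ (μ 0) r → g (x, y) = 0) →
      ∫⁻ s in Ioc 0 t, ∫⁻ p, g p ∂((ρ s).prod (ρ s)) ≤
        (∫⁻ s in Ioc 0 t, ∫⁻ p, g p ∂((ρ' s).prod (ρ' s))) +
          ENNReal.ofReal (2 * (b * r)) * ∫⁻ s in Ioc 0 t, a s := by
    intro ρ ρ' hρ hρ' hρ0 hρ'0 hle b hb g hg hgle hgD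
    have hfin₁ := hρ.1
    have hfin₂ := hρ'.1
    rw [← lintegral_const_mul _ ha, ← lintegral_add_right _ (ha.const_mul _)]
    refine setLIntegral_mono' measurableSet_Ioc fun s hs => ?_
    refine lintegral_lintegral_le_add_of_measure_le (mul_nonneg hb hr0)
      (hle s hs.1.le (hs.2.trans htT)) hg (fun x hx => ?_) (fun y hy => ?_) hgD
    · calc ∫⁻ y, g (x, y) ∂(ρ s) ≤ ∫⁻ y, ENNReal.ofReal b * conservedRate φ (x, y) ∂(ρ s) :=
            lintegral_mono fun y => hgle _
        _ ≤ ENNReal.ofReal (b * r) := by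
            rw [lintegral_const_mul' _ _ ENNReal.ofReal_ne_top, ENNReal.ofReal_mul hb]
            gcongr
            exact hrow ρ hρ hρ0 s hs.1.le x hx
    · calc ∫⁻ x, g (x, y) ∂(ρ' s) ≤ ∫⁻ x, ENNReal.ofReal b * conservedRate φ (x, y) ∂(ρ' s) :=
            lintegral_mono fun x => hgle _
        _ ≤ ENNReal.ofReal (b * r) := by
            rw [lintegral_const_mul' _ _ ENNReal.ofReal_ne_top, ENNReal.ofReal_mul hb]
            gcongr
            exact hcol ρ' hρ' hρ'0 s hs.1.le y hy
  have hindD : ∀ g : E × E → ℝ≥0∞, ∀ x y, x ∉ Dset φ (μ 0) r ∨ y ∉ Dset φ (μ 0) r →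
      (Dset φ (μ 0) r ×ˢ A).indicator g (x, y) = 0 := by
    intro g x y hxy
    refine indicator_of_notMem (fun hmem => ?_) _
    rcases hxy with hx | hy
    · exact hx hmem.1
    · exact hy (hA hmem.2)
  have hgain := hquad μ ν hμ hν rfl h0 hμν c' hc _ hKA
    (fun p => (measure_mono (subset_univ A)).trans (h.totalRate_le p))
    fun x y hxy => h.kernel_apply_eq_zero hA hxy
  have hrest := hquad μ ν hμ hν rfl h0 hμν 1 zero_le_one _ (hφm.indicator (hDm.prod hAm))
    (fun p => (indicator_le_self _ _ p).trans (by simp)) (hindD _)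
  have hloss := hquad ν μ hν hμ h0 rfl hνμ c' hc _ (hκ.indicator (hDm.prod hAm))
    (fun p => (indicator_le_self _ _ p).trans (h.totalRate_le p)) (hindD _)
  have hsize : ∫⁻ s in Ioc 0 t, ∫⁻ y, A.indicator (conservedSize φ (μ 0)) y ∂(ν s) ≤
      (∫⁻ s in Ioc 0 t, ∫⁻ y, A.indicator (conservedSize φ (μ 0)) y ∂(μ s)) +
        ENNReal.ofReal r * ∫⁻ s in Ioc 0 t, a s := by
    rw [← lintegral_const_mul _ ha, ← lintegral_add_right _ (ha.const_mul _)]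
    refine setLIntegral_mono' measurableSet_Ioc fun s hs => ?_
    refine lintegral_le_add_of_measure_le hr0 (hνμ s hs.1.le (hs.2.trans htT))
      (hψ.indicator hAm) (fun y => ?_) fun y hy => indicator_of_notMem (fun hyA => hy (hA hyA)) _
    by_cases hy : y ∈ A
    · simpa [hy] using h.mem_Dset_iff.1 (hA hy)
    · simp [hy]
  rw [lintegral_const_mul _ ha]
  set I := ∫⁻ s in Ioc 0 t, a s
  have hconst : ENNReal.ofReal ((3 * c' + 3) * r) = ENNReal.ofReal (c' * r) +
      ENNReal.ofReal (2 * (1 * r)) + ENNReal.ofReal (2 * (c' * r)) + ENNReal.ofReal r := by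
    rw [← ENNReal.ofReal_add hcr (by positivity), ← ENNReal.ofReal_add (by positivity)
      (by positivity), ← ENNReal.ofReal_add (by positivity) hr0]
    congr 1
    ring
  rw [hconst, add_mul, add_mul, add_mul]
  rw [ENNReal.ofReal_mul zero_le_two, ENNReal.ofReal_ofNat, mul_assoc] at hgain
  exact le_add_of_balance_eq heqμ heqν hfin hgain hrest hloss hsize

/-- Two solutions coincide on every large compact sublevel set. -/
lemma measure_apply_le {ν : ℝ → Measure E}
    (h : IsEventuallyConservative K φ (μ 0) c' R) (hμ : IsFlorySolution K φ μ)
    (hν : IsFlorySolution K φ ν) (h0 : ν 0 = μ 0) {r : ℝ} (hr : R ≤ r) (hr0 : 0 ≤ r)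
    (hD : IsCompact (Dset φ (μ 0) r)) {T : ℝ} (hT : 0 ≤ T)
    {A : Set E} (hA : A ⊆ Dset φ (μ 0) r) (hAm : MeasurableSet A) : μ T A ≤ ν T A := by
  have hν' : IsEventuallyConservative K φ (ν 0) c' R := h0 ▸ h
  obtain ⟨M₁, hM₁, hμM⟩ := h.exists_measure_Dset_le hμ hD hT
  obtain ⟨M₂, hM₂, hνM⟩ := hν'.exists_measure_Dset_le hν (h0 ▸ hD) hT
  rw [h0] at hνM
  set M := max M₁ M₂
  have hM : 0 ≤ M := hM₁.trans (le_max_left _ _)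
  set C := (3 * c' + 3) * r with hCdef
  have hC : 0 ≤ C := mul_nonneg (by linarith [h.nonneg_const]) hr0
  have hiter : ∀ n : ℕ, ∀ s, 0 ≤ s → s ≤ T → ∀ B ⊆ Dset φ (μ 0) r, MeasurableSet B →
      μ s B ≤ ν s B + ENNReal.ofReal (M * ((C * s) ^ n / n.factorial)) ∧
      ν s B ≤ μ s B + ENNReal.ofReal (M * ((C * s) ^ n / n.factorial)) := by
    intro n
    induction n with
    | zero =>
      intro s hs hsT B hB _
      simp only [pow_zero, Nat.factorial_zero, Nat.cast_one, div_one, mul_one]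
      constructor
      · exact ((measure_mono hB).trans ((hμM s hs hsT).trans
          (ENNReal.ofReal_le_ofReal (le_max_left _ _)))).trans le_add_self
      · exact ((measure_mono hB).trans ((hνM s hs hsT).trans
          (ENNReal.ofReal_le_ofReal (le_max_right _ _)))).trans le_add_self
    | succ n ih =>
      intro s hs hsT B hB hBm
      have ham : Measurable fun s : ℝ => ENNReal.ofReal (M * ((C * s) ^ n / n.factorial)) := by
        fun_prop
      rw [← setLIntegral_pow_div_factorial hC hM hs n]
      constructor
      · exact h.measure_le_add_lintegral hμ hν h0 hr hr0 hD ham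
          (fun u hu huT B' hB' hB'm => (ih u hu huT B' hB' hB'm).1)
          (fun u hu huT B' hB' hB'm => (ih u hu huT B' hB' hB'm).2) hs hsT hB hBm
      · exact hν'.measure_le_add_lintegral hν hμ h0.symm hr hr0 (h0 ▸ hD) ham
          (fun u hu huT B' hB' hB'm => (ih u hu huT B' (h0 ▸ hB') hB'm).2)
          (fun u hu huT B' hB' hB'm => (ih u hu huT B' (h0 ▸ hB') hB'm).1) hs hsT (h0 ▸ hB) hBm
  have hlim : Filter.Tendsto
      (fun n : ℕ => ν T A + ENNReal.ofReal (M * ((C * T) ^ n / n.factorial)))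
      Filter.atTop (nhds (ν T A + ENNReal.ofReal (M * 0))) :=
    (ENNReal.tendsto_ofReal
      ((FloorSemiring.tendsto_pow_div_factorial_atTop (C * T)).const_mul M)).const_add _
  rw [mul_zero, ENNReal.ofReal_zero, add_zero] at hlim
  exact ge_of_tendsto' hlim fun n => (hiter n T hT le_rfl A hA hAm).1

lemma measure_le {ν : ℝ → Measure E}
    (h : IsEventuallyConservative K φ (μ 0) c' R) (hμ : IsFlorySolution K φ μ)
    (hν : IsFlorySolution K φ ν) (h0 : ν 0 = μ 0) {t : ℝ} (ht : 0 ≤ t) : μ t ≤ ν t := by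
  refine Measure.le_iff.2 fun A hAm => ?_
  obtain ⟨k₀, hk₀⟩ := h.isCompact_Dset
  obtain ⟨N, hN⟩ := exists_nat_ge R
  set D : ℕ → Set E := fun n => Dset φ (μ 0) ((k₀ + N + n : ℕ) : ℝ) with hDdef
  have hDc : ∀ n, IsCompact (D n) := fun n => hk₀ _ (by omega)
  have hcover : A = ⋃ n, A ∩ D n := by
    rw [← inter_iUnion, eq_comm, inter_eq_left]
    intro x _
    obtain ⟨n, hn⟩ := mem_iUnion.1 (h.iUnion_Dset.symm ▸ mem_univ x)
    exact mem_iUnion.2 ⟨n, Dset_mono φ (μ 0) (by exact_mod_cast Nat.le_add_left n _) hn⟩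
  have hmono : Monotone fun n => A ∩ D n := fun i j hij =>
    inter_subset_inter_right A (Dset_mono φ (μ 0) (by exact_mod_cast Nat.add_le_add_left hij _))
  rw [hcover, hmono.measure_iUnion, hmono.measure_iUnion]
  refine iSup_mono fun n => h.measure_apply_le hμ hν h0 (hN.trans ?_) (Nat.cast_nonneg _) (hDc n)
    ht inter_subset_right (hAm.inter (hDc n).measurableSet)
  exact_mod_cast (by omega : N ≤ k₀ + N + n)

end IsEventuallyConservative

end Uniqueness

/-- **Uniqueness for the multi-type Flory equation with an eventually conservative
kernel** (Theorem `thm:uniqueness`).  Under the uniqueness hypotheses, two solutions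
of the multi-type Flory equation with conserved quantity `φ` and the same finite
initial condition `μ₀` coincide at every time `t ≥ 0`. -/
theorem flory_uniqueness
    {E : Type*} [MetricSpace E] [MeasurableSpace E] [BorelSpace E]
    [SigmaCompactSpace E] [LocallyCompactSpace E]
    (m : E → ℝ) (hm_pos : ∀ x, 0 < m x) (hm_meas : Measurable m)
    (K : E → E → Measure E)
    (hK_meas : ∀ A : Set E, MeasurableSet A →
      Measurable fun p : E × E => K p.1 p.2 A)
    (hK_fin : ∀ x y, IsFiniteMeasure (K x y))
    (hK_symm : ∀ x y, K x y = K y x)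
    (hK_mass : ∀ x y, ∀ᵐ z ∂(K x y), m z = m x + m y)
    (φ : E → E → ℝ)
    (hφ_meas : Measurable fun p : E × E => φ p.1 p.2)
    (hφ_nonneg : ∀ x y, 0 ≤ φ x y)
    (hφ_symm : ∀ x y, φ x y = φ y x)
    (hφ_cons : Conservative K φ)
    (μ₀ : Measure E) [IsFiniteMeasure μ₀]
    (hD_compact : ∃ k₀ : ℕ, ∀ k : ℕ, k₀ ≤ k → IsCompact (Dset φ μ₀ (k : ℝ)))
    (hD_cover : ⋃ k : ℕ, Dset φ μ₀ (k : ℝ) = Set.univ)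
    (c' : ℝ) (hc' : 0 < c')
    (hKφ : ∀ x y, Kbar K x y ≤ c' * φ x y)
    (hev : ∃ R : ℝ, 0 < R ∧
      ∀ x y : E, (x, y) ∉ Dset φ μ₀ R ×ˢ Dset φ μ₀ R → φ x y = Kbar K x y)
    (μ μhat : ℝ → Measure E)
    (hμ : IsFlorySolution K φ μ) (hμhat : IsFlorySolution K φ μhat)
    (hinit : μ 0 = μ₀) (hinithat : μhat 0 = μ₀) :
    ∀ t : ℝ, 0 ≤ t → μ t = μhat t := by
  obtain ⟨R, -, hR⟩ := hev
  subst hinit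
  have h : IsEventuallyConservative K φ (μ 0) c' R :=
    { measurable_kernel := Measure.measurable_of_measurable_coe _ hK_meas
      finite_kernel := hK_fin
      measurable_phi := hφ_meas
      phi_nonneg := hφ_nonneg
      phi_symm := hφ_symm
      conservative := hφ_cons
      isCompact_Dset := hD_compact
      iUnion_Dset := hD_cover
      nonneg_const := hc'.le
      Kbar_le := hKφ
      eq_Kbar := hR }
  intro t ht
  exact le_antisymm (h.measure_le hμ hμhat hinithat ht)
    ((hinithat ▸ h : IsEventuallyConservative K φ (μhat 0) c' R).measure_le hμhat hμ
      hinithat.symm ht)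
end
end

section
/- Gronwall-type estimate in the uniqueness proof: under the uniqueness hypotheses, if (μ_t)_{t≥0} and (μ̂_t)_{t≥0} are both solutions of the multi-type Flory equation with conserved quantity φ and the same initial condition μ_0, then the function r ↦ ‖(μ_r − μ̂_r)|_{D_R}‖ is measurable and bounded by 2 μ_0(E), and for every s ≥ 0 one has ‖(μ_s − μ̂_s)|_{D_R}‖ ≤ 3 R (c' + 1) ∫_0^s ‖(μ_r − μ̂_r)|_{D_R}‖ dr, where R is the constant from the eventual-conservativity hypothesis and ‖(μ − ν)|_{D_R}‖ denotes the total variation of the finite signed measure (μ − ν) restricted to D_R. -/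
open MeasureTheory Set

noncomputable section

/-- The total variation of the finite signed measure `ν - ν'` on the set `A`,
i.e. `‖(ν - ν')|_A‖`. -/
def tvOn {E : Type*} [MeasurableSpace E] (ν ν' : Measure E)
    (hν : IsFiniteMeasure ν) (hν' : IsFiniteMeasure ν') (A : Set E) : ℝ :=
  (((@Measure.toSignedMeasure E _ ν hν) -
      (@Measure.toSignedMeasure E _ ν' hν')).totalVariation A).toReal

/-- A kernel all of whose measures are finite is s-finite. -/
theorem isSFiniteKernel_of_isFiniteMeasure {α β : Type*} [MeasurableSpace α] [MeasurableSpace β]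
    (κ : ProbabilityTheory.Kernel α β) (hκ : ∀ a, IsFiniteMeasure (κ a)) :
    ProbabilityTheory.IsSFiniteKernel κ := by
  classical
  have hmeas : Measurable fun a => ⌊(κ a Set.univ).toReal⌋₊ :=
    Nat.measurable_floor.comp (κ.measurable_coe MeasurableSet.univ).ennreal_toReal
  have hset : ∀ n : ℕ, MeasurableSet {a | ⌊(κ a Set.univ).toReal⌋₊ = n} := fun n =>
    hmeas (measurableSet_singleton n)
  refine ⟨fun n => ProbabilityTheory.Kernel.piecewise (hset n) κ 0, fun n => ?_, ?_⟩
  · refine ⟨ENNReal.ofReal (n + 1), ENNReal.ofReal_lt_top, fun a => ?_⟩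
    rw [ProbabilityTheory.Kernel.piecewise_apply']
    split_ifs with h
    · have h' : ⌊(κ a Set.univ).toReal⌋₊ = n := h
      rw [← ENNReal.ofReal_toReal (measure_ne_top (κ a) Set.univ)]
      exact ENNReal.ofReal_le_ofReal (h' ▸ (Nat.lt_floor_add_one _).le)
    · simp
  · ext a s hs
    rw [ProbabilityTheory.Kernel.sum_apply' _ _ hs, tsum_eq_single ⌊(κ a Set.univ).toReal⌋₊]
    · simp [ProbabilityTheory.Kernel.piecewise_apply']
    · intro n hn
      rw [ProbabilityTheory.Kernel.piecewise_apply', if_neg (by simpa using hn.symm)]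
      simp

/-- A measure `Q` which agrees with a locally finite measure `P` on every nonnegative compactly
supported continuous function of finite `Q`-integral is equal to `P`, as soon as the space is
covered by countably many closed sets of finite `Q`-measure. -/
theorem eq_of_lintegral_eq_of_lintegral_lt_top {E : Type*} [MetricSpace E] [MeasurableSpace E]
    [BorelSpace E] [SigmaCompactSpace E] [LocallyCompactSpace E] (P Q : Measure E)
    [IsLocallyFiniteMeasure P] (D : ℕ → Set E) (hD_closed : ∀ k, IsClosed (D k))
    (hD_cover : ⋃ k, D k = Set.univ) (hQD : ∀ k, Q (D k) < ⊤)
    (hPQ : ∀ f : E → ℝ, Continuous f → HasCompactSupport f → (∀ x, 0 ≤ f x) →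
      ∫⁻ x, ENNReal.ofReal (f x) ∂Q < ⊤ →
      ∫⁻ x, ENNReal.ofReal (f x) ∂P = ∫⁻ x, ENNReal.ofReal (f x) ∂Q) :
    P = Q := by
  have integral_lt_top : ∀ (M : Measure E) (C : Set E), IsCompact C → M C < ⊤ →
      ∀ f : E → ℝ, Continuous f → (∀ x ∉ C, f x = 0) →
      ∫⁻ x, ENNReal.ofReal (f x) ∂M < ⊤ := by
    intro M C hC hMC f hf hfC
    obtain ⟨c, hc⟩ := (hC.image hf).bddAbove
    have hle : ∀ x, ENNReal.ofReal (f x) ≤ C.indicator (fun _ => ENNReal.ofReal c) x := by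
      intro x
      by_cases hx : x ∈ C
      · rw [Set.indicator_of_mem hx]
        exact ENNReal.ofReal_le_ofReal (hc ⟨x, hx, rfl⟩)
      · simp [hfC x hx]
    refine (lintegral_mono hle).trans_lt ?_
    rw [lintegral_indicator hC.measurableSet, setLIntegral_const]
    exact ENNReal.mul_lt_top ENNReal.ofReal_lt_top hMC
  -- On open sets where `Q` is locally finite, `Q` is dominated by `P`.
  have hQle : ∀ U : Set E, IsOpen U → (∀ x ∈ U, Q.FiniteAtFilter (nhds x)) → Q U ≤ P U := by
    intro U hU hUfin
    have hcompact : ∀ C : Set E, IsCompact C → C ⊆ U → Q C ≤ P U := by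
      intro C hC hCU
      obtain ⟨L, hL, hCL, hLU⟩ := exists_compact_between hC hU hCU
      obtain ⟨f, hf1, hf0, hfc, hf01⟩ := exists_continuous_one_zero_of_isCompact hC
        (isOpen_interior (s := L)).isClosed_compl
        (Set.disjoint_compl_right_iff_subset.2 hCL)
      have hfL : ∀ x ∉ L, f x = 0 := fun x hx => hf0 fun h => hx (interior_subset h)
      have hQL : Q L < ⊤ := hL.measure_lt_top_of_nhdsWithin fun x hx =>
        (hUfin x (hLU hx)).filter_mono nhdsWithin_le_nhds
      have heq := hPQ f f.continuous hfc (fun x => (hf01 x).1)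
        (integral_lt_top Q L hL hQL f f.continuous hfL)
      calc Q C = ∫⁻ x, C.indicator 1 x ∂Q := (lintegral_indicator_one hC.measurableSet).symm
        _ ≤ ∫⁻ x, ENNReal.ofReal (f x) ∂Q := by
          refine lintegral_mono fun x => ?_
          by_cases hx : x ∈ C
          · simp [Set.indicator_of_mem hx, hf1 hx]
          · simp [Set.indicator_of_notMem hx]
        _ = ∫⁻ x, ENNReal.ofReal (f x) ∂P := heq.symm
        _ ≤ ∫⁻ x, U.indicator 1 x ∂P := by
          refine lintegral_mono fun x => ?_
          by_cases hx : x ∈ U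
          · simpa [Set.indicator_of_mem hx] using (hf01 x).2
          · simp [hfL x fun h => hx (hLU h)]
        _ = P U := lintegral_indicator_one hU.measurableSet
    have hclosed : ∃ F : ℕ → Set E, (∀ n, IsClosed (F n)) ∧ (∀ n, F n ⊆ U) ∧ ⋃ n, F n = U ∧
        Monotone F := hU.exists_iUnion_isClosed
    obtain ⟨F, hFc, hFU, hFun, hFm⟩ := hclosed
    have hmono : Monotone fun n => F n ∩ compactCovering E n := fun a b hab =>
      Set.inter_subset_inter (hFm hab) (compactCovering_subset E hab)
    have hunion : ⋃ n, F n ∩ compactCovering E n = U := by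
      rw [Set.iUnion_inter_of_monotone hFm (compactCovering_subset E), hFun,
        iUnion_compactCovering, Set.inter_univ]
    rw [← hunion, hmono.measure_iUnion, hunion]
    exact iSup_le fun n => hcompact _ ((isCompact_compactCovering E n).inter_left (hFc n))
      (Set.inter_subset_left.trans (hFU n))
  -- Baire's theorem shows that `Q` is locally finite.
  have hQfin : ∀ x, Q.FiniteAtFilter (nhds x) := by
    set W : Set E := {x | Q.FiniteAtFilter (nhds x)} with hW
    have hW_nhds : ∀ V : Set E, IsOpen V → Q V < ⊤ → V ⊆ W := fun V hV hQV x hx =>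
      ⟨V, hV.mem_nhds hx, hQV⟩
    have hWopen : IsOpen W := by
      refine isOpen_iff_mem_nhds.2 fun x hx => ?_
      obtain ⟨s, hs, hQs⟩ := hx
      obtain ⟨V, hVs, hV, hxV⟩ := mem_nhds_iff.1 hs
      exact Filter.mem_of_superset (hV.mem_nhds hxV)
        (hW_nhds V hV ((measure_mono hVs).trans_lt hQs))
    by_contra hne
    push Not at hne
    obtain ⟨x₀, hx₀⟩ := hne
    have hFclosed : IsClosed Wᶜ := hWopen.isClosed_compl
    have : LocallyCompactSpace (Wᶜ : Set E) := hFclosed.locallyCompactSpace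
    have : Nonempty (Wᶜ : Set E) := ⟨⟨x₀, hx₀⟩⟩
    obtain ⟨k, ⟨y, hyW⟩, hy⟩ := nonempty_interior_of_iUnion_of_closed
      (f := fun k => ((↑) : (Wᶜ : Set E) → E) ⁻¹' D k)
      (fun k => (hD_closed k).preimage continuous_subtype_val)
      (by rw [← Set.preimage_iUnion, hD_cover, Set.preimage_univ])
    obtain ⟨O, hOD, hO, hyO⟩ := mem_interior.1 hy
    obtain ⟨V, hV, rfl⟩ := isOpen_induced_iff.1 hO
    obtain ⟨s, hs, hPs⟩ := P.finiteAt_nhds y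
    obtain ⟨V', hV's, hV', hyV'⟩ := mem_nhds_iff.1 hs
    refine hyW (hW_nhds (V ∩ V') (hV.inter hV') ?_ ⟨hyO, hyV'⟩)
    have hsub : V ∩ V' ⊆ (V ∩ V' ∩ W) ∪ D k := by
      intro z hz
      by_cases hzW : z ∈ W
      · exact Or.inl ⟨hz, hzW⟩
      · exact Or.inr (hOD (show (⟨z, hzW⟩ : (Wᶜ : Set E)) ∈ _ from hz.1))
    refine (measure_mono hsub).trans_lt ((measure_union_le _ _).trans_lt
      (ENNReal.add_lt_top.2 ⟨?_, hQD k⟩))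
    refine (hQle _ ((hV.inter hV').inter hWopen) fun z hz => hz.2).trans_lt ?_
    exact (measure_mono fun z hz => hV's hz.1.2).trans_lt hPs
  have : IsLocallyFiniteMeasure Q := ⟨hQfin⟩
  refine Measure.ext_of_integral_eq_on_compactlySupported_nnreal fun f => ?_
  have hfcont : Continuous fun x => ((f x : NNReal) : ℝ) := NNReal.continuous_coe.comp f.continuous
  have hfsupp : HasCompactSupport fun x => ((f x : NNReal) : ℝ) :=
    f.hasCompactSupport.comp_left NNReal.coe_zero
  rw [integral_eq_lintegral_of_nonneg_ae (Filter.Eventually.of_forall fun x => (f x).coe_nonneg)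
      hfcont.aestronglyMeasurable,
    integral_eq_lintegral_of_nonneg_ae (Filter.Eventually.of_forall fun x => (f x).coe_nonneg)
      hfcont.aestronglyMeasurable,
    hPQ _ hfcont hfsupp (fun x => (f x).coe_nonneg) (integral_lt_top Q _ hfsupp hfsupp.measure_lt_top _
      hfcont fun x hx => image_eq_zero_of_notMem_tsupport
        (f := fun x => ((f x : NNReal) : ℝ)) hx)]

section TotalVariation

variable {E : Type*} [MeasurableSpace E]

theorem tvOn_nonneg (ν ν' : Measure E) (hν : IsFiniteMeasure ν) (hν' : IsFiniteMeasure ν')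
    (A : Set E) : 0 ≤ tvOn ν ν' hν hν' A :=
  ENNReal.toReal_nonneg

/-- The Hahn decomposition expressed through `tvOn`. -/
theorem exists_tvOn_eq (ν ν' : Measure E) (hν : IsFiniteMeasure ν) (hν' : IsFiniteMeasure ν')
    {A : Set E} (hA : MeasurableSet A) :
    ∃ H, MeasurableSet H ∧ tvOn ν ν' hν hν' A =
      (ν.real (A ∩ H) - ν'.real (A ∩ H)) - (ν.real (A ∩ Hᶜ) - ν'.real (A ∩ Hᶜ)) := by
  obtain ⟨H, hH, hpos, hneg, hp, hn⟩ :=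
    SignedMeasure.toJordanDecomposition_spec (ν.toSignedMeasure - ν'.toSignedMeasure)
  refine ⟨H, hH, ?_⟩
  rw [tvOn, SignedMeasure.totalVariation, hp, hn, Measure.add_apply,
    SignedMeasure.toMeasureOfZeroLE_apply _ hpos hH hA,
    SignedMeasure.toMeasureOfLEZero_apply _ hneg hH.compl hA,
    ENNReal.toReal_add ENNReal.coe_ne_top ENNReal.coe_ne_top]
  simp only [ENNReal.coe_toReal, NNReal.coe_mk, Set.inter_comm _ A]
  rw [Measure.toSignedMeasure_sub_apply (hA.inter hH),
    Measure.toSignedMeasure_sub_apply (hA.inter hH.compl)]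
  ring

/-- Integrals against two measures differ by at most the total variation of their difference. -/
theorem abs_setIntegral_sub_le_mul_tvOn (ν ν' : Measure E) (hν : IsFiniteMeasure ν)
    (hν' : IsFiniteMeasure ν') {A : Set E} (hA : MeasurableSet A) {u : E → ℝ}
    (hu : Measurable u) {c : ℝ} (huc : ∀ x ∈ A, |u x| ≤ c) :
    |∫ x in A, u x ∂ν - ∫ x in A, u x ∂ν'| ≤ c * tvOn ν ν' hν hν' A := by
  set σ : SignedMeasure E := ν.toSignedMeasure - ν'.toSignedMeasure with hσ
  set p := σ.toJordanDecomposition.posPart with hp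
  set n := σ.toJordanDecomposition.negPart with hn
  have hadd : ν + n = ν' + p := by
    ext B hB
    have h1 := σ.apply_eq_posPart_real_sub_negPart_real hB
    rw [hσ, Measure.toSignedMeasure_sub_apply hB, ← hσ, ← hp, ← hn] at h1
    rw [← measureReal_eq_measureReal_iff, measureReal_add_apply, measureReal_add_apply]
    linarith
  have hinteg : ∀ (M : Measure E) [IsFiniteMeasure M], IntegrableOn u A M := by
    intro M _
    exact Measure.integrableOn_of_bounded (measure_ne_top _ _) hu.aestronglyMeasurable
      ((ae_restrict_mem hA).mono huc)
  have hbound : ∀ (M : Measure E) [IsFiniteMeasure M], |∫ x in A, u x ∂M| ≤ c * M.real A := by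
    intro M _
    exact norm_setIntegral_le_of_norm_le_const (f := u) (measure_lt_top _ _) huc
  have heq : ∫ x in A, u x ∂ν + ∫ x in A, u x ∂n = ∫ x in A, u x ∂ν' + ∫ x in A, u x ∂p := by
    rw [← integral_add_measure (hinteg ν) (hinteg n), ← integral_add_measure (hinteg ν') (hinteg p),
      ← Measure.restrict_add, ← Measure.restrict_add, hadd]
  have htv : tvOn ν ν' hν hν' A = p.real A + n.real A := by
    rw [tvOn, SignedMeasure.totalVariation, Measure.add_apply,
      ENNReal.toReal_add (measure_ne_top _ _) (measure_ne_top _ _)]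
    rfl
  have hp' := abs_le.1 (hbound p)
  have hn' := abs_le.1 (hbound n)
  rw [htv, abs_le]
  constructor <;> linarith

theorem sub_le_tvOn (ν ν' : Measure E) (hν : IsFiniteMeasure ν) (hν' : IsFiniteMeasure ν')
    {A T : Set E} (hA : MeasurableSet A) (hT : MeasurableSet T) :
    (ν.real (A ∩ T) - ν'.real (A ∩ T)) - (ν.real (A ∩ Tᶜ) - ν'.real (A ∩ Tᶜ))
      ≤ tvOn ν ν' hν hν' A := by
  have hmeas : Measurable (T.indicator (fun _ => (1 : ℝ)) - Tᶜ.indicator fun _ => (1 : ℝ)) :=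
    (measurable_const.indicator hT).sub (measurable_const.indicator hT.compl)
  have h := abs_setIntegral_sub_le_mul_tvOn ν ν' hν hν' hA (c := 1) hmeas (by
    intro x _
    by_cases hx : x ∈ T <;> simp [hx])
  have hI : ∀ (M : Measure E) [IsFiniteMeasure M],
      ∫ x in A, (T.indicator (fun _ => (1 : ℝ)) - Tᶜ.indicator fun _ => (1 : ℝ)) x ∂M =
        M.real (A ∩ T) - M.real (A ∩ Tᶜ) := by
    intro M _
    simp only [Pi.sub_apply]
    rw [integral_sub ((integrable_const _).indicator hT)
      ((integrable_const _).indicator hT.compl), integral_indicator hT,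
      integral_indicator hT.compl, Measure.restrict_restrict hT,
      Measure.restrict_restrict hT.compl]
    simp [Set.inter_comm]
  rw [hI ν, hI ν', one_mul] at h
  linarith [(abs_le.1 h).2]

theorem tvOn_le_add (ν ν' : Measure E) (hν : IsFiniteMeasure ν) (hν' : IsFiniteMeasure ν')
    {A : Set E} (hA : MeasurableSet A) :
    tvOn ν ν' hν hν' A ≤ ν.real Set.univ + ν'.real Set.univ := by
  obtain ⟨H, hH, h⟩ := exists_tvOn_eq ν ν' hν hν' hA
  have h1 : ν.real (A ∩ H) ≤ ν.real Set.univ := measureReal_mono (Set.subset_univ _)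
  have h2 : ν'.real (A ∩ Hᶜ) ≤ ν'.real Set.univ := measureReal_mono (Set.subset_univ _)
  have h3 : 0 ≤ ν'.real (A ∩ H) := measureReal_nonneg
  have h4 : 0 ≤ ν.real (A ∩ Hᶜ) := measureReal_nonneg
  linarith

/-- Over a countably generated `σ`-algebra the total variation of the difference of two measurable
families of finite measures is measurable. -/
theorem measurable_tvOn [MeasurableSpace.CountablyGenerated E] {S : Type*} [MeasurableSpace S]
    (μ μ' : S → Measure E) (hμ : ∀ r, IsFiniteMeasure (μ r)) (hμ' : ∀ r, IsFiniteMeasure (μ' r))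
    (hm : ∀ A, MeasurableSet A → Measurable fun r => μ r A)
    (hm' : ∀ A, MeasurableSet A → Measurable fun r => μ' r A)
    {A : Set E} (hA : MeasurableSet A) :
    Measurable fun r => tvOn (μ r) (μ' r) (hμ r) (hμ' r) A := by
  obtain ⟨b, hbc, hbE⟩ := MeasurableSpace.CountablyGenerated.isCountablyGenerated (α := E)
  set 𝒜 := generateSetAlgebra b with h𝒜
  have h𝒜c : 𝒜.Countable := countable_generateSetAlgebra hbc
  have hgen : ‹MeasurableSpace E› = MeasurableSpace.generateFrom 𝒜 := by
    rw [h𝒜, generateFrom_generateSetAlgebra_eq, hbE]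
  have h𝒜m : ∀ T ∈ 𝒜, MeasurableSet T := fun T hT => by
    rw [hgen]; exact MeasurableSpace.measurableSet_generateFrom hT
  have h𝒜e : 𝒜.Nonempty := ⟨∅, isSetAlgebra_generateSetAlgebra.empty_mem⟩
  have : Countable 𝒜 := h𝒜c
  have : Nonempty 𝒜 := h𝒜e.to_subtype
  set g : 𝒜 → S → ℝ := fun T r => ((μ r).real (A ∩ T) - (μ' r).real (A ∩ T)) -
    ((μ r).real (A ∩ (T : Set E)ᶜ) - (μ' r).real (A ∩ (T : Set E)ᶜ)) with hg
  have hle : ∀ T r, g T r ≤ tvOn (μ r) (μ' r) (hμ r) (hμ' r) A := fun T r =>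
    sub_le_tvOn (μ r) (μ' r) (hμ r) (hμ' r) hA (h𝒜m T T.2)
  have hsup : (fun r => tvOn (μ r) (μ' r) (hμ r) (hμ' r) A) = fun r => ⨆ T, g T r := by
    funext r
    have := hμ r
    have := hμ' r
    refine le_antisymm (le_of_forall_pos_le_add fun ε hε => ?_) (ciSup_le fun T => hle T r)
    obtain ⟨H, hH, htv⟩ := exists_tvOn_eq (μ r) (μ' r) (hμ r) (hμ' r) hA
    obtain ⟨T, hT, hHT⟩ := (Measure.MeasureDense.of_generateFrom_isSetAlgebra_finite
      (μ := μ r + μ' r) isSetAlgebra_generateSetAlgebra hgen).approx H hH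
      (measure_ne_top _ _) (ε / 2) (by positivity)
    have hclose : (μ r).real (symmDiff H T) + (μ' r).real (symmDiff H T) ≤ ε / 2 := by
      rw [← measureReal_add_apply]
      exact ENNReal.toReal_le_of_le_ofReal (by positivity) hHT.le
    have hdiff : ∀ (M : Measure E) [IsFiniteMeasure M] (X Y : Set E),
        M.real (A ∩ X) ≤ M.real (A ∩ Y) + M.real (symmDiff X Y) := by
      intro M _ X Y
      refine (measureReal_mono ?_).trans (measureReal_union_le _ _)
      intro x hx
      by_cases hxY : x ∈ Y
      · exact Or.inl ⟨hx.1, hxY⟩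
      · exact Or.inr (Or.inl ⟨hx.2, hxY⟩)
    have h1 := hdiff (μ r) H T
    have h2 := hdiff (μ' r) T H
    have h3 := hdiff (μ r) Tᶜ Hᶜ
    have h4 := hdiff (μ' r) Hᶜ Tᶜ
    rw [compl_symmDiff_compl] at h3 h4
    rw [symmDiff_comm T H] at h2 h3
    have hgT : g ⟨T, hT⟩ r ≤ ⨆ T, g T r :=
      le_ciSup (f := fun T => g T r) ⟨_, Set.forall_mem_range.2 fun T => hle T r⟩ ⟨T, hT⟩
    simp only [hg] at hgT
    linarith
  rw [hsup]
  refine Measurable.iSup fun T => ?_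
  have hTm := h𝒜m T T.2
  exact (((hm _ (hA.inter hTm)).ennreal_toReal).sub ((hm' _ (hA.inter hTm)).ennreal_toReal)).sub
    (((hm _ (hA.inter hTm.compl)).ennreal_toReal).sub
      ((hm' _ (hA.inter hTm.compl)).ennreal_toReal))

end TotalVariation

section Drift

variable {E : Type*} [MeasurableSpace E]

/-- The part of the uniqueness hypotheses that enters the pointwise-in-time estimates. -/
structure EventuallyConservative (K : E → E → Measure E) (φ : E → E → ℝ) (μ₀ : Measure E)
    (c' R : ℝ) : Prop where
  kernel_measurable : ∀ A : Set E, MeasurableSet A → Measurable fun p : E × E => K p.1 p.2 A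
  kernel_finite : ∀ x y, IsFiniteMeasure (K x y)
  measurable : Measurable fun p : E × E => φ p.1 p.2
  nonneg : ∀ x y, 0 ≤ φ x y
  symm : ∀ x y, φ x y = φ y x
  conservative : Conservative K φ
  const_pos : 0 < c'
  kernel_le : ∀ x y, Kbar K x y ≤ c' * φ x y
  radius_pos : 0 < R
  eq_off : ∀ x y : E, (x, y) ∉ Dset φ μ₀ R ×ˢ Dset φ μ₀ R → φ x y = Kbar K x y

/-- The `φ`-potential of `ν` is dominated by the one of `μ₀`. -/
def PotentialLE (φ : E → E → ℝ) (μ₀ ν : Measure E) : Prop :=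
  ∀ x, ∫⁻ u, ENNReal.ofReal (φ x u) ∂ν ≤ ∫⁻ u, ENNReal.ofReal (φ x u) ∂μ₀

/-- Rate at which mass of `B` is gained by coagulation. -/
def gainRate (K : E → E → Measure E) (ν : Measure E) (B : Set E) : ENNReal :=
  ∫⁻ x, ∫⁻ y, K x y B ∂ν ∂ν

/-- Rate at which mass of `B` is lost by coagulation. -/
def lossRate (K : E → E → Measure E) (ν : Measure E) (B : Set E) : ENNReal :=
  ∫⁻ y in B, ∫⁻ x, K x y Set.univ ∂ν ∂ν

/-- Rate of `φ`-interaction of the part of `ν` in `B` with `ν'`. -/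
def fluxRate (φ : E → E → ℝ) (ν' ν : Measure E) (B : Set E) : ENNReal :=
  ∫⁻ y in B, ∫⁻ x, ENNReal.ofReal (φ x y) ∂ν' ∂ν

/-- The right-hand side of the Flory equation, tested against the indicator of `B`. -/
def floryDrift (K : E → E → Measure E) (φ : E → E → ℝ) (μ₀ ν : Measure E) (B : Set E) : ℝ :=
  (1 / 2) * (gainRate K ν B).toReal + (fluxRate φ ν ν B).toReal - (lossRate K ν B).toReal
    - (fluxRate φ μ₀ ν B).toReal

variable {K : E → E → Measure E} {φ : E → E → ℝ} {μ₀ : Measure E} {c' R : ℝ}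

theorem EventuallyConservative.ofReal_measurable (h : EventuallyConservative K φ μ₀ c' R) :
    Measurable fun p : E × E => ENNReal.ofReal (φ p.1 p.2) :=
  h.measurable.ennreal_ofReal

theorem EventuallyConservative.measurableSet_Dset [SFinite μ₀]
    (h : EventuallyConservative K φ μ₀ c' R) (k : ℝ) : MeasurableSet (Dset φ μ₀ k) :=
  measurableSet_le h.ofReal_measurable.lintegral_prod_right' measurable_const

theorem EventuallyConservative.kernel_univ_le (h : EventuallyConservative K φ μ₀ c' R) (x y : E) :
    K x y Set.univ ≤ ENNReal.ofReal c' * ENNReal.ofReal (φ x y) := by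
  have := h.kernel_finite x y
  rw [← ENNReal.ofReal_mul h.const_pos.le, ← ENNReal.ofReal_toReal (measure_ne_top (K x y) _)]
  exact ENNReal.ofReal_le_ofReal (h.kernel_le x y)

/-- Coagulation never produces an element of a sublevel set out of a pair not contained in it. -/
theorem EventuallyConservative.kernel_eq_zero [SFinite μ₀]
    (h : EventuallyConservative K φ μ₀ c' R)
    {k : ℝ} {x y : E} (hxy : (x, y) ∉ Dset φ μ₀ k ×ˢ Dset φ μ₀ k) : K x y (Dset φ μ₀ k) = 0 := by
  have := h.kernel_finite x y
  have hset : MeasurableSet {p : E × E | φ p.1 p.2 = φ x p.2 + φ y p.2} := by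
    refine measurableSet_eq_fun h.measurable ?_
    exact (h.measurable.comp (measurable_const.prodMk measurable_snd)).add
      (h.measurable.comp (measurable_const.prodMk measurable_snd))
  have hae : ∀ᵐ z ∂(K x y), ∀ᵐ q ∂μ₀, φ z q = φ x q + φ y q :=
    (Measure.ae_ae_comm (p := fun z q => φ z q = φ x q + φ y q) hset).2
      (Filter.Eventually.of_forall (h.conservative x y))
  have hnot : ∀ᵐ z ∂(K x y), z ∉ Dset φ μ₀ k := by
    filter_upwards [hae] with z hz hzk
    refine hxy ⟨?_, ?_⟩
    · refine le_trans (lintegral_mono_ae ?_) hzk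
      filter_upwards [hz] with q hq
      exact ENNReal.ofReal_le_ofReal (by linarith [h.nonneg y q])
    · refine le_trans (lintegral_mono_ae ?_) hzk
      filter_upwards [hz] with q hq
      exact ENNReal.ofReal_le_ofReal (by linarith [h.nonneg x q])
  simpa using measure_eq_zero_iff_ae_notMem.2 hnot

theorem EventuallyConservative.lintegral_prod_restrict_lt_top [SFinite μ₀]
    (h : EventuallyConservative K φ μ₀ c' R) (ν ν' : Measure E) [IsFiniteMeasure ν]
    [IsFiniteMeasure ν'] (hν' : PotentialLE φ μ₀ ν') :
    ∫⁻ z, ENNReal.ofReal (φ z.1 z.2) ∂((ν.restrict (Dset φ μ₀ R)).prod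
      (ν'.restrict (Dset φ μ₀ R))) < ⊤ := by
  rw [lintegral_prod _ h.ofReal_measurable.aemeasurable]
  have hle : ∫⁻ x in Dset φ μ₀ R, ∫⁻ y in Dset φ μ₀ R, ENNReal.ofReal (φ x y) ∂ν' ∂ν ≤
      ∫⁻ _ in Dset φ μ₀ R, ENNReal.ofReal R ∂ν :=
    setLIntegral_mono' (h.measurableSet_Dset R) fun x hx =>
      ((lintegral_mono' Measure.restrict_le_self le_rfl).trans (hν' x)).trans hx
  refine hle.trans_lt ?_
  rw [setLIntegral_const]
  exact ENNReal.mul_lt_top ENNReal.ofReal_lt_top (measure_lt_top _ _)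

theorem EventuallyConservative.integrable_of_abs_le [SFinite μ₀]
    (h : EventuallyConservative K φ μ₀ c' R) (ν ν' : Measure E) [IsFiniteMeasure ν]
    [IsFiniteMeasure ν'] (hν' : PotentialLE φ μ₀ ν')
    {w : E × E → ℝ} (hw : Measurable w) {C : ℝ} (hwC : ∀ z, |w z| ≤ C * φ z.1 z.2) :
    Integrable w ((ν.restrict (Dset φ μ₀ R)).prod (ν'.restrict (Dset φ μ₀ R))) := by
  have hφ : Integrable (fun z : E × E => φ z.1 z.2)
      ((ν.restrict (Dset φ μ₀ R)).prod (ν'.restrict (Dset φ μ₀ R))) := by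
    refine ⟨h.measurable.aestronglyMeasurable, ?_⟩
    rw [hasFiniteIntegral_iff_ofReal (Filter.Eventually.of_forall fun z => h.nonneg _ _)]
    exact h.lintegral_prod_restrict_lt_top ν ν' hν'
  exact (hφ.const_mul C).mono' hw.aestronglyMeasurable (Filter.Eventually.of_forall hwC)

theorem EventuallyConservative.abs_setIntegral_le [SFinite μ₀]
    (h : EventuallyConservative K φ μ₀ c' R) (ν : Measure E) (hν : PotentialLE φ μ₀ ν)
    {x : E} (hx : x ∈ Dset φ μ₀ R) {w : E → ℝ} {C : ℝ} (hC : 0 ≤ C)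
    (hwC : ∀ y, |w y| ≤ C * φ x y) :
    |∫ y in Dset φ μ₀ R, w y ∂ν| ≤ C * R := by
  have hle : ∫⁻ y in Dset φ μ₀ R, ENNReal.ofReal |w y| ∂ν ≤ ENNReal.ofReal (C * R) :=
    calc ∫⁻ y in Dset φ μ₀ R, ENNReal.ofReal |w y| ∂ν
        ≤ ∫⁻ y in Dset φ μ₀ R, ENNReal.ofReal C * ENNReal.ofReal (φ x y) ∂ν := by
          refine lintegral_mono fun y => ?_
          rw [← ENNReal.ofReal_mul hC]
          exact ENNReal.ofReal_le_ofReal (hwC y)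
      _ = ENNReal.ofReal C * ∫⁻ y in Dset φ μ₀ R, ENNReal.ofReal (φ x y) ∂ν :=
          lintegral_const_mul' _ _ ENNReal.ofReal_ne_top
      _ ≤ ENNReal.ofReal C * ENNReal.ofReal R := by
          gcongr
          exact ((lintegral_mono' Measure.restrict_le_self le_rfl).trans (hν x)).trans hx
      _ = ENNReal.ofReal (C * R) := (ENNReal.ofReal_mul hC).symm
  refine (norm_integral_le_lintegral_norm w).trans ?_
  exact ENNReal.toReal_le_of_le_ofReal (mul_nonneg hC h.radius_pos.le) hle

/-- A quadratic functional with a density dominated by `φ` is Lipschitz in total variation. -/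
theorem EventuallyConservative.abs_integral_prod_sub_le [SFinite μ₀]
    (h : EventuallyConservative K φ μ₀ c' R) (ν ν' : Measure E) (hν : IsFiniteMeasure ν)
    (hν' : IsFiniteMeasure ν') (hνφ : PotentialLE φ μ₀ ν) (hν'φ : PotentialLE φ μ₀ ν')
    {w : E × E → ℝ} (hw : Measurable w) {C : ℝ} (hC : 0 ≤ C)
    (hwC : ∀ z, |w z| ≤ C * φ z.1 z.2) :
    |∫ z, w z ∂((ν.restrict (Dset φ μ₀ R)).prod (ν.restrict (Dset φ μ₀ R))) -
      ∫ z, w z ∂((ν'.restrict (Dset φ μ₀ R)).prod (ν'.restrict (Dset φ μ₀ R)))|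
      ≤ 2 * C * R * tvOn ν ν' hν hν' (Dset φ μ₀ R) := by
  have hD := h.measurableSet_Dset R
  have hu := abs_setIntegral_sub_le_mul_tvOn ν ν' hν hν' hD (c := C * R)
    (hw.stronglyMeasurable.integral_prod_right' (ν := ν.restrict (Dset φ μ₀ R))).measurable
    fun x hx => h.abs_setIntegral_le ν hνφ hx hC fun y => hwC (x, y)
  have hv := abs_setIntegral_sub_le_mul_tvOn ν ν' hν hν' hD (c := C * R)
    (hw.stronglyMeasurable.integral_prod_left' (μ := ν'.restrict (Dset φ μ₀ R))).measurable
    fun y hy => h.abs_setIntegral_le ν' hν'φ hy hC fun x => by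
      rw [h.symm]; exact hwC (x, y)
  rw [integral_prod _ (h.integrable_of_abs_le ν ν hνφ hw hwC),
    integral_prod_symm _ (h.integrable_of_abs_le ν' ν' hν'φ hw hwC)]
  have hmixed := h.integrable_of_abs_le ν' ν hνφ hw hwC
  have hswap := (integral_prod _ hmixed).symm.trans (integral_prod_symm _ hmixed)
  rw [abs_le] at hu hv ⊢
  constructor <;> linarith [hu.1, hu.2, hv.1, hv.2]

theorem EventuallyConservative.fluxRate_le [SFinite μ₀] (h : EventuallyConservative K φ μ₀ c' R)
    {ν' : Measure E} (ν : Measure E) (hν' : PotentialLE φ μ₀ ν') {B : Set E} {k : ℝ}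
    (hBk : B ⊆ Dset φ μ₀ k) : fluxRate φ ν' ν B ≤ ENNReal.ofReal k * ν Set.univ :=
  calc fluxRate φ ν' ν B
      ≤ ∫⁻ y in Dset φ μ₀ k, ∫⁻ x, ENNReal.ofReal (φ x y) ∂ν' ∂ν := lintegral_mono_set hBk
    _ ≤ ∫⁻ _ in Dset φ μ₀ k, ENNReal.ofReal k ∂ν := by
        refine setLIntegral_mono' (h.measurableSet_Dset k) fun y hy => ?_
        simp_rw [h.symm _ y]
        exact (hν' y).trans hy
    _ ≤ ENNReal.ofReal k * ν Set.univ := by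
        rw [setLIntegral_const]
        gcongr
        exact Set.subset_univ _

theorem EventuallyConservative.fluxRate_le_fluxRate (h : EventuallyConservative K φ μ₀ c' R)
    {ν' : Measure E} (ν : Measure E) (hν' : PotentialLE φ μ₀ ν') (B : Set E) :
    fluxRate φ ν' ν B ≤ fluxRate φ μ₀ ν B := by
  refine lintegral_mono fun y => ?_
  simp_rw [h.symm _ y]
  exact hν' y

theorem EventuallyConservative.lossRate_le (h : EventuallyConservative K φ μ₀ c' R)
    (ν : Measure E) (B : Set E) : lossRate K ν B ≤ ENNReal.ofReal c' * fluxRate φ ν ν B := by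
  rw [fluxRate, ← lintegral_const_mul' _ _ ENNReal.ofReal_ne_top]
  refine lintegral_mono fun y => ?_
  rw [← lintegral_const_mul' _ _ ENNReal.ofReal_ne_top]
  exact lintegral_mono fun x => h.kernel_univ_le x y

theorem EventuallyConservative.gainRate_le [SFinite μ₀] (h : EventuallyConservative K φ μ₀ c' R)
    (ν : Measure E) [SFinite ν] {B : Set E} {k : ℝ} (hBk : B ⊆ Dset φ μ₀ k) :
    gainRate K ν B ≤ lossRate K ν (Dset φ μ₀ k) := by
  have hK := h.kernel_measurable _ (h.measurableSet_Dset k)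
  calc gainRate K ν B ≤ ∫⁻ x, ∫⁻ y, K x y (Dset φ μ₀ k) ∂ν ∂ν :=
        lintegral_mono fun x => lintegral_mono fun y => measure_mono hBk
    _ = ∫⁻ y, ∫⁻ x, K x y (Dset φ μ₀ k) ∂ν ∂ν := lintegral_lintegral_swap hK.aemeasurable
    _ ≤ ∫⁻ y, (Dset φ μ₀ k).indicator (fun y => ∫⁻ x, K x y Set.univ ∂ν) y ∂ν := by
        refine lintegral_mono fun y => ?_
        by_cases hy : y ∈ Dset φ μ₀ k
        · rw [Set.indicator_of_mem hy]
          exact lintegral_mono fun x => measure_mono (Set.subset_univ _)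
        · simp [h.kernel_eq_zero fun hxy => hy hxy.2]
    _ = lossRate K ν (Dset φ μ₀ k) := lintegral_indicator (h.measurableSet_Dset k) _

theorem EventuallyConservative.rates_lt_top [SFinite μ₀] (h : EventuallyConservative K φ μ₀ c' R)
    (ν : Measure E) [IsFiniteMeasure ν] (hν : PotentialLE φ μ₀ ν) {B : Set E} {k : ℝ}
    (hBk : B ⊆ Dset φ μ₀ k) :
    gainRate K ν B < ⊤ ∧ fluxRate φ ν ν B < ⊤ ∧ lossRate K ν B < ⊤ ∧ fluxRate φ μ₀ ν B < ⊤ := by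
  have htop : ENNReal.ofReal k * ν Set.univ < ⊤ :=
    ENNReal.mul_lt_top ENNReal.ofReal_lt_top (measure_lt_top _ _)
  have hloss : ∀ A ⊆ Dset φ μ₀ k, lossRate K ν A < ⊤ := fun A hA =>
    (h.lossRate_le ν A).trans_lt (ENNReal.mul_lt_top ENNReal.ofReal_lt_top
      ((h.fluxRate_le ν hν hA).trans_lt htop))
  exact ⟨(h.gainRate_le ν hBk).trans_lt (hloss _ subset_rfl),
    (h.fluxRate_le ν hν hBk).trans_lt htop, hloss B hBk,
    (h.fluxRate_le ν (fun _ => le_rfl) hBk).trans_lt htop⟩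

theorem EventuallyConservative.measurable_Kbar (h : EventuallyConservative K φ μ₀ c' R) :
    Measurable fun z : E × E => Kbar K z.1 z.2 :=
  (h.kernel_measurable _ MeasurableSet.univ).ennreal_toReal

theorem EventuallyConservative.abs_sub_Kbar_le (h : EventuallyConservative K φ μ₀ c' R)
    (x y : E) : |φ x y - Kbar K x y| ≤ (c' + 1) * φ x y := by
  have h1 := h.kernel_le x y
  have h2 := h.nonneg x y
  have h3 : 0 ≤ Kbar K x y := ENNReal.toReal_nonneg
  have h4 := mul_nonneg h.const_pos.le h2
  rw [abs_le]
  constructor <;> linarith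

theorem EventuallyConservative.gainRate_toReal [SFinite μ₀]
    (h : EventuallyConservative K φ μ₀ c' R) (ν : Measure E) [IsFiniteMeasure ν]
    {B : Set E} (hB : MeasurableSet B) (hBD : B ⊆ Dset φ μ₀ R) :
    (gainRate K ν B).toReal = ∫ z, (K z.1 z.2 B).toReal
      ∂((ν.restrict (Dset φ μ₀ R)).prod (ν.restrict (Dset φ μ₀ R))) := by
  have hK := h.kernel_measurable B hB
  have hzero : ∀ x y, (x, y) ∉ Dset φ μ₀ R ×ˢ Dset φ μ₀ R → K x y B = 0 := fun x y hxy =>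
    measure_mono_null hBD (h.kernel_eq_zero hxy)
  rw [integral_toReal hK.aemeasurable (Filter.Eventually.of_forall fun z =>
    have := h.kernel_finite z.1 z.2; measure_lt_top _ _), Measure.prod_restrict,
    ← lintegral_indicator ((h.measurableSet_Dset R).prod (h.measurableSet_Dset R)),
    Set.indicator_eq_self.2, lintegral_prod _ hK.aemeasurable]
  · rfl
  · intro z hz
    by_contra hmem
    exact hz (hzero z.1 z.2 hmem)

/-- Only interactions inside the sublevel set contribute to the net `φ`-flux into `B`. -/
theorem EventuallyConservative.fluxRate_sub_lossRate [SFinite μ₀]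
    (h : EventuallyConservative K φ μ₀ c' R) (ν : Measure E) [IsFiniteMeasure ν]
    (hν : PotentialLE φ μ₀ ν) {B : Set E} (hB : MeasurableSet B) (hBD : B ⊆ Dset φ μ₀ R) :
    (fluxRate φ ν ν B).toReal - (lossRate K ν B).toReal =
      ∫ z, (B ×ˢ Set.univ).indicator (fun z : E × E => φ z.2 z.1 - Kbar K z.2 z.1) z
        ∂((ν.restrict (Dset φ μ₀ R)).prod (ν.restrict (Dset φ μ₀ R))) := by
  set D := Dset φ μ₀ R with hDdef
  have hD : MeasurableSet D := h.measurableSet_Dset R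
  have hφm : Measurable fun z : E × E => ENNReal.ofReal (φ z.2 z.1) :=
    h.ofReal_measurable.comp measurable_swap
  have hKm : Measurable fun z : E × E => K z.2 z.1 Set.univ :=
    (h.kernel_measurable _ MeasurableSet.univ).comp measurable_swap
  have hsplit : ∀ g : E × E → ENNReal, Measurable g →
      ∫⁻ y in B, ∫⁻ x, g (y, x) ∂ν ∂ν =
        ∫⁻ z, g z ∂((ν.restrict B).prod (ν.restrict D)) +
          ∫⁻ z, g z ∂((ν.restrict B).prod (ν.restrict Dᶜ)) := by
    intro g hg
    rw [lintegral_prod _ hg.aemeasurable, lintegral_prod _ hg.aemeasurable,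
      ← lintegral_add_left hg.lintegral_prod_right']
    exact lintegral_congr fun y => (lintegral_add_compl _ hD).symm
  have hrest : ∫⁻ z, ENNReal.ofReal (φ z.2 z.1) ∂((ν.restrict B).prod (ν.restrict Dᶜ)) =
      ∫⁻ z, K z.2 z.1 Set.univ ∂((ν.restrict B).prod (ν.restrict Dᶜ)) := by
    rw [Measure.prod_restrict]
    refine setLIntegral_congr_fun (hB.prod hD.compl) fun z hz => ?_
    have := h.kernel_finite z.2 z.1
    rw [h.eq_off z.2 z.1 fun hz' => hz.2 hz'.1, Kbar, ENNReal.ofReal_toReal (measure_ne_top _ _)]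
  obtain ⟨-, hF, hL, -⟩ := h.rates_lt_top ν hν hBD
  have hFs : fluxRate φ ν ν B = _ := hsplit _ hφm
  have hLs : lossRate K ν B = _ := hsplit _ hKm
  rw [hrest] at hFs
  rw [hFs] at hF
  rw [hLs] at hL
  rw [hFs, hLs, ENNReal.toReal_add (ENNReal.add_lt_top.1 hF).1.ne (ENNReal.add_lt_top.1 hF).2.ne,
    ENNReal.toReal_add (ENNReal.add_lt_top.1 hL).1.ne (ENNReal.add_lt_top.1 hL).2.ne]
  have hinteg : ∀ w : E × E → ℝ, Measurable w → (∀ z, |w z| ≤ (c' + 1) * φ z.1 z.2) →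
      Integrable w ((ν.restrict B).prod (ν.restrict D)) := fun w hw hwC =>
    (h.integrable_of_abs_le ν ν hν hw hwC).mono_measure
      (Measure.prod_mono (Measure.restrict_mono hBD le_rfl) le_rfl)
  rw [integral_indicator (hB.prod MeasurableSet.univ), ← Measure.prod_restrict,
    Measure.restrict_restrict hB, Set.inter_eq_self_of_subset_left hBD, Measure.restrict_univ,
    integral_sub (hinteg (fun z => φ z.2 z.1) (h.measurable.comp measurable_swap) fun z => ?_)
      (hinteg (fun z => Kbar K z.2 z.1) (h.measurable_Kbar.comp measurable_swap) fun z => ?_)]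
  · rw [← integral_toReal (μ := (ν.restrict B).prod (ν.restrict D)) hφm.aemeasurable
        (Filter.Eventually.of_forall fun z => ENNReal.ofReal_lt_top),
      ← integral_toReal (μ := (ν.restrict B).prod (ν.restrict D)) hKm.aemeasurable
        (Filter.Eventually.of_forall fun z =>
        have := h.kernel_finite z.2 z.1; measure_lt_top _ _)]
    simp_rw [ENNReal.toReal_ofReal (h.nonneg _ _)]
    simp only [Kbar]
    ring
  · rw [h.symm, abs_of_nonneg (h.nonneg _ _)]
    nlinarith [h.nonneg z.1 z.2, h.const_pos]
  · rw [h.symm z.1, abs_of_nonneg (show 0 ≤ Kbar K z.2 z.1 from ENNReal.toReal_nonneg)]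
    linarith [h.nonneg z.2 z.1, h.kernel_le z.2 z.1]

theorem EventuallyConservative.fluxRate_toReal [SFinite μ₀]
    (h : EventuallyConservative K φ μ₀ c' R) (ν : Measure E)
    {B : Set E} (hB : MeasurableSet B) (hBD : B ⊆ Dset φ μ₀ R) :
    (fluxRate φ μ₀ ν B).toReal = ∫ y in Dset φ μ₀ R,
      B.indicator (fun y => (∫⁻ x, ENNReal.ofReal (φ x y) ∂μ₀).toReal) y ∂ν := by
  rw [integral_indicator hB, Measure.restrict_restrict hB, Set.inter_eq_self_of_subset_left hBD,
    integral_toReal h.ofReal_measurable.lintegral_prod_left'.aemeasurable]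
  · rfl
  · filter_upwards [ae_restrict_mem hB] with y hy
    simp_rw [h.symm _ y]
    exact (hBD hy).trans_lt ENNReal.ofReal_lt_top

/-- The drift of the Flory equation is Lipschitz in total variation on `D_R`. -/
theorem EventuallyConservative.floryDrift_sub_le [SFinite μ₀]
    (h : EventuallyConservative K φ μ₀ c' R) (ν ν' : Measure E) (hν : IsFiniteMeasure ν)
    (hν' : IsFiniteMeasure ν') (hνφ : PotentialLE φ μ₀ ν) (hν'φ : PotentialLE φ μ₀ ν')
    {H : Set E} (hH : MeasurableSet H) :
    (floryDrift K φ μ₀ ν (Dset φ μ₀ R ∩ H) - floryDrift K φ μ₀ ν' (Dset φ μ₀ R ∩ H)) -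
      (floryDrift K φ μ₀ ν (Dset φ μ₀ R ∩ Hᶜ) - floryDrift K φ μ₀ ν' (Dset φ μ₀ R ∩ Hᶜ))
      ≤ 3 * R * (c' + 1) * tvOn ν ν' hν hν' (Dset φ μ₀ R) := by
  set D := Dset φ μ₀ R with hDdef
  have hD : MeasurableSet D := h.measurableSet_Dset R
  set B := D ∩ H
  set B' := D ∩ Hᶜ
  have hB : MeasurableSet B := hD.inter hH
  have hB' : MeasurableSet B' := hD.inter hH.compl
  have hBD : B ⊆ D := Set.inter_subset_left
  have hBD' : B' ⊆ D := Set.inter_subset_left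
  have hdisj : ∀ x, x ∈ B → x ∉ B' := fun x hx hx' => hx'.2 hx.2
  let wg : Set E → E × E → ℝ := fun A z => (K z.1 z.2 A).toReal
  let wf : Set E → E × E → ℝ := fun A z =>
    (A ×ˢ Set.univ).indicator (fun z : E × E => φ z.2 z.1 - Kbar K z.2 z.1) z
  let wp : Set E → E → ℝ := fun A y =>
    A.indicator (fun y => (∫⁻ x, ENNReal.ofReal (φ x y) ∂μ₀).toReal) y
  have hwg : ∀ A, MeasurableSet A → Measurable (wg A) := fun A hA =>
    (h.kernel_measurable A hA).ennreal_toReal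
  have hwf : ∀ A, MeasurableSet A → Measurable (wf A) := fun A hA =>
    ((h.measurable.comp measurable_swap).sub (h.measurable_Kbar.comp measurable_swap)).indicator
      (hA.prod MeasurableSet.univ)
  have hwp : ∀ A, MeasurableSet A → Measurable (wp A) := fun A hA =>
    h.ofReal_measurable.lintegral_prod_left'.ennreal_toReal.indicator hA
  have hwg0 : ∀ A z, 0 ≤ wg A z := fun A z => ENNReal.toReal_nonneg
  have hwgle : ∀ A z, wg A z ≤ c' * φ z.1 z.2 := fun A z => by
    have := h.kernel_finite z.1 z.2
    exact (ENNReal.toReal_mono (measure_ne_top _ _) (measure_mono (Set.subset_univ A))).trans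
      (h.kernel_le z.1 z.2)
  have hφ0 : ∀ z : E × E, 0 ≤ (c' + 1) * φ z.1 z.2 := fun z =>
    mul_nonneg (by linarith [h.const_pos]) (h.nonneg _ _)
  have hKφ : ∀ z : E × E, |φ z.2 z.1 - Kbar K z.2 z.1| ≤ (c' + 1) * φ z.1 z.2 := fun z => by
    rw [h.symm z.1]; exact h.abs_sub_Kbar_le _ _
  have hwgabs : ∀ A z, |wg A z| ≤ c' * φ z.1 z.2 := fun A z => by
    rw [abs_of_nonneg (hwg0 A z)]; exact hwgle A z
  have hwfabs : ∀ A z, |wf A z| ≤ (c' + 1) * φ z.1 z.2 := fun A z => by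
    by_cases hz : z ∈ A ×ˢ (Set.univ : Set E)
    · simpa only [wf, Set.indicator_of_mem hz] using hKφ z
    · simpa only [wf, Set.indicator_of_notMem hz, abs_zero] using hφ0 z
  have hpot : ∀ y ∈ D, |(∫⁻ x, ENNReal.ofReal (φ x y) ∂μ₀).toReal| ≤ R := fun y hy => by
    rw [abs_of_nonneg ENNReal.toReal_nonneg]
    simp_rw [h.symm _ y]
    exact ENNReal.toReal_le_of_le_ofReal h.radius_pos.le hy
  have hwpabs : ∀ A, ∀ y ∈ D, |wp A y| ≤ R := fun A y hy => by
    by_cases hyA : y ∈ A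
    · simpa only [wp, Set.indicator_of_mem hyA] using hpot y hy
    · simpa only [wp, Set.indicator_of_notMem hyA, abs_zero] using h.radius_pos.le
  have hG := h.abs_integral_prod_sub_le ν ν' hν hν' hνφ hν'φ (w := fun z => wg B z - wg B' z)
    ((hwg B hB).sub (hwg B' hB')) h.const_pos.le fun z => by
      rw [abs_le]
      constructor <;> linarith [hwg0 B z, hwg0 B' z, hwgle B z, hwgle B' z]
  have hF := h.abs_integral_prod_sub_le ν ν' hν hν' hνφ hν'φ (w := fun z => wf B z - wf B' z)
    (C := c' + 1) ((hwf B hB).sub (hwf B' hB')) (by linarith [h.const_pos]) fun z => by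
      by_cases hz : z.1 ∈ B
      · have hz' : wf B' z = 0 := Set.indicator_of_notMem (fun hz' => hdisj _ hz hz'.1) _
        simpa only [hz', sub_zero] using hwfabs B z
      · have hz' : wf B z = 0 := Set.indicator_of_notMem (fun hz' => hz hz'.1) _
        simpa only [hz', zero_sub, abs_neg] using hwfabs B' z
  have hP := abs_setIntegral_sub_le_mul_tvOn ν ν' hν hν' hD (u := fun y => wp B y - wp B' y)
    ((hwp B hB).sub (hwp B' hB')) (c := R) fun y hy => by
      by_cases hyB : y ∈ B
      · have hy' : wp B' y = 0 := Set.indicator_of_notMem (hdisj y hyB) _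
        simpa only [hy', sub_zero] using hwpabs B y hy
      · have hy' : wp B y = 0 := Set.indicator_of_notMem hyB _
        simpa only [hy', zero_sub, abs_neg] using hwpabs B' y hy
  have hdrift : ∀ (M : Measure E) [IsFiniteMeasure M], PotentialLE φ μ₀ M →
      floryDrift K φ μ₀ M B - floryDrift K φ μ₀ M B' =
        (1 / 2) * ∫ z, (wg B z - wg B' z) ∂((M.restrict D).prod (M.restrict D)) +
        ∫ z, (wf B z - wf B' z) ∂((M.restrict D).prod (M.restrict D)) -
        ∫ y in D, (wp B y - wp B' y) ∂M := by
    intro M _ hM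
    have hip : ∀ A, MeasurableSet A → IntegrableOn (wp A) D M := fun A hA =>
      Measure.integrableOn_of_bounded (measure_ne_top _ _) (hwp A hA).aestronglyMeasurable
        ((ae_restrict_mem hD).mono (hwpabs A))
    rw [integral_sub (h.integrable_of_abs_le M M hM (hwg B hB) (hwgabs B))
        (h.integrable_of_abs_le M M hM (hwg B' hB') (hwgabs B')),
      integral_sub (h.integrable_of_abs_le M M hM (hwf B hB) (hwfabs B))
        (h.integrable_of_abs_le M M hM (hwf B' hB') (hwfabs B')),
      integral_sub (hip B hB) (hip B' hB')]
    have e1 := h.gainRate_toReal M hB hBD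
    have e2 := h.gainRate_toReal M hB' hBD'
    have e3 := h.fluxRate_sub_lossRate M hM hB hBD
    have e4 := h.fluxRate_sub_lossRate M hM hB' hBD'
    have e5 := h.fluxRate_toReal M hB hBD
    have e6 := h.fluxRate_toReal M hB' hBD'
    simp only [floryDrift, wg, wf, wp]
    linarith
  have h1 := hdrift ν hνφ
  have h2 := hdrift ν' hν'φ
  rw [abs_le] at hG hF hP
  nlinarith [hG.2, hF.2, hP.1]

end Drift

section Balance

theorem integral_integral_eq_toReal {E F : Type*} [MeasurableSpace E] [MeasurableSpace F]
    (ν : Measure E) (ν' : Measure F) [SFinite ν'] {w : E × F → ℝ} (hw : Measurable w)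
    (hw0 : ∀ z, 0 ≤ w z) (hfin : ∫⁻ x, ∫⁻ y, ENNReal.ofReal (w (x, y)) ∂ν' ∂ν ≠ ⊤) :
    ∫ x, ∫ y, w (x, y) ∂ν' ∂ν = (∫⁻ x, ∫⁻ y, ENNReal.ofReal (w (x, y)) ∂ν' ∂ν).toReal := by
  have hm : Measurable fun x => ∫⁻ y, ENNReal.ofReal (w (x, y)) ∂ν' :=
    hw.ennreal_ofReal.lintegral_prod_right'
  rw [← integral_toReal hm.aemeasurable (ae_lt_top hm hfin)]
  refine integral_congr_ae (Filter.Eventually.of_forall fun x => ?_)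
  exact integral_eq_lintegral_of_nonneg_ae (Filter.Eventually.of_forall fun y => hw0 _)
    (hw.comp measurable_prodMk_left).aestronglyMeasurable

variable {E : Type*} [MeasurableSpace E] {K : E → E → Measure E} {φ : E → E → ℝ}
  {μ₀ : Measure E} {c' R : ℝ} {μ : ℝ → Measure E}

theorem IsFlorySolution.potentialLE [TopologicalSpace E] (hμ : IsFlorySolution K φ μ)
    (hinit : μ 0 = μ₀) {t : ℝ} (ht : 0 ≤ t) : PotentialLE φ μ₀ (μ t) := fun x =>
  hinit ▸ hμ.2.2.2.2 x t ht

/-- The family `μ` as a kernel. -/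
def timeKernel (μ : ℝ → Measure E)
    (hm : ∀ A : Set E, MeasurableSet A → Measurable fun t : ℝ => μ t A) :
    ProbabilityTheory.Kernel ℝ E :=
  ⟨μ, Measure.measurable_of_measurable_coe _ hm⟩

/-- The coagulation kernel as a kernel from `E × E` to `E`. -/
def coagulationKernel (K : E → E → Measure E)
    (hK : ∀ A : Set E, MeasurableSet A → Measurable fun p : E × E => K p.1 p.2 A) :
    ProbabilityTheory.Kernel (E × E) E :=
  ⟨fun p => K p.1 p.2, Measure.measurable_of_measurable_coe _ hK⟩

theorem measurable_lintegral_family (hfin : ∀ t, IsFiniteMeasure (μ t))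
    (hm : ∀ A : Set E, MeasurableSet A → Measurable fun t : ℝ => μ t A)
    {g : ℝ → E → ENNReal} (hg : Measurable (Function.uncurry g)) :
    Measurable fun t => ∫⁻ y, g t y ∂(μ t) := by
  have := isSFiniteKernel_of_isFiniteMeasure (timeKernel μ hm) hfin
  exact Measurable.lintegral_kernel_prod_right (κ := timeKernel μ hm) hg

theorem measurable_lintegral_lintegral_family (hfin : ∀ t, IsFiniteMeasure (μ t))
    (hm : ∀ A : Set E, MeasurableSet A → Measurable fun t : ℝ => μ t A)
    {g : E × E → ENNReal} (hg : Measurable g) :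
    Measurable fun p : ℝ × E => ∫⁻ x, g (p.2, x) ∂(μ p.1) := by
  have := isSFiniteKernel_of_isFiniteMeasure (timeKernel μ hm) hfin
  exact Measurable.lintegral_kernel_prod_right
    (κ := (timeKernel μ hm).comap (Prod.fst : ℝ × E → ℝ) measurable_fst)
    (f := fun (p : ℝ × E) x => g (p.2, x))
    (hg.comp ((measurable_snd.comp measurable_fst).prodMk measurable_snd))

theorem EventuallyConservative.measurable_lossDensity (h : EventuallyConservative K φ μ₀ c' R)
    (hfin : ∀ t, IsFiniteMeasure (μ t))
    (hm : ∀ A : Set E, MeasurableSet A → Measurable fun t : ℝ => μ t A) :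
    Measurable fun p : ℝ × E => ∫⁻ x, K x p.2 Set.univ ∂(μ p.1) :=
  measurable_lintegral_lintegral_family hfin hm
    ((h.kernel_measurable _ MeasurableSet.univ).comp measurable_swap)

theorem EventuallyConservative.measurable_fluxDensity (h : EventuallyConservative K φ μ₀ c' R)
    (hfin : ∀ t, IsFiniteMeasure (μ t))
    (hm : ∀ A : Set E, MeasurableSet A → Measurable fun t : ℝ => μ t A) :
    Measurable fun p : ℝ × E => ∫⁻ x, ENNReal.ofReal (φ x p.2) ∂(μ p.1) :=
  measurable_lintegral_lintegral_family hfin hm (h.ofReal_measurable.comp measurable_swap)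

theorem EventuallyConservative.measurable_potential [SFinite μ₀]
    (h : EventuallyConservative K φ μ₀ c' R) :
    Measurable fun y : E => ∫⁻ x, ENNReal.ofReal (φ x y) ∂μ₀ :=
  h.ofReal_measurable.lintegral_prod_left'

theorem measurable_setLIntegral_family (hfin : ∀ t, IsFiniteMeasure (μ t))
    (hm : ∀ A : Set E, MeasurableSet A → Measurable fun t : ℝ => μ t A)
    {g : ℝ × E → ENNReal} (hg : Measurable g) {B : Set E} (hB : MeasurableSet B) :
    Measurable fun t => ∫⁻ y in B, g (t, y) ∂(μ t) := by
  simp_rw [← lintegral_indicator hB]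
  refine measurable_lintegral_family hfin hm ?_
  convert hg.indicator (measurable_snd hB) using 1
  funext ⟨t, y⟩
  rfl

theorem EventuallyConservative.measurable_gainRate (h : EventuallyConservative K φ μ₀ c' R)
    (hfin : ∀ t, IsFiniteMeasure (μ t))
    (hm : ∀ A : Set E, MeasurableSet A → Measurable fun t : ℝ => μ t A)
    {B : Set E} (hB : MeasurableSet B) : Measurable fun t => gainRate K (μ t) B :=
  measurable_lintegral_family hfin hm
    (measurable_lintegral_lintegral_family hfin hm (h.kernel_measurable B hB))

theorem EventuallyConservative.measurable_lossRate (h : EventuallyConservative K φ μ₀ c' R)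
    (hfin : ∀ t, IsFiniteMeasure (μ t))
    (hm : ∀ A : Set E, MeasurableSet A → Measurable fun t : ℝ => μ t A)
    {B : Set E} (hB : MeasurableSet B) : Measurable fun t => lossRate K (μ t) B :=
  measurable_setLIntegral_family hfin hm (h.measurable_lossDensity hfin hm) hB

theorem EventuallyConservative.measurable_fluxRate (h : EventuallyConservative K φ μ₀ c' R)
    (hfin : ∀ t, IsFiniteMeasure (μ t))
    (hm : ∀ A : Set E, MeasurableSet A → Measurable fun t : ℝ => μ t A)
    {B : Set E} (hB : MeasurableSet B) : Measurable fun t => fluxRate φ (μ t) (μ t) B :=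
  measurable_setLIntegral_family hfin hm (h.measurable_fluxDensity hfin hm) hB

theorem EventuallyConservative.measurable_initialFluxRate [SFinite μ₀]
    (h : EventuallyConservative K φ μ₀ c' R) (hfin : ∀ t, IsFiniteMeasure (μ t))
    (hm : ∀ A : Set E, MeasurableSet A → Measurable fun t : ℝ => μ t A)
    {B : Set E} (hB : MeasurableSet B) : Measurable fun t => fluxRate φ μ₀ (μ t) B :=
  measurable_setLIntegral_family hfin hm (h.measurable_potential.comp measurable_snd) hB

/-- The loss terms are integrable in time on compact sets. -/
theorem IsFlorySolution.lintegral_rates_lt_top [MetricSpace E] [LocallyCompactSpace E]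
    [BorelSpace E] (hμ : IsFlorySolution K φ μ) (hinit : μ 0 = μ₀) {t : ℝ} (ht : 0 ≤ t)
    {C : Set E} (hC : IsCompact C) :
    ∫⁻ s in Set.Ioc 0 t, lossRate K (μ s) C < ⊤ ∧
      ∫⁻ s in Set.Ioc 0 t, fluxRate φ μ₀ (μ s) C < ⊤ := by
  obtain ⟨f, hf1, -, hfc, hf01⟩ := exists_continuous_one_zero_of_isCompact hC isClosed_empty
    (Set.disjoint_empty C)
  obtain ⟨h1, h2⟩ := hμ.2.2.1 f f.continuous hfc (fun x => (hf01 x).1) t ht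
  rw [hinit] at h2
  have hle : ∀ (ν ν' : Measure E) (w : E → E → ENNReal), ∫⁻ y in C, ∫⁻ x, w x y ∂ν' ∂ν ≤
      ∫⁻ y, ∫⁻ x, ENNReal.ofReal (f y) * w x y ∂ν' ∂ν := by
    intro ν ν' w
    rw [← lintegral_indicator hC.measurableSet]
    refine lintegral_mono fun y => ?_
    by_cases hy : y ∈ C
    · simp [Set.indicator_of_mem hy, hf1 hy]
    · simp [Set.indicator_of_notMem hy]
  exact ⟨(lintegral_mono fun s => hle _ _ _).trans_lt h1,
    (lintegral_mono fun s => hle _ _ _).trans_lt h2⟩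

/-- The weak form of the Flory equation for a test function with finite gain term, without
subtraction. -/
theorem IsFlorySolution.lintegral_test_eq [MetricSpace E] [SigmaCompactSpace E] [BorelSpace E]
    [IsFiniteMeasure μ₀] (h : EventuallyConservative K φ μ₀ c' R)
    (hμ : IsFlorySolution K φ μ) (hinit : μ 0 = μ₀)
    {t : ℝ} (ht : 0 ≤ t) {f : E → ℝ} (hf : Continuous f) (hfc : HasCompactSupport f)
    (hf0 : ∀ x, 0 ≤ f x)
    (hgain : ∫⁻ s in Set.Ioc 0 t,
      ∫⁻ x, ∫⁻ y, ∫⁻ z, ENNReal.ofReal (f z) ∂(K x y) ∂(μ s) ∂(μ s) ≠ ⊤) :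
    ∫⁻ y, ENNReal.ofReal (f y) ∂(μ t) +
      ((∫⁻ s in Set.Ioc 0 t, ∫⁻ y, ∫⁻ x, ENNReal.ofReal (f y) * K x y Set.univ ∂(μ s) ∂(μ s)) +
      ∫⁻ s in Set.Ioc 0 t, ∫⁻ y, ∫⁻ x, ENNReal.ofReal (f y) * ENNReal.ofReal (φ x y) ∂μ₀ ∂(μ s)) =
    ∫⁻ y, ENNReal.ofReal (f y) ∂μ₀ +
      (ENNReal.ofReal (1 / 2) * (∫⁻ s in Set.Ioc 0 t,
        ∫⁻ x, ∫⁻ y, ∫⁻ z, ENNReal.ofReal (f z) ∂(K x y) ∂(μ s) ∂(μ s)) +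
      ∫⁻ s in Set.Ioc 0 t,
        ∫⁻ y, ∫⁻ x, ENNReal.ofReal (f y) * ENNReal.ofReal (φ x y) ∂(μ s) ∂(μ s)) := by
  have hfin := hμ.1
  have hm := hμ.2.1
  obtain ⟨hL, hP⟩ := hμ.2.2.1 f hf hfc hf0 t ht
  have heq := hμ.2.2.2.1 f hf hfc t ht
  rw [hinit] at hP heq
  have hfm : Measurable f := hf.measurable
  have hgm : Measurable fun x => ENNReal.ofReal (f x) := hfm.ennreal_ofReal
  have hF : ∫⁻ s in Set.Ioc 0 t,
      ∫⁻ y, ∫⁻ x, ENNReal.ofReal (f y) * ENNReal.ofReal (φ x y) ∂(μ s) ∂(μ s) < ⊤ := by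
    refine (setLIntegral_mono' measurableSet_Ioc fun s hs => lintegral_mono fun y => ?_).trans_lt hP
    rw [lintegral_const_mul' _ _ ENNReal.ofReal_ne_top,
      lintegral_const_mul' _ _ ENNReal.ofReal_ne_top]
    refine mul_le_mul' le_rfl ?_
    simp_rw [h.symm _ y]
    exact hμ.potentialLE hinit hs.1.le y
  have hinteg : ∀ (ν : Measure E) [IsFiniteMeasure ν], Integrable f ν := fun ν _ =>
    hf.integrable_of_hasCompactSupport hfc
  -- densities of the four terms on `E × E`
  have hwGm : Measurable fun p : E × E => ∫⁻ z, ENNReal.ofReal (f z) ∂(K p.1 p.2) :=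
    Measurable.lintegral_kernel (κ := coagulationKernel K h.kernel_measurable) hgm
  have hwG_ofReal : ∀ x y, ENNReal.ofReal (∫ z, f z ∂(K x y)) =
      ∫⁻ z, ENNReal.ofReal (f z) ∂(K x y) := fun x y =>
    have := h.kernel_finite x y
    ofReal_integral_eq_lintegral_ofReal (hinteg _) (Filter.Eventually.of_forall hf0)
  have hwG : Measurable fun p : E × E => ∫ z, f z ∂(K p.1 p.2) := by
    have e : (fun p : E × E => ∫ z, f z ∂(K p.1 p.2)) =
        fun p => (∫⁻ z, ENNReal.ofReal (f z) ∂(K p.1 p.2)).toReal := funext fun p =>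
      integral_eq_lintegral_of_nonneg_ae (Filter.Eventually.of_forall hf0)
        hfm.aestronglyMeasurable
    rw [e]
    exact hwGm.ennreal_toReal
  have hwL : Measurable fun p : E × E => f p.1 * Kbar K p.2 p.1 :=
    (hfm.comp measurable_fst).mul (h.measurable_Kbar.comp measurable_swap)
  have hwL_ofReal : ∀ x y, ENNReal.ofReal (f y * Kbar K x y) =
      ENNReal.ofReal (f y) * K x y Set.univ := fun x y => by
    have := h.kernel_finite x y
    rw [ENNReal.ofReal_mul (hf0 y), Kbar, ENNReal.ofReal_toReal (measure_ne_top _ _)]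
  have hwF : Measurable fun p : E × E => f p.1 * φ p.2 p.1 :=
    (hfm.comp measurable_fst).mul (h.measurable.comp measurable_swap)
  have hwF_ofReal : ∀ x y, ENNReal.ofReal (f y * φ x y) =
      ENNReal.ofReal (f y) * ENNReal.ofReal (φ x y) := fun x y => ENNReal.ofReal_mul (hf0 y)
  -- measurability in time
  have hGt : Measurable fun s =>
      ∫⁻ x, ∫⁻ y, ∫⁻ z, ENNReal.ofReal (f z) ∂(K x y) ∂(μ s) ∂(μ s) :=
    measurable_lintegral_family hfin hm (measurable_lintegral_lintegral_family hfin hm hwGm)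
  have hLt : Measurable fun s =>
      ∫⁻ y, ∫⁻ x, ENNReal.ofReal (f y) * K x y Set.univ ∂(μ s) ∂(μ s) := by
    simp_rw [← hwL_ofReal]
    exact measurable_lintegral_family hfin hm
      (measurable_lintegral_lintegral_family hfin hm hwL.ennreal_ofReal)
  have hFt : Measurable fun s =>
      ∫⁻ y, ∫⁻ x, ENNReal.ofReal (f y) * ENNReal.ofReal (φ x y) ∂(μ s) ∂(μ s) := by
    simp_rw [← hwF_ofReal]
    exact measurable_lintegral_family hfin hm
      (measurable_lintegral_lintegral_family hfin hm hwF.ennreal_ofReal)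
  have hPt : Measurable fun s =>
      ∫⁻ y, ∫⁻ x, ENNReal.ofReal (f y) * ENNReal.ofReal (φ x y) ∂μ₀ ∂(μ s) := by
    simp_rw [← hwF_ofReal]
    exact measurable_lintegral_family hfin hm
      (hwF.ennreal_ofReal.lintegral_prod_right'.comp measurable_snd)
  have haeG := ae_lt_top hGt hgain
  have haeL := ae_lt_top hLt hL.ne
  have haeF := ae_lt_top hFt hF.ne
  have haeP := ae_lt_top hPt hP.ne
  have hcongr : ∀ᵐ s ∂(volume.restrict (Set.Ioc 0 t)),
      (1 / 2) * ∫ x, ∫ y, ∫ z, f z ∂(K x y) ∂(μ s) ∂(μ s)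
        - ∫ y, ∫ x, f y * Kbar K x y ∂(μ s) ∂(μ s)
        - ∫ y, ∫ x, f y * φ x y ∂μ₀ ∂(μ s)
        + ∫ y, ∫ x, f y * φ x y ∂(μ s) ∂(μ s) =
      (1 / 2) * (∫⁻ x, ∫⁻ y, ∫⁻ z, ENNReal.ofReal (f z) ∂(K x y) ∂(μ s) ∂(μ s)).toReal
        - (∫⁻ y, ∫⁻ x, ENNReal.ofReal (f y) * K x y Set.univ ∂(μ s) ∂(μ s)).toReal
        - (∫⁻ y, ∫⁻ x, ENNReal.ofReal (f y) * ENNReal.ofReal (φ x y) ∂μ₀ ∂(μ s)).toReal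
        + (∫⁻ y, ∫⁻ x, ENNReal.ofReal (f y) * ENNReal.ofReal (φ x y) ∂(μ s) ∂(μ s)).toReal := by
    filter_upwards [haeG, haeL, haeF, haeP] with s hGs hLs hFs hPs
    simp_rw [← hwG_ofReal] at hGs ⊢
    simp_rw [← hwL_ofReal] at hLs ⊢
    simp_rw [← hwF_ofReal] at hFs hPs ⊢
    have := hfin s
    rw [integral_integral_eq_toReal (μ s) (μ s) hwG (fun z => integral_nonneg hf0) hGs.ne,
      integral_integral_eq_toReal (μ s) (μ s) hwL
        (fun z => mul_nonneg (hf0 _) ENNReal.toReal_nonneg) hLs.ne,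
      integral_integral_eq_toReal (μ s) (μ s) hwF
        (fun z => mul_nonneg (hf0 _) (h.nonneg _ _)) hFs.ne,
      integral_integral_eq_toReal (μ s) μ₀ hwF
        (fun z => mul_nonneg (hf0 _) (h.nonneg _ _)) hPs.ne]
  have hiG := integrable_toReal_of_lintegral_ne_top hGt.aemeasurable hgain
  have hiL := integrable_toReal_of_lintegral_ne_top hLt.aemeasurable hL.ne
  have hiF := integrable_toReal_of_lintegral_ne_top hFt.aemeasurable hF.ne
  have hiP := integrable_toReal_of_lintegral_ne_top hPt.aemeasurable hP.ne
  have hsplit : ∀ a b c d : ℝ → ℝ, IntegrableOn a (Set.Ioc 0 t) → IntegrableOn b (Set.Ioc 0 t) →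
      IntegrableOn c (Set.Ioc 0 t) → IntegrableOn d (Set.Ioc 0 t) →
      ∫ s in Set.Ioc 0 t, ((1 / 2) * a s - b s - c s + d s) =
        (1 / 2) * (∫ s in Set.Ioc 0 t, a s) - (∫ s in Set.Ioc 0 t, b s) -
          (∫ s in Set.Ioc 0 t, c s) + ∫ s in Set.Ioc 0 t, d s := by
    intro a b c d ha hb hc hd
    have ha' : IntegrableOn (fun s => (1 / 2) * a s) (Set.Ioc 0 t) := ha.const_mul _
    have hab : IntegrableOn (fun s => (1 / 2) * a s - b s) (Set.Ioc 0 t) := ha'.sub hb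
    have habc : IntegrableOn (fun s => (1 / 2) * a s - b s - c s) (Set.Ioc 0 t) := hab.sub hc
    rw [integral_add habc hd, integral_sub hab hc, integral_sub ha' hb, integral_const_mul]
  rw [intervalIntegral.integral_of_le ht, integral_congr_ae hcongr,
    hsplit _ _ _ _ hiG hiL hiP hiF, integral_toReal hGt.aemeasurable haeG,
    integral_toReal hLt.aemeasurable haeL,
    integral_toReal hPt.aemeasurable haeP, integral_toReal hFt.aemeasurable haeF,
    integral_eq_lintegral_of_nonneg_ae (Filter.Eventually.of_forall hf0)
      hfm.aestronglyMeasurable,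
    integral_eq_lintegral_of_nonneg_ae (Filter.Eventually.of_forall hf0)
      hfm.aestronglyMeasurable] at heq
  have hfinite : ∀ (ν : Measure E) [IsFiniteMeasure ν], ∫⁻ y, ENNReal.ofReal (f y) ∂ν ≠ ⊤ :=
    fun ν _ => ((hasFiniteIntegral_iff_ofReal (Filter.Eventually.of_forall hf0)).1
      (hinteg ν).2).ne
  have hhalf := ENNReal.mul_ne_top (ENNReal.ofReal_ne_top (r := 1 / 2)) hgain
  have := hfin t
  rw [← ENNReal.toReal_eq_toReal_iff'
      (ENNReal.add_ne_top.2 ⟨hfinite _, ENNReal.add_ne_top.2 ⟨hL.ne, hP.ne⟩⟩)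
      (ENNReal.add_ne_top.2 ⟨hfinite _, ENNReal.add_ne_top.2 ⟨hhalf, hF.ne⟩⟩),
    ENNReal.toReal_add (hfinite _) (ENNReal.add_ne_top.2 ⟨hL.ne, hP.ne⟩),
    ENNReal.toReal_add (hfinite _) (ENNReal.add_ne_top.2 ⟨hhalf, hF.ne⟩),
    ENNReal.toReal_add hL.ne hP.ne, ENNReal.toReal_add hhalf hF.ne, ENNReal.toReal_mul,
    ENNReal.toReal_ofReal (by norm_num)]
  linarith

/-- The Flory equation as an identity between measures. -/
theorem IsFlorySolution.measure_balance [MetricSpace E] [SigmaCompactSpace E]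
    [LocallyCompactSpace E] [BorelSpace E] [IsFiniteMeasure μ₀]
    (h : EventuallyConservative K φ μ₀ c' R) (hμ : IsFlorySolution K φ μ) (hinit : μ 0 = μ₀)
    (D : ℕ → ℝ) (hD_compact : ∀ n, IsCompact (Dset φ μ₀ (D n)))
    (hD_cover : ⋃ n, Dset φ μ₀ (D n) = Set.univ)
    {t : ℝ} (ht : 0 ≤ t) {B : Set E} (hB : MeasurableSet B) :
    μ t B + ((∫⁻ s in Set.Ioc 0 t, lossRate K (μ s) B) +
      ∫⁻ s in Set.Ioc 0 t, fluxRate φ μ₀ (μ s) B) =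
    μ₀ B + (ENNReal.ofReal (1 / 2) * (∫⁻ s in Set.Ioc 0 t, gainRate K (μ s) B) +
      ∫⁻ s in Set.Ioc 0 t, fluxRate φ (μ s) (μ s) B) := by
  have hfin := hμ.1
  have hm := hμ.2.1
  let κ := timeKernel μ hm
  let κK := coagulationKernel K h.kernel_measurable
  have : ProbabilityTheory.IsSFiniteKernel κ := isSFiniteKernel_of_isFiniteMeasure κ hfin
  let T := volume.restrict (Set.Ioc 0 t)
  let ηL := κ.withDensity fun s y => ∫⁻ x, K x y Set.univ ∂(μ s)
  let ηP := κ.withDensity fun _ y => ∫⁻ x, ENNReal.ofReal (φ x y) ∂μ₀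
  let ηF := κ.withDensity fun s y => ∫⁻ x, ENNReal.ofReal (φ x y) ∂(μ s)
  let ηG := κK.comp (κ.prod κ)
  have hLm : Measurable (Function.uncurry fun (s : ℝ) (y : E) => ∫⁻ x, K x y Set.univ ∂(μ s)) :=
    h.measurable_lossDensity hfin hm
  have hFm : Measurable (Function.uncurry fun (s : ℝ) (y : E) =>
      ∫⁻ x, ENNReal.ofReal (φ x y) ∂(μ s)) :=
    h.measurable_fluxDensity hfin hm
  have hPm : Measurable (Function.uncurry fun (_ : ℝ) (y : E) =>
      ∫⁻ x, ENNReal.ofReal (φ x y) ∂μ₀) :=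
    h.measurable_potential.comp measurable_snd
  have lintegral_density : ∀ (d : ℝ → E → ENNReal), Measurable (Function.uncurry d) →
      ∀ g : E → ENNReal, Measurable g →
      ∫⁻ y, g y ∂(T.bind (κ.withDensity d)) =
        ∫⁻ s in Set.Ioc 0 t, ∫⁻ y, g y * d s y ∂(μ s) := by
    intro d hd g hg
    rw [Measure.lintegral_bind (κ.withDensity d).measurable.aemeasurable hg.aemeasurable]
    refine lintegral_congr fun s => ?_
    rw [ProbabilityTheory.Kernel.lintegral_withDensity κ hd s hg]
    exact lintegral_congr fun y => mul_comm _ _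
  have lintegral_gain : ∀ g : E → ENNReal, Measurable g → ∫⁻ y, g y ∂(T.bind ηG) =
      ∫⁻ s in Set.Ioc 0 t, ∫⁻ x, ∫⁻ y, ∫⁻ z, g z ∂(K x y) ∂(μ s) ∂(μ s) := by
    intro g hg
    rw [Measure.lintegral_bind ηG.measurable.aemeasurable hg.aemeasurable]
    refine lintegral_congr fun s => ?_
    rw [ProbabilityTheory.Kernel.lintegral_comp _ _ _ hg,
      ProbabilityTheory.Kernel.lintegral_prod _ _ _ hg.lintegral_kernel]
    rfl
  have apply_density : ∀ (d : ℝ → E → ENNReal), Measurable (Function.uncurry d) →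
      ∀ A, MeasurableSet A → T.bind (κ.withDensity d) A =
        ∫⁻ s in Set.Ioc 0 t, ∫⁻ y in A, d s y ∂(μ s) := by
    intro d hd A hA
    rw [Measure.bind_apply hA (κ.withDensity d).measurable.aemeasurable]
    refine lintegral_congr fun s => ?_
    rw [ProbabilityTheory.Kernel.withDensity_apply' κ hd]
    rfl
  have apply_gain : ∀ A, MeasurableSet A →
      T.bind ηG A = ∫⁻ s in Set.Ioc 0 t, gainRate K (μ s) A := by
    intro A hA
    rw [← lintegral_indicator_one hA, lintegral_gain _ (measurable_one.indicator hA)]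
    simp_rw [lintegral_indicator_one hA]
    rfl
  let P := μ t + (T.bind ηL + T.bind ηP)
  let Q := μ₀ + (ENNReal.ofReal (1 / 2) • T.bind ηG + T.bind ηF)
  have hP_apply : ∀ A, MeasurableSet A → P A = μ t A + ((∫⁻ s in Set.Ioc 0 t, lossRate K (μ s) A) +
      ∫⁻ s in Set.Ioc 0 t, fluxRate φ μ₀ (μ s) A) := by
    intro A hA
    simp only [P, Measure.add_apply, ηL, ηP, apply_density _ hLm A hA, apply_density _ hPm A hA]
    rfl
  have hQ_apply : ∀ A, MeasurableSet A → Q A = μ₀ A +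
      (ENNReal.ofReal (1 / 2) * (∫⁻ s in Set.Ioc 0 t, gainRate K (μ s) A) +
        ∫⁻ s in Set.Ioc 0 t, fluxRate φ (μ s) (μ s) A) := by
    intro A hA
    simp only [Q, Measure.add_apply, Measure.smul_apply, smul_eq_mul, ηF, apply_gain A hA,
      apply_density _ hFm A hA]
    rfl
  have hPC : ∀ C, IsCompact C → P C < ⊤ := by
    intro C hC
    have := hfin t
    obtain ⟨h1, h2⟩ := hμ.lintegral_rates_lt_top hinit ht hC
    rw [hP_apply C hC.measurableSet]
    exact ENNReal.add_lt_top.2 ⟨measure_lt_top _ _, ENNReal.add_lt_top.2 ⟨h1, h2⟩⟩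
  have hPloc : IsLocallyFiniteMeasure P := by
    refine ⟨fun x => ?_⟩
    obtain ⟨C, hC, hxC⟩ := exists_compact_mem_nhds x
    exact ⟨C, hxC, hPC C hC⟩
  suffices hPQ : P = Q by rw [← hP_apply B hB, ← hQ_apply B hB, hPQ]
  refine eq_of_lintegral_eq_of_lintegral_lt_top P Q (fun n => Dset φ μ₀ (D n))
    (fun n => (hD_compact n).isClosed) hD_cover (fun n => ?_) fun f hf hfc hf0 hfQ => ?_
  · obtain ⟨h1, h2⟩ := hμ.lintegral_rates_lt_top hinit ht (hD_compact n)
    rw [hQ_apply _ (h.measurableSet_Dset _)]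
    refine ENNReal.add_lt_top.2 ⟨measure_lt_top _ _, ENNReal.add_lt_top.2
      ⟨ENNReal.mul_lt_top ENNReal.ofReal_lt_top ?_, ?_⟩⟩
    · refine (lintegral_mono fun s => ?_).trans_lt h1
      have := hfin s
      exact h.gainRate_le (μ s) subset_rfl
    · exact (setLIntegral_mono' measurableSet_Ioc fun s hs => h.fluxRate_le_fluxRate (μ s)
        (hμ.potentialLE hinit hs.1.le) _).trans_lt h2
  · have hg : Measurable fun x => ENNReal.ofReal (f x) := hf.measurable.ennreal_ofReal
    simp only [Q, ηF, lintegral_add_measure, lintegral_smul_measure, smul_eq_mul,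
      lintegral_gain _ hg, lintegral_density _ hFm _ hg] at hfQ ⊢
    simp only [P, ηL, ηP, lintegral_add_measure, lintegral_density _ hLm _ hg,
      lintegral_density _ hPm _ hg]
    have hgain := (ENNReal.add_lt_top.1 (ENNReal.add_lt_top.1 hfQ).2).1
    have heq := hμ.lintegral_test_eq h hinit ht hf hfc hf0 fun htop => by
      rw [htop, ENNReal.mul_top (by norm_num)] at hgain
      exact lt_irrefl _ hgain
    simp_rw [lintegral_const_mul' _ _ ENNReal.ofReal_ne_top] at heq
    exact heq

/-- A solution of the Flory equation never has more mass than its initial condition. -/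
theorem IsFlorySolution.measure_univ_le [MetricSpace E] [SigmaCompactSpace E]
    [LocallyCompactSpace E] [BorelSpace E] [IsFiniteMeasure μ₀]
    (h : EventuallyConservative K φ μ₀ c' R) (hμ : IsFlorySolution K φ μ) (hinit : μ 0 = μ₀)
    (D : ℕ → ℝ) (hD_mono : Monotone D) (hD_compact : ∀ n, IsCompact (Dset φ μ₀ (D n)))
    (hD_cover : ⋃ n, Dset φ μ₀ (D n) = Set.univ) {t : ℝ} (ht : 0 ≤ t) :
    μ t Set.univ ≤ μ₀ Set.univ := by
  have hmono : Monotone fun n => Dset φ μ₀ (D n) := fun i j hij x hx =>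
    le_trans (b := ENNReal.ofReal (D i)) hx (ENNReal.ofReal_le_ofReal (hD_mono hij))
  rw [← hD_cover, hmono.measure_iUnion, hD_cover]
  refine iSup_le fun n => ?_
  have hbal := hμ.measure_balance h hinit D hD_compact hD_cover ht (h.measurableSet_Dset (D n))
  obtain ⟨h1, h2⟩ := hμ.lintegral_rates_lt_top hinit ht (hD_compact n)
  have hgain : ENNReal.ofReal (1 / 2) *
      (∫⁻ s in Set.Ioc 0 t, gainRate K (μ s) (Dset φ μ₀ (D n))) ≤
      ∫⁻ s in Set.Ioc 0 t, lossRate K (μ s) (Dset φ μ₀ (D n)) := by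
    refine (mul_le_of_le_one_left' (ENNReal.ofReal_le_one.2 (by norm_num))).trans
      (lintegral_mono fun s => ?_)
    have := hμ.1 s
    exact h.gainRate_le (μ s) subset_rfl
  have hflux : ∫⁻ s in Set.Ioc 0 t, fluxRate φ (μ s) (μ s) (Dset φ μ₀ (D n)) ≤
      ∫⁻ s in Set.Ioc 0 t, fluxRate φ μ₀ (μ s) (Dset φ μ₀ (D n)) :=
    setLIntegral_mono' measurableSet_Ioc fun s hs =>
      h.fluxRate_le_fluxRate (μ s) (hμ.potentialLE hinit hs.1.le) _
  refine le_trans ?_ (measure_mono (Set.subset_univ (Dset φ μ₀ (D n))))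
  refine (ENNReal.add_le_add_iff_right (ENNReal.add_lt_top.2 ⟨h1, h2⟩).ne).1 (hbal.trans_le ?_)
  gcongr

/-- The Flory equation on a measurable subset of a compact sublevel set, with real values. -/
theorem IsFlorySolution.measureReal_eq [MetricSpace E] [SigmaCompactSpace E]
    [LocallyCompactSpace E] [BorelSpace E] [IsFiniteMeasure μ₀]
    (h : EventuallyConservative K φ μ₀ c' R) (hμ : IsFlorySolution K φ μ) (hinit : μ 0 = μ₀)
    (D : ℕ → ℝ) (hD_compact : ∀ n, IsCompact (Dset φ μ₀ (D n)))
    (hD_cover : ⋃ n, Dset φ μ₀ (D n) = Set.univ) {t : ℝ} (ht : 0 ≤ t)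
    {B : Set E} (hB : MeasurableSet B) {n : ℕ} (hBn : B ⊆ Dset φ μ₀ (D n)) :
    IntegrableOn (fun s => floryDrift K φ μ₀ (μ s) B) (Set.Ioc 0 t) ∧
      (μ t).real B = μ₀.real B + ∫ s in Set.Ioc 0 t, floryDrift K φ μ₀ (μ s) B := by
  have hfin := hμ.1
  have hm := hμ.2.1
  have hbal := hμ.measure_balance h hinit D hD_compact hD_cover ht hB
  obtain ⟨h1, h2⟩ := hμ.lintegral_rates_lt_top hinit ht (hD_compact n)
  have hG : ∫⁻ s in Set.Ioc 0 t, gainRate K (μ s) B < ⊤ :=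
    (lintegral_mono fun s => by
      have := hfin s
      exact h.gainRate_le (μ s) hBn).trans_lt h1
  have hL : ∫⁻ s in Set.Ioc 0 t, lossRate K (μ s) B < ⊤ :=
    (lintegral_mono fun s => lintegral_mono_set hBn).trans_lt h1
  have hP : ∫⁻ s in Set.Ioc 0 t, fluxRate φ μ₀ (μ s) B < ⊤ :=
    (lintegral_mono fun s => lintegral_mono_set hBn).trans_lt h2
  have hF : ∫⁻ s in Set.Ioc 0 t, fluxRate φ (μ s) (μ s) B < ⊤ :=
    (setLIntegral_mono' measurableSet_Ioc fun s hs =>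
      h.fluxRate_le_fluxRate (μ s) (hμ.potentialLE hinit hs.1.le) _).trans_lt hP
  have hGm := h.measurable_gainRate hfin hm hB
  have hLm := h.measurable_lossRate hfin hm hB
  have hPm := h.measurable_initialFluxRate hfin hm hB
  have hFm := h.measurable_fluxRate hfin hm hB
  have hiG : IntegrableOn (fun s => (1 / 2) * (gainRate K (μ s) B).toReal) (Set.Ioc 0 t) :=
    (integrable_toReal_of_lintegral_ne_top hGm.aemeasurable hG.ne).const_mul _
  have hiL := integrable_toReal_of_lintegral_ne_top hLm.aemeasurable hL.ne
  have hiP := integrable_toReal_of_lintegral_ne_top hPm.aemeasurable hP.ne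
  have hiF := integrable_toReal_of_lintegral_ne_top hFm.aemeasurable hF.ne
  have hiGF : IntegrableOn (fun s => (1 / 2) * (gainRate K (μ s) B).toReal +
      (fluxRate φ (μ s) (μ s) B).toReal) (Set.Ioc 0 t) := hiG.add hiF
  have hiGFL : IntegrableOn (fun s => (1 / 2) * (gainRate K (μ s) B).toReal +
      (fluxRate φ (μ s) (μ s) B).toReal - (lossRate K (μ s) B).toReal) (Set.Ioc 0 t) :=
    hiGF.sub hiL
  refine ⟨hiGFL.sub hiP, ?_⟩
  simp only [floryDrift]
  rw [integral_sub hiGFL hiP, integral_sub hiGF hiL, integral_add hiG hiF, integral_const_mul,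
    integral_toReal hGm.aemeasurable (ae_lt_top hGm hG.ne),
    integral_toReal hLm.aemeasurable (ae_lt_top hLm hL.ne),
    integral_toReal hPm.aemeasurable (ae_lt_top hPm hP.ne),
    integral_toReal hFm.aemeasurable (ae_lt_top hFm hF.ne)]
  have hhalf := ENNReal.mul_ne_top (ENNReal.ofReal_ne_top (r := 1 / 2)) hG.ne
  have := hfin t
  have hbal' := congrArg ENNReal.toReal hbal
  rw [ENNReal.toReal_add (measure_ne_top _ _) (ENNReal.add_ne_top.2 ⟨hL.ne, hP.ne⟩),
    ENNReal.toReal_add (measure_ne_top _ _) (ENNReal.add_ne_top.2 ⟨hhalf, hF.ne⟩),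
    ENNReal.toReal_add hL.ne hP.ne, ENNReal.toReal_add hhalf hF.ne, ENNReal.toReal_mul,
    ENNReal.toReal_ofReal (by norm_num)] at hbal'
  simp only [Measure.real]
  linarith

end Balance

/-- **Gronwall-type estimate in the uniqueness proof** (proof of Theorem
`thm:uniqueness`).  Under the uniqueness hypotheses, if `μ` and `μhat` are two
solutions of the multi-type Flory equation with conserved quantity `φ` and the
same initial condition `μ₀`, then `r ↦ ‖(μ_r − μ̂_r)|_{D_R}‖` is measurable,
bounded by `2 μ₀(E)`, and satisfies
`‖(μ_s − μ̂_s)|_{D_R}‖ ≤ 3 R (c' + 1) ∫_0^s ‖(μ_r − μ̂_r)|_{D_R}‖ dr` for `s ≥ 0`. -/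
theorem flory_uniqueness_gronwall_estimate
    {E : Type*} [MetricSpace E] [MeasurableSpace E] [BorelSpace E]
    [SigmaCompactSpace E] [LocallyCompactSpace E]
    (m : E → ℝ) (hm_pos : ∀ x, 0 < m x) (hm_meas : Measurable m)
    (K : E → E → Measure E)
    (hK_meas : ∀ A : Set E, MeasurableSet A →
      Measurable fun p : E × E => K p.1 p.2 A)
    (hK_fin : ∀ x y, IsFiniteMeasure (K x y))
    (hK_symm : ∀ x y, K x y = K y x)
    (hK_mass : ∀ x y, ∀ᵐ z ∂(K x y), m z = m x + m y)
    (φ : E → E → ℝ)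
    (hφ_meas : Measurable fun p : E × E => φ p.1 p.2)
    (hφ_nonneg : ∀ x y, 0 ≤ φ x y)
    (hφ_symm : ∀ x y, φ x y = φ y x)
    (hφ_cons : Conservative K φ)
    (μ₀ : Measure E) [IsFiniteMeasure μ₀]
    (hD_compact : ∃ k₀ : ℕ, ∀ k : ℕ, k₀ ≤ k → IsCompact (Dset φ μ₀ (k : ℝ)))
    (hD_cover : ⋃ k : ℕ, Dset φ μ₀ (k : ℝ) = Set.univ)
    (c' : ℝ) (hc' : 0 < c')
    (hKφ : ∀ x y, Kbar K x y ≤ c' * φ x y)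
    (R : ℝ) (hR : 0 < R)
    (hev : ∀ x y : E, (x, y) ∉ Dset φ μ₀ R ×ˢ Dset φ μ₀ R → φ x y = Kbar K x y)
    (μ μhat : ℝ → Measure E)
    (hμ : IsFlorySolution K φ μ) (hμhat : IsFlorySolution K φ μhat)
    (hinit : μ 0 = μ₀) (hinithat : μhat 0 = μ₀) :
    Measurable (fun r : ℝ =>
        tvOn (μ r) (μhat r) (hμ.1 r) (hμhat.1 r) (Dset φ μ₀ R)) ∧
    (∀ r : ℝ, 0 ≤ r →
        tvOn (μ r) (μhat r) (hμ.1 r) (hμhat.1 r) (Dset φ μ₀ R)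
          ≤ 2 * (μ₀ Set.univ).toReal) ∧
    (∀ s : ℝ, 0 ≤ s →
        tvOn (μ s) (μhat s) (hμ.1 s) (hμhat.1 s) (Dset φ μ₀ R)
          ≤ 3 * R * (c' + 1) *
            ∫ r in (0 : ℝ)..s,
              tvOn (μ r) (μhat r) (hμ.1 r) (hμhat.1 r) (Dset φ μ₀ R)) := by
  have h : EventuallyConservative K φ μ₀ c' R :=
    ⟨hK_meas, hK_fin, hφ_meas, hφ_nonneg, hφ_symm, hφ_cons, hc', hKφ, hR, hev⟩
  obtain ⟨k₀, hk₀⟩ := hD_compact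
  let D : ℕ → ℝ := fun n => ((k₀ + n : ℕ) : ℝ)
  have hD_mono : Monotone D := fun i j hij => Nat.cast_le.2 (Nat.add_le_add_left hij _)
  have hDset_mono : ∀ {a b : ℝ}, a ≤ b → Dset φ μ₀ a ⊆ Dset φ μ₀ b := fun {a _} hab x hx =>
    le_trans (b := ENNReal.ofReal a) hx (ENNReal.ofReal_le_ofReal hab)
  have hDn_compact : ∀ n, IsCompact (Dset φ μ₀ (D n)) := fun n => hk₀ _ (Nat.le_add_right _ _)
  have hDn_cover : ⋃ n, Dset φ μ₀ (D n) = Set.univ := by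
    refine Set.univ_subset_iff.1 (hD_cover.ge.trans (Set.iUnion_mono fun k => hDset_mono ?_))
    exact Nat.cast_le.2 (Nat.le_add_left _ _)
  have hA : MeasurableSet (Dset φ μ₀ R) := h.measurableSet_Dset R
  have htv_meas := measurable_tvOn μ μhat hμ.1 hμhat.1 hμ.2.1 hμhat.2.1 hA
  have hmass : ∀ {ν : ℝ → Measure E}, IsFlorySolution K φ ν → ν 0 = μ₀ → ∀ r, 0 ≤ r →
      (ν r).real Set.univ ≤ (μ₀ Set.univ).toReal := fun hν hν0 r hr =>
    ENNReal.toReal_mono (measure_ne_top _ _)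
      (hν.measure_univ_le h hν0 D hD_mono hDn_compact hDn_cover hr)
  have htv_le : ∀ r : ℝ, 0 ≤ r → tvOn (μ r) (μhat r) (hμ.1 r) (hμhat.1 r) (Dset φ μ₀ R)
      ≤ 2 * (μ₀ Set.univ).toReal := fun r hr => by
    linarith [tvOn_le_add (μ r) (μhat r) (hμ.1 r) (hμhat.1 r) hA, hmass hμ hinit r hr,
      hmass hμhat hinithat r hr]
  refine ⟨htv_meas, htv_le, fun s hs => ?_⟩
  obtain ⟨n, hn⟩ := exists_nat_ge R
  have hRn : Dset φ μ₀ R ⊆ Dset φ μ₀ (D n) :=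
    hDset_mono (hn.trans (Nat.cast_le.2 (Nat.le_add_left _ _)))
  obtain ⟨H, hH, heq⟩ := exists_tvOn_eq (μ s) (μhat s) (hμ.1 s) (hμhat.1 s) hA
  have hbal : ∀ {ν : ℝ → Measure E}, IsFlorySolution K φ ν → ν 0 = μ₀ → ∀ T : Set E,
      MeasurableSet T →
      IntegrableOn (fun r => floryDrift K φ μ₀ (ν r) (Dset φ μ₀ R ∩ T)) (Set.Ioc 0 s) ∧
      (ν s).real (Dset φ μ₀ R ∩ T) = μ₀.real (Dset φ μ₀ R ∩ T) +
        ∫ r in Set.Ioc 0 s, floryDrift K φ μ₀ (ν r) (Dset φ μ₀ R ∩ T) := fun hν hν0 T hT =>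
    hν.measureReal_eq h hν0 D hDn_compact hDn_cover hs (hA.inter hT)
      (Set.inter_subset_left.trans hRn)
  obtain ⟨i₁, e₁⟩ := hbal hμ hinit H hH
  obtain ⟨i₂, e₂⟩ := hbal hμhat hinithat H hH
  obtain ⟨i₃, e₃⟩ := hbal hμ hinit Hᶜ hH.compl
  obtain ⟨i₄, e₄⟩ := hbal hμhat hinithat Hᶜ hH.compl
  have htv_int : IntegrableOn
      (fun r => tvOn (μ r) (μhat r) (hμ.1 r) (hμhat.1 r) (Dset φ μ₀ R)) (Set.Ioc 0 s) := by
    refine Measure.integrableOn_of_bounded (M := 2 * (μ₀ Set.univ).toReal)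
      measure_Ioc_lt_top.ne htv_meas.aestronglyMeasurable ?_
    filter_upwards [ae_restrict_mem measurableSet_Ioc] with r hr
    rw [Real.norm_of_nonneg (tvOn_nonneg _ _ _ _ _)]
    exact htv_le r hr.1.le
  have i₁₂ : IntegrableOn (fun r => floryDrift K φ μ₀ (μ r) (Dset φ μ₀ R ∩ H) -
      floryDrift K φ μ₀ (μhat r) (Dset φ μ₀ R ∩ H)) (Set.Ioc 0 s) := i₁.sub i₂
  have i₃₄ : IntegrableOn (fun r => floryDrift K φ μ₀ (μ r) (Dset φ μ₀ R ∩ Hᶜ) -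
      floryDrift K φ μ₀ (μhat r) (Dset φ μ₀ R ∩ Hᶜ)) (Set.Ioc 0 s) := i₃.sub i₄
  have hmono := setIntegral_mono_on (i₁₂.sub i₃₄) (htv_int.const_mul (3 * R * (c' + 1)))
    measurableSet_Ioc fun r hr => h.floryDrift_sub_le (μ r) (μhat r) (hμ.1 r) (hμhat.1 r)
      (hμ.potentialLE hinit hr.1.le) (hμhat.potentialLE hinithat hr.1.le) hH
  rw [integral_const_mul, integral_sub' i₁₂ i₃₄, integral_sub i₁ i₂, integral_sub i₃ i₄] at hmono
  rw [intervalIntegral.integral_of_le hs, heq]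
  linarith
end
end

section
/- Cross-terms estimate (Claim 'clm:cross-terms'): Let E be a σ-compact metric space, φ : E × E → [0,∞) a symmetric Borel measurable function, and let μ_0, ν, ν̂ be finite positive Borel measures on E such that for every x ∈ E, ∫ φ(x,u) ν(du) ≤ ∫ φ(x,u) μ_0(du) and ∫ φ(x,u) ν̂(du) ≤ ∫ φ(x,u) μ_0(du). Let R > 0 and set D_R := {x ∈ E : ∫ φ(x,y) μ_0(dy) ≤ R}. Then ∫_{E×E} 1_{D_R}(u) 1_{D_R}(v) φ(u,v) d|ν⊗ν − ν̂⊗ν̂|(u,v) ≤ 2 R ∫_E 1_{D_R}(v) d|ν − ν̂|(v), where |σ| denotes the total variation measure of a finite signed measure σ and ⊗ denotes the product of measures. -/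
open MeasureTheory Set

noncomputable section

namespace MeasureTheory

variable {α β : Type*} [MeasurableSpace α] [MeasurableSpace β]

lemma Measure.le_of_mutuallySingular_of_le_add {p n a : Measure α}
    (hpn : p.MutuallySingular n) (h : p ≤ n + a) : p ≤ a := by
  obtain ⟨S, hS, hp, hn⟩ := hpn
  refine Measure.le_intro fun A _ _ => ?_
  calc p A ≤ p (A ∩ Sᶜ) + p S :=
        (measure_mono fun x hx => by by_cases hxS : x ∈ S <;> simp [hx, hxS]).trans
          (measure_union_le _ _)
    _ = p (A ∩ Sᶜ) := by rw [hp, add_zero]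
    _ ≤ n (A ∩ Sᶜ) + a (A ∩ Sᶜ) := h _
    _ = a (A ∩ Sᶜ) := by rw [measure_mono_null inter_subset_right hn, zero_add]
    _ ≤ a A := measure_mono inter_subset_left

lemma toSignedMeasure_sub_eq_sub_iff (μ μ' p n : Measure α)
    [IsFiniteMeasure μ] [IsFiniteMeasure μ'] [IsFiniteMeasure p] [IsFiniteMeasure n] :
    μ.toSignedMeasure - μ'.toSignedMeasure = p.toSignedMeasure - n.toSignedMeasure ↔
      μ + n = μ' + p := by
  rw [← Measure.toSignedMeasure_eq_toSignedMeasure_iff, Measure.toSignedMeasure_add,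
    Measure.toSignedMeasure_add, sub_eq_sub_iff_add_eq_add, add_comm p.toSignedMeasure]

/-- Any representation of the difference `μ - μ'` as `a - b` with positive measures bounds its
total variation by `a + b`. -/
lemma totalVariation_sub_le {μ μ' a b : Measure α} [IsFiniteMeasure μ] [IsFiniteMeasure μ']
    [IsFiniteMeasure a] [IsFiniteMeasure b] (h : μ + b = μ' + a) :
    (μ.toSignedMeasure - μ'.toSignedMeasure).totalVariation ≤ a + b := by
  set j := (μ.toSignedMeasure - μ'.toSignedMeasure).toJordanDecomposition with hj
  have hs : a.toSignedMeasure - b.toSignedMeasure =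
      j.posPart.toSignedMeasure - j.negPart.toSignedMeasure := by
    rw [← (toSignedMeasure_sub_eq_sub_iff μ μ' a b).2 h]
    exact (SignedMeasure.toSignedMeasure_toJordanDecomposition _).symm
  have he : a + j.negPart = b + j.posPart := (toSignedMeasure_sub_eq_sub_iff _ _ _ _).1 hs
  refine add_le_add
    (Measure.le_of_mutuallySingular_of_le_add j.mutuallySingular ?_)
    (Measure.le_of_mutuallySingular_of_le_add j.mutuallySingular.symm ?_)
  · rw [add_comm, he]
    exact Measure.le_add_left le_rfl
  · rw [add_comm, ← he]
    exact Measure.le_add_left le_rfl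

lemma totalVariation_prod_self_sub_prod_self_le (ν ν' : Measure α)
    [IsFiniteMeasure ν] [IsFiniteMeasure ν'] :
    ((ν.prod ν).toSignedMeasure - (ν'.prod ν').toSignedMeasure).totalVariation ≤
      ν.prod (ν.toSignedMeasure - ν'.toSignedMeasure).totalVariation +
        (ν.toSignedMeasure - ν'.toSignedMeasure).totalVariation.prod ν' := by
  set j := (ν.toSignedMeasure - ν'.toSignedMeasure).toJordanDecomposition with hj
  have he : ν + j.negPart = ν' + j.posPart :=
    (toSignedMeasure_sub_eq_sub_iff _ _ _ _).1
      (SignedMeasure.toSignedMeasure_toJordanDecomposition _).symm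
  have hl : ν.prod ν + ν.prod j.negPart = ν.prod ν' + ν.prod j.posPart := by
    rw [← Measure.prod_add, he, Measure.prod_add]
  have hr : ν.prod ν' + j.negPart.prod ν' = ν'.prod ν' + j.posPart.prod ν' := by
    rw [← Measure.add_prod, he, Measure.add_prod]
  have key : ν.prod ν + (ν.prod j.negPart + j.negPart.prod ν') =
      ν'.prod ν' + (ν.prod j.posPart + j.posPart.prod ν') := by
    rw [← add_assoc, hl, add_right_comm, hr]
    abel
  refine (totalVariation_sub_le key).trans_eq ?_
  simp only [SignedMeasure.totalVariation, ← hj, Measure.prod_add, Measure.add_prod]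
  abel

lemma setLIntegral_prod_le_mul_of_forall_lintegral_le {f : α × β → ENNReal} (hf : Measurable f)
    {μ : Measure α} {τ : Measure β} [SFinite μ] [SFinite τ] {s : Set α} {t : Set β}
    (ht : MeasurableSet t) {c : ENNReal} (h : ∀ y ∈ t, ∫⁻ x, f (x, y) ∂μ ≤ c) :
    ∫⁻ p in s ×ˢ t, f p ∂(μ.prod τ) ≤ c * τ t := by
  rw [← Measure.prod_restrict, lintegral_prod_symm _ hf.aemeasurable, ← setLIntegral_const]
  exact setLIntegral_mono' ht fun y hy => (setLIntegral_le_lintegral _ _).trans (h y hy)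

lemma setLIntegral_prod_le_mul_of_forall_lintegral_le' {f : α × β → ENNReal} (hf : Measurable f)
    {μ : Measure α} {τ : Measure β} [SFinite μ] [SFinite τ] {s : Set α} {t : Set β}
    (hs : MeasurableSet s) {c : ENNReal} (h : ∀ x ∈ s, ∫⁻ y, f (x, y) ∂τ ≤ c) :
    ∫⁻ p in s ×ˢ t, f p ∂(μ.prod τ) ≤ c * μ s := by
  rw [← Measure.prod_restrict, lintegral_prod _ hf.aemeasurable, ← setLIntegral_const]
  exact setLIntegral_mono' hs fun x hx => (setLIntegral_le_lintegral _ _).trans (h x hx)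

end MeasureTheory

lemma measurableSet_Dset {E : Type*} [MeasurableSpace E] {φ : E → E → ℝ}
    (hφ : Measurable fun p : E × E => φ p.1 p.2) (μ₀ : Measure E) [SFinite μ₀] (r : ℝ) :
    MeasurableSet (Dset φ μ₀ r) :=
  measurableSet_le hφ.ennreal_ofReal.lintegral_prod_right' measurable_const

/-- **Cross-terms estimate** (Claim `clm:cross-terms`): if `ν` and `ν̂` are finite
measures whose `φ`-moments are dominated by those of `μ₀`, then
`∫∫ 1_{D_R}(u) 1_{D_R}(v) φ(u,v) d|ν⊗ν − ν̂⊗ν̂|(u,v) ≤ 2R ∫ 1_{D_R}(v) d|ν − ν̂|(v)`. -/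
theorem cross_terms_estimate
    {E : Type*} [MetricSpace E] [MeasurableSpace E] [BorelSpace E]
    [SigmaCompactSpace E]
    (φ : E → E → ℝ)
    (hφ_meas : Measurable fun p : E × E => φ p.1 p.2)
    (hφ_nonneg : ∀ x y, 0 ≤ φ x y)
    (hφ_symm : ∀ x y, φ x y = φ y x)
    (μ₀ ν νhat : Measure E)
    [IsFiniteMeasure μ₀] [IsFiniteMeasure ν] [IsFiniteMeasure νhat]
    (hν : ∀ x : E, ∫⁻ u, ENNReal.ofReal (φ x u) ∂ν
        ≤ ∫⁻ u, ENNReal.ofReal (φ x u) ∂μ₀)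
    (hνhat : ∀ x : E, ∫⁻ u, ENNReal.ofReal (φ x u) ∂νhat
        ≤ ∫⁻ u, ENNReal.ofReal (φ x u) ∂μ₀)
    (R : ℝ) (hR : 0 < R) :
    (∫⁻ p in Dset φ μ₀ R ×ˢ Dset φ μ₀ R, ENNReal.ofReal (φ p.1 p.2)
        ∂(((ν.prod ν).toSignedMeasure -
            (νhat.prod νhat).toSignedMeasure).totalVariation))
      ≤ ENNReal.ofReal (2 * R) *
          (ν.toSignedMeasure - νhat.toSignedMeasure).totalVariation
            (Dset φ μ₀ R) := by
  set τ := (ν.toSignedMeasure - νhat.toSignedMeasure).totalVariation with hτ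
  have : IsFiniteMeasure τ := by
    rw [hτ, SignedMeasure.totalVariation]
    infer_instance
  have hf : Measurable fun p : E × E => ENNReal.ofReal (φ p.1 p.2) := hφ_meas.ennreal_ofReal
  have hD := measurableSet_Dset hφ_meas μ₀ R
  calc _ ≤ ∫⁻ p in Dset φ μ₀ R ×ˢ Dset φ μ₀ R, ENNReal.ofReal (φ p.1 p.2)
        ∂(ν.prod τ + τ.prod νhat) :=
        lintegral_mono' (Measure.restrict_mono le_rfl
          (totalVariation_prod_self_sub_prod_self_le ν νhat)) le_rfl
    _ ≤ ENNReal.ofReal R * τ (Dset φ μ₀ R) + ENNReal.ofReal R * τ (Dset φ μ₀ R) := by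
        rw [Measure.restrict_add, lintegral_add_measure]
        refine add_le_add (setLIntegral_prod_le_mul_of_forall_lintegral_le hf hD fun y hy => ?_)
          (setLIntegral_prod_le_mul_of_forall_lintegral_le' hf hD fun x hx => (hνhat x).trans hx)
        simp only [hφ_symm _ y]
        exact (hν y).trans hy
    _ = ENNReal.ofReal (2 * R) * τ (Dset φ μ₀ R) := by
        rw [← add_mul, ← ENNReal.ofReal_add hR.le hR.le, two_mul]
end
end

section
/- Estimate on the loss and gel terms for eventually conservative kernels (inequality 'eq:flory-unique-second-fourth'): let K be a coagulation kernel on E and φ : E × E → [0,∞) Borel measurable and symmetric, with K̄(x,y) ≤ c' φ(x,y) for all x,y and some constant c' > 0. Let μ_0, ν, ν̂ be finite positive Borel measures on E such that for every x ∈ E, ∫ φ(x,u) ν(du) ≤ ∫ φ(x,u) μ_0(du) and ∫ φ(x,u) ν̂(du) ≤ ∫ φ(x,u) μ_0(du). Let R > 0, set D_R := {x ∈ E : ∫ φ(x,y) μ_0(dy) ≤ R}, and assume φ(u,v) = K̄(u,v) whenever (u,v) ∉ D_R × D_R. Then for every Borel measurable f : E → ℝ with |f| ≤ 1, | ∫_{E×E}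 f(u) 1_{D_R}(u) (φ(u,v) − K̄(u,v)) d(ν⊗ν)(u,v) − ∫_{E×E} f(u) 1_{D_R}(u) (φ(u,v) − K̄(u,v)) d(ν̂⊗ν̂)(u,v) | ≤ 2 R (c' + 1) ∫_E 1_{D_R}(v) d|ν − ν̂|(v). -/
open MeasureTheory Set

noncomputable section

/-- If a measurable function is bounded by `C` on `D` and vanishes off `D`, its integrals against
two finite measures differ by at most `C` times the total variation of their difference on `D`. -/
theorem abs_integral_sub_integral_le_totalVariation {E : Type*} [MeasurableSpace E]
    (μ ν : Measure E) [IsFiniteMeasure μ] [IsFiniteMeasure ν] {D : Set E} (hD : MeasurableSet D)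
    {C : ℝ} (hC : 0 ≤ C) {h : E → ℝ} (hh : Measurable h)
    (hbound : ∀ x, |h x| ≤ D.indicator (fun _ => C) x) :
    |∫ x, h x ∂μ - ∫ x, h x ∂ν|
      ≤ C * ((μ.toSignedMeasure - ν.toSignedMeasure).totalVariation D).toReal := by
  set s := μ.toSignedMeasure - ν.toSignedMeasure
  set p := s.toJordanDecomposition.posPart
  set n := s.toJordanDecomposition.negPart
  have hint (ρ : Measure E) [IsFiniteMeasure ρ] : Integrable h ρ := by
    refine Integrable.of_bound hh.aestronglyMeasurable C (ae_of_all _ fun x => ?_)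
    exact (hbound x).trans (indicator_le_self' (fun _ _ => hC) x)
  have hle (ρ : Measure E) [IsFiniteMeasure ρ] : |∫ x, h x ∂ρ| ≤ C * ρ.real D := by
    calc |∫ x, h x ∂ρ| ≤ ∫ x, D.indicator (fun _ => C) x ∂ρ :=
          norm_integral_le_of_norm_le (f := h) ((integrable_const C).indicator hD)
            (ae_of_all _ hbound)
      _ = C * ρ.real D := by
          rw [integral_indicator_const _ hD, smul_eq_mul, mul_comm]
  have hsum : μ + n = ν + p := by
    rw [← Measure.toSignedMeasure_eq_toSignedMeasure_iff, Measure.toSignedMeasure_add,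
      Measure.toSignedMeasure_add]
    have hdec : p.toSignedMeasure - n.toSignedMeasure = μ.toSignedMeasure - ν.toSignedMeasure :=
      s.toSignedMeasure_toJordanDecomposition
    rw [sub_eq_iff_eq_add.mp hdec]
    abel
  have hdiff : ∫ x, h x ∂μ - ∫ x, h x ∂ν = ∫ x, h x ∂p - ∫ x, h x ∂n := by
    have hint_sum : ∫ x, h x ∂(μ + n) = ∫ x, h x ∂(ν + p) := by rw [hsum]
    rw [integral_add_measure (hint μ) (hint n), integral_add_measure (hint ν) (hint p)] at hint_sum
    linarith
  have htv : (s.totalVariation D).toReal = p.real D + n.real D := measureReal_add_apply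
  rw [hdiff, htv, mul_add]
  exact (abs_sub _ _).trans (add_le_add (hle p) (hle n))

/-- If the partial integrals of `|g|` against `μ` in the first variable and against `ν` in the
second are bounded by `C` on `D` and vanish off `D`, then the integrals of `g` against `μ ⊗ μ` and
`ν ⊗ ν` differ by at most `2 * C` times the total variation of `μ - ν` on `D`. -/
theorem abs_integral_prod_self_sub_le_totalVariation {E : Type*} [MeasurableSpace E]
    (μ ν : Measure E) [IsFiniteMeasure μ] [IsFiniteMeasure ν] {D : Set E} (hD : MeasurableSet D)
    {C : ℝ} (hC : 0 ≤ C) {g : E × E → ℝ} (hg : Measurable g)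
    (hleft : ∀ v, ∫⁻ u, ‖g (u, v)‖ₑ ∂μ ≤ ENNReal.ofReal (D.indicator (fun _ => C) v))
    (hright : ∀ u, ∫⁻ v, ‖g (u, v)‖ₑ ∂ν ≤ ENNReal.ofReal (D.indicator (fun _ => C) u)) :
    |∫ p, g p ∂(μ.prod μ) - ∫ p, g p ∂(ν.prod ν)|
      ≤ 2 * C * ((μ.toSignedMeasure - ν.toSignedMeasure).totalVariation D).toReal := by
  have hind (x : E) : D.indicator (fun _ => C) x ≤ C := indicator_le_self' (fun _ _ => hC) x
  have hind_nonneg (x : E) : 0 ≤ D.indicator (fun _ => C) x := indicator_nonneg (fun _ _ => hC) x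
  have hconst (ρ : Measure E) [IsFiniteMeasure ρ] : ∫⁻ _, ENNReal.ofReal C ∂ρ < ⊤ := by
    rw [lintegral_const]
    exact ENNReal.mul_lt_top ENNReal.ofReal_lt_top (measure_lt_top _ _)
  have hint_left (ρ : Measure E) [IsFiniteMeasure ρ] : Integrable g (μ.prod ρ) := by
    refine ⟨hg.aestronglyMeasurable, ?_⟩
    rw [HasFiniteIntegral, lintegral_prod_symm _ hg.enorm.aemeasurable]
    exact (lintegral_mono fun v =>
      (hleft v).trans (ENNReal.ofReal_le_ofReal (hind v))).trans_lt (hconst ρ)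
  have hint_right : Integrable g (ν.prod ν) := by
    refine ⟨hg.aestronglyMeasurable, ?_⟩
    rw [HasFiniteIntegral, lintegral_prod _ hg.enorm.aemeasurable]
    exact (lintegral_mono fun u =>
      (hright u).trans (ENNReal.ofReal_le_ofReal (hind u))).trans_lt (hconst ν)
  have habs {ρ : Measure E} {k : E → ℝ} {b : ℝ} (hb : 0 ≤ b)
      (hk : ∫⁻ x, ‖k x‖ₑ ∂ρ ≤ ENNReal.ofReal b) : |∫ x, k x ∂ρ| ≤ b := by
    have henorm := (enorm_integral_le_lintegral_enorm k).trans hk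
    rwa [← ofReal_norm, ENNReal.ofReal_le_ofReal_iff hb] at henorm
  have hfst := abs_integral_sub_integral_le_totalVariation μ ν hD hC
    hg.stronglyMeasurable.integral_prod_left'.measurable
    fun v => habs (hind_nonneg v) (hleft v)
  have hsnd := abs_integral_sub_integral_le_totalVariation μ ν hD hC
    hg.stronglyMeasurable.integral_prod_right'.measurable
    fun u => habs (hind_nonneg u) (hright u)
  rw [← integral_prod_symm g (hint_left μ), ← integral_prod_symm g (hint_left ν)] at hfst
  rw [← integral_prod g (hint_left ν), ← integral_prod g hint_right] at hsnd
  have htri := abs_sub_le (∫ p, g p ∂(μ.prod μ)) (∫ p, g p ∂(μ.prod ν)) (∫ p, g p ∂(ν.prod ν))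
  linarith

/-- **Estimate on the loss and gel terms for eventually conservative kernels**
(inequality `eq:flory-unique-second-fourth`): if `φ = K̄` outside `D_R × D_R`,
then for `|f| ≤ 1`,
`|∫∫ f(u) 1_{D_R}(u) (φ(u,v) − K̄(u,v)) d(ν⊗ν) − ∫∫ f(u) 1_{D_R}(u) (φ(u,v) − K̄(u,v)) d(ν̂⊗ν̂)|
  ≤ 2R(c'+1) ∫ 1_{D_R} d|ν − ν̂|`. -/
theorem loss_gel_term_estimate
    {E : Type*} [MetricSpace E] [MeasurableSpace E] [BorelSpace E]
    [SigmaCompactSpace E]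
    (K : E → E → Measure E)
    (hK_meas : ∀ A : Set E, MeasurableSet A →
      Measurable fun p : E × E => K p.1 p.2 A)
    (hK_fin : ∀ x y, IsFiniteMeasure (K x y))
    (hK_symm : ∀ x y, K x y = K y x)
    (φ : E → E → ℝ)
    (hφ_meas : Measurable fun p : E × E => φ p.1 p.2)
    (hφ_nonneg : ∀ x y, 0 ≤ φ x y)
    (hφ_symm : ∀ x y, φ x y = φ y x)
    (c' : ℝ) (hc' : 0 < c')
    (hKφ : ∀ x y, Kbar K x y ≤ c' * φ x y)
    (μ₀ ν νhat : Measure E)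
    [IsFiniteMeasure μ₀] [IsFiniteMeasure ν] [IsFiniteMeasure νhat]
    (hν : ∀ x : E, ∫⁻ u, ENNReal.ofReal (φ x u) ∂ν
        ≤ ∫⁻ u, ENNReal.ofReal (φ x u) ∂μ₀)
    (hνhat : ∀ x : E, ∫⁻ u, ENNReal.ofReal (φ x u) ∂νhat
        ≤ ∫⁻ u, ENNReal.ofReal (φ x u) ∂μ₀)
    (R : ℝ) (hR : 0 < R)
    (hev : ∀ u v : E, (u, v) ∉ Dset φ μ₀ R ×ˢ Dset φ μ₀ R → φ u v = Kbar K u v)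
    (f : E → ℝ) (hf_meas : Measurable f) (hf_bdd : ∀ x, |f x| ≤ 1) :
    |(∫ p : E × E, Set.indicator (Dset φ μ₀ R) f p.1 *
          (φ p.1 p.2 - Kbar K p.1 p.2) ∂(ν.prod ν))
      - ∫ p : E × E, Set.indicator (Dset φ μ₀ R) f p.1 *
          (φ p.1 p.2 - Kbar K p.1 p.2) ∂(νhat.prod νhat)|
      ≤ 2 * R * (c' + 1) *
          ((ν.toSignedMeasure - νhat.toSignedMeasure).totalVariation
            (Dset φ μ₀ R)).toReal := by
  set D := Dset φ μ₀ R
  have hD : MeasurableSet D :=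
    measurableSet_le hφ_meas.ennreal_ofReal.lintegral_prod_right' measurable_const
  have hKbar : Measurable fun p : E × E => Kbar K p.1 p.2 :=
    (hK_meas _ MeasurableSet.univ).ennreal_toReal
  have hg : Measurable fun p : E × E => D.indicator f p.1 * (φ p.1 p.2 - Kbar K p.1 p.2) :=
    ((hf_meas.indicator hD).comp measurable_fst).mul (hφ_meas.sub hKbar)
  have hpoint (u v : E) :
      |D.indicator f u * (φ u v - Kbar K u v)| ≤ (c' + 1) * φ u v := by
    have hind : |D.indicator f u| ≤ 1 := by
      by_cases hu : u ∈ D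
      · simpa [hu] using hf_bdd u
      · simp [hu]
    have hKnn : 0 ≤ Kbar K u v := ENNReal.toReal_nonneg
    have hsub : |φ u v - Kbar K u v| ≤ (c' + 1) * φ u v := by
      have hcφ := mul_nonneg hc'.le (hφ_nonneg u v)
      rw [abs_le]
      constructor <;> linarith [hKφ u v, hφ_nonneg u v]
    rw [abs_mul]
    exact (mul_le_of_le_one_left (abs_nonneg _) hind).trans hsub
  have hzero (u v : E) (huv : u ∉ D ∨ v ∉ D) :
      D.indicator f u * (φ u v - Kbar K u v) = 0 := by
    rw [hev u v fun hmem => huv.elim (· hmem.1) (· hmem.2), sub_self, mul_zero]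
  have hpartial (ρ : Measure E)
      (hρ : ∀ x, ∫⁻ u, ENNReal.ofReal (φ x u) ∂ρ ≤ ∫⁻ u, ENNReal.ofReal (φ x u) ∂μ₀)
      (x : E) (k : E → ℝ) (hk : ∀ y, |k y| ≤ (c' + 1) * φ x y) (hk0 : x ∉ D → ∀ y, k y = 0) :
      ∫⁻ y, ‖k y‖ₑ ∂ρ ≤ ENNReal.ofReal (D.indicator (fun _ => R * (c' + 1)) x) := by
    by_cases hx : x ∈ D
    · calc ∫⁻ y, ‖k y‖ₑ ∂ρ
          ≤ ∫⁻ y, ENNReal.ofReal (c' + 1) * ENNReal.ofReal (φ x y) ∂ρ := by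
            refine lintegral_mono fun y => ?_
            rw [← ENNReal.ofReal_mul (by positivity), ← ofReal_norm]
            exact ENNReal.ofReal_le_ofReal (hk y)
        _ = ENNReal.ofReal (c' + 1) * ∫⁻ y, ENNReal.ofReal (φ x y) ∂ρ :=
            lintegral_const_mul' _ _ ENNReal.ofReal_ne_top
        _ ≤ ENNReal.ofReal (c' + 1) * ENNReal.ofReal R := by
            gcongr
            exact (hρ x).trans hx
        _ = ENNReal.ofReal (D.indicator (fun _ => R * (c' + 1)) x) := by
            rw [indicator_of_mem hx, ← ENNReal.ofReal_mul (by positivity), mul_comm]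
    · simp [hk0 hx]
  rw [mul_assoc 2 R]
  refine abs_integral_prod_self_sub_le_totalVariation ν νhat hD (by positivity) hg
    (fun v => hpartial ν hν v _ (fun u => ?_) fun hv u => hzero u v (.inr hv))
    fun u => hpartial νhat hνhat u _ (hpoint u) fun hu v => hzero u v (.inl hu)
  rw [hφ_symm v u]
  exact hpoint u v
end
end
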